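/- arXiv:1604.00338 — 3 statements merged into one kernel-verified Lean document; each statement's English description precedes it below -/
import Mathlib

section
/- Let K be a field of characteristic zero and q ∈ K a nonzero element transcendental over ℚ. Let 𝓘 and 𝓚 be homogeneous families (multisets) of corteges for m,n, and let α : 𝓘 → ℤ and β : 𝓚 → ℤ. If the quadruple (𝓘, 𝓚, α, β) is not q-balanced, then there exist an associative unital K-algebra A and an m×n q-matrix x with entries in A for which Σ_{(I|J,I'|J') ∈ 𝓘} q^{α(I|J,I'|J')} [I|J]·[I'|J'] ≠ Σ_{(K|L,K'|L') ∈ 𝓚} q^{β(K|L,K'|L')} [K|L]·[K'|L'] (sums taken with multiplicities). -/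
/-- Number of inversions of a permutation of `Fin k`. -/
def permInversions {k : ℕ} (σ : Equiv.Perm (Fin k)) : ℕ :=
  (Finset.univ.filter (fun p : Fin k × Fin k => p.1 < p.2 ∧ σ p.2 < σ p.1)).card

/-- The quantum minor `[I|J]_q` of a matrix `x` (indexed by `ℕ`, rows/columns `1,…`),
with row set `I` and column set `J` (both listed in increasing order). -/
noncomputable def qMinor {K : Type} [Field K] {A : Type} [Ring A] [Algebra K A]
    (q : K) (x : ℕ → ℕ → A) (I J : Finset ℕ) : A :=
  if h : I.card = J.card then
    ∑ σ : Equiv.Perm (Fin I.card),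
      ((-q) ^ permInversions σ) •
        (List.ofFn (fun d : Fin I.card =>
          x (I.orderEmbOfFin rfl d) (J.orderEmbOfFin h.symm (σ d)))).prod
  else 0

/-- The flag quantum minor `[J]_q := [{1,…,|J|} | J]_q`. -/
noncomputable def flagMinor {K : Type} [Field K] {A : Type} [Ring A] [Algebra K A]
    (q : K) (x : ℕ → ℕ → A) (J : Finset ℕ) : A :=
  qMinor q x (Finset.Icc 1 J.card) J

/-- Manin's relations: `x` is an `m × n` `q`-matrix. -/
def IsQMatrix {K : Type} [Field K] {A : Type} [Ring A] [Algebra K A]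
    (q : K) (m n : ℕ) (x : ℕ → ℕ → A) : Prop :=
  (∀ i j k, 1 ≤ i → i ≤ m → 1 ≤ j → j < k → k ≤ n →
    x i j * x i k = q • (x i k * x i j)) ∧
  (∀ i l j, 1 ≤ i → i < l → l ≤ m → 1 ≤ j → j ≤ n →
    x i j * x l j = q • (x l j * x i j)) ∧
  (∀ i l j k, 1 ≤ i → i < l → l ≤ m → 1 ≤ j → j < k → k ≤ n →
    x i k * x l j = x l j * x i k) ∧
  (∀ i l j k, 1 ≤ i → i < l → l ≤ m → 1 ≤ j → j < k → k ≤ n →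
    x i j * x l k - x l k * x i j = (q - q⁻¹) • (x i k * x l j))

/-- A cortege `(I|J, I'|J')` for `m,n`. -/
structure Cortege (m n : ℕ) where
  I : Finset ℕ
  J : Finset ℕ
  I' : Finset ℕ
  J' : Finset ℕ
  hIm : I ⊆ Finset.Icc 1 m
  hI'm : I' ⊆ Finset.Icc 1 m
  hJn : J ⊆ Finset.Icc 1 n
  hJ'n : J' ⊆ Finset.Icc 1 n
  hIJ : I.card = J.card
  hI'J' : I'.card = J'.card

/-- Elements of the ground set `Y^r ⊔ Y^c`: `Sum.inl i` is a row index, `Sum.inr j`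
a column index. -/
abbrev Elt := ℕ ⊕ ℕ

/-- The linear order on `Y^r ⊔ Y^c`: rows in increasing order first, then columns
in decreasing order. -/
def cLT : Elt → Elt → Prop
  | Sum.inl i, Sum.inl i' => i < i'
  | Sum.inl _, Sum.inr _ => True
  | Sum.inr _, Sum.inl _ => False
  | Sum.inr j, Sum.inr j' => j' < j

instance : DecidableRel cLT := fun a b =>
  match a, b with
  | Sum.inl i, Sum.inl i' => inferInstanceAs (Decidable (i < i'))
  | Sum.inl _, Sum.inr _ => inferInstanceAs (Decidable True)
  | Sum.inr _, Sum.inl _ => inferInstanceAs (Decidable False)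
  | Sum.inr j, Sum.inr j' => inferInstanceAs (Decidable (j' < j))

/-- Two elements lie on the same side (both rows or both columns). -/
abbrev sameSide (a b : Elt) : Prop := a.isLeft = b.isLeft

/-- The underlying numerical index of an element. -/
abbrev eVal : Elt → ℕ := Sum.elim id id

/-- The numerically smaller member of a couple (used for couples lying in one side). -/
def numMin (p : Elt × Elt) : Elt := if eVal p.1 ≤ eVal p.2 then p.1 else p.2

namespace Cortege
variable {m n : ℕ}

/-- White elements of the refinement: `I° = I - I'` (rows) and `J° = J - J'` (columns). -/
def whites (S : Cortege m n) : Finset Elt :=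
  (S.I \ S.I').image Sum.inl ∪ (S.J \ S.J').image Sum.inr

/-- Black elements of the refinement: `I• = I' - I` (rows) and `J• = J' - J` (columns). -/
def blacks (S : Cortege m n) : Finset Elt :=
  (S.I' \ S.I).image Sum.inl ∪ (S.J' \ S.J).image Sum.inr

/-- The ground set `Y^r ⊔ Y^c` of a cortege. -/
def ground (S : Cortege m n) : Finset Elt := S.whites ∪ S.blacks

end Cortege

/-- `M` is a feasible matching for the cortege `S`.  Couples are stored as pairs
`(a, b)` with `a` preceding `b` in the linear order `cLT`. -/
def IsFeasible {m n : ℕ} (S : Cortege m n) (M : Finset (Elt × Elt)) : Prop :=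
  (∀ p ∈ M, p.1 ∈ S.ground ∧ p.2 ∈ S.ground ∧ cLT p.1 p.2) ∧
  (∀ y ∈ S.ground, ∃! p, p ∈ M ∧ (p.1 = y ∨ p.2 = y)) ∧
  (∀ p ∈ M, (sameSide p.1 p.2 → (p.1 ∈ S.whites ↔ p.2 ∈ S.blacks)) ∧
            (¬ sameSide p.1 p.2 → (p.1 ∈ S.whites ↔ p.2 ∈ S.whites))) ∧
  (∀ p ∈ M, ∀ p' ∈ M, ¬ (cLT p.1 p'.1 ∧ cLT p'.1 p.2 ∧ cLT p.2 p'.2))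

/-- The set of elements covered by a set of couples. -/
def coveredBy (Φ : Finset (Elt × Elt)) : Finset Elt :=
  Φ.image Prod.fst ∪ Φ.image Prod.snd

/-- `T` is obtained from `S` by the index exchange operation using the couples `Φ`:
the intersections and unions of the row (resp. column) sets are unchanged, and
the white/black color is flipped exactly on the elements covered by `Φ`. -/
def IsExchange {m n : ℕ} (S T : Cortege m n) (Φ : Finset (Elt × Elt)) : Prop :=
  S.I ∩ S.I' = T.I ∩ T.I' ∧ S.J ∩ S.J' = T.J ∩ T.J' ∧
  S.I ∪ S.I' = T.I ∪ T.I' ∧ S.J ∪ S.J' = T.J ∪ T.J' ∧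
  ∀ a ∈ S.ground,
    (a ∈ coveredBy Φ → (a ∈ S.whites ↔ a ∈ T.blacks)) ∧
    (a ∉ coveredBy Φ → (a ∈ S.whites ↔ a ∈ T.whites))

/-- The couples of `M` on which the white/black colorings of `S` and `T` differ. -/
def differSet {m n : ℕ} (S T : Cortege m n) (M : Finset (Elt × Elt)) :
    Finset (Elt × Elt) :=
  M.filter (fun p =>
    ¬ (p.1 ∈ S.whites ↔ p.1 ∈ T.whites) ∨ ¬ (p.2 ∈ S.whites ↔ p.2 ∈ T.whites))

/-- `ζ°(S;Φ)`: the number of couples of `Φ` lying within one side whose numerically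
smaller element is white. -/
def zetaWhite {m n : ℕ} (S : Cortege m n) (Φ : Finset (Elt × Elt)) : ℕ :=
  (Φ.filter (fun p => sameSide p.1 p.2 ∧ numMin p ∈ S.whites)).card

/-- `ζ•(S;Φ)`: the number of couples of `Φ` lying within one side whose numerically
smaller element is black. -/
def zetaBlack {m n : ℕ} (S : Cortege m n) (Φ : Finset (Elt × Elt)) : ℕ :=
  (Φ.filter (fun p => sameSide p.1 p.2 ∧ numMin p ∈ S.blacks)).card

/-- Configurations for an (indexed) family of corteges: pairs of a member of the family
and a feasible matching for it. -/
def Config {m n : ℕ} {ι : Type} (F : ι → Cortege m n) : Type :=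
  {p : ι × Finset (Elt × Elt) // IsFeasible (F p.1) p.2}

/-- The quadruple `(F, G, α, β)` is `q`-balanced. -/
def QBalanced {m n : ℕ} {ι κ : Type} (F : ι → Cortege m n) (G : κ → Cortege m n)
    (α : ι → ℤ) (β : κ → ℤ) : Prop :=
  ∃ γ : Config F ≃ Config G, ∀ c : Config F,
    ((γ c).1.2 = c.1.2) ∧
    IsExchange (F c.1.1) (G (γ c).1.1) (differSet (F c.1.1) (G (γ c).1.1) c.1.2) ∧
    β (γ c).1.1 - α c.1.1 =
      (zetaWhite (F c.1.1) (differSet (F c.1.1) (G (γ c).1.1) c.1.2) : ℤ) -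
      (zetaBlack (F c.1.1) (differSet (F c.1.1) (G (γ c).1.1) c.1.2) : ℤ)

/-- The two families `F`, `G` are (jointly) homogeneous. -/
def Homogeneous {m n : ℕ} {ι κ : Type} (F : ι → Cortege m n) (G : κ → Cortege m n) : Prop :=
  ∀ S T : Cortege m n,
    ((∃ i, F i = S) ∨ (∃ k, G k = S)) → ((∃ i, F i = T) ∨ (∃ k, G k = T)) →
    S.I ∪ S.I' = T.I ∪ T.I' ∧ S.I ∩ S.I' = T.I ∩ T.I' ∧
    S.J ∪ S.J' = T.J ∪ T.J' ∧ S.J ∩ S.J' = T.J ∩ T.J'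

namespace QMinors

section Expansion

variable {K : Type} [Field K] {A : Type} [Ring A] [Algebra K A]

/-- The permutation of `Fin (k + 1)` sending `0` to `p` and acting on the remaining indices as `τ`,
after the order-preserving identification of the complement of `p` with `Fin k`. -/
def permCons {k : ℕ} (p : Fin (k + 1)) (τ : Equiv.Perm (Fin k)) : Equiv.Perm (Fin (k + 1)) :=
  p.cycleRange.symm * Equiv.Perm.decomposeFin.symm (0, τ)

theorem permCons_zero {k : ℕ} (p : Fin (k + 1)) (τ : Equiv.Perm (Fin k)) :
    permCons p τ 0 = p := by
  simp [permCons]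

theorem permCons_succ {k : ℕ} (p : Fin (k + 1)) (τ : Equiv.Perm (Fin k)) (e : Fin k) :
    permCons p τ e.succ = p.succAbove (τ e) := by
  simp [permCons, Equiv.Perm.decomposeFin_symm_apply_succ]

theorem permCons_bijective (k : ℕ) :
    Function.Bijective (fun t : Fin (k + 1) × Equiv.Perm (Fin k) => permCons t.1 t.2) := by
  rw [Fintype.bijective_iff_injective_and_card]
  constructor
  · rintro ⟨p, τ⟩ ⟨p', τ'⟩ h
    have h0 : p = p' := by
      have := DFunLike.congr_fun h 0
      simpa [permCons_zero] using this
    subst h0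
    have : τ = τ' := by
      ext e
      have := DFunLike.congr_fun h e.succ
      simp only [permCons_succ] at this
      rw [Fin.succAbove_right_injective this]
    rw [this]
  · simp [Fintype.card_perm, Nat.factorial_succ]

theorem permInversions_permCons {k : ℕ} (p : Fin (k + 1)) (τ : Equiv.Perm (Fin k)) :
    permInversions (permCons p τ) = p + permInversions τ := by
  have hp : (p : ℕ) = (Finset.univ.filter (fun e : Fin k => p.succAbove (τ e) < p)).card := by
    have h1 : (Finset.univ.filter (fun e : Fin k => p.succAbove (τ e) < p)).card =
        (Finset.univ.filter (fun e : Fin k => p.succAbove e < p)).card := by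
      refine Finset.card_equiv τ ?_
      simp
    rw [h1]
    have h2 : (Finset.univ.filter (fun e : Fin k => p.succAbove e < p)).card =
        (Finset.range p).card := by
      refine Finset.card_bij (fun e _ => (e : ℕ)) ?_ ?_ ?_
      · intro e he
        simp only [Finset.mem_filter, Finset.mem_univ, true_and, Fin.succAbove_lt_iff_castSucc_lt]
          at he
        simpa [Fin.lt_def] using he
      · intro a _ b _ h
        exact Fin.ext h
      · intro b hb
        have hb' : b < (p : ℕ) := by simpa using hb
        have := p.2
        refine ⟨⟨b, by omega⟩, ?_, rfl⟩
        simp only [Finset.mem_filter, Finset.mem_univ, true_and, Fin.succAbove_lt_iff_castSucc_lt]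
        exact hb'
    rw [h2, Finset.card_range]
  unfold permInversions
  simp only [Finset.card_filter] at hp ⊢
  rw [Fintype.sum_prod_type, Fin.sum_univ_succ]
  congr 1
  · rw [Fin.sum_univ_succ]
    simp only [permCons_zero, permCons_succ, lt_self_iff_false, false_and, if_false, zero_add,
      Fin.succ_pos, true_and]
    exact hp.symm
  · rw [Fintype.sum_prod_type]
    refine Finset.sum_congr rfl fun i _ => ?_
    rw [Fin.sum_univ_succ]
    simp [permCons_succ]

/-- The signed `q`-sum over permutations of row-ordered products of a `k × k` array. -/
noncomputable def permSum (q : K) (k : ℕ) (X : Fin k → Fin k → A) : A :=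
  ∑ σ : Equiv.Perm (Fin k), ((-q) ^ permInversions σ) • (List.ofFn fun d => X d (σ d)).prod

theorem permSum_succ (q : K) (k : ℕ) (X : Fin (k + 1) → Fin (k + 1) → A) :
    permSum q (k + 1) X = ∑ p : Fin (k + 1), ((-q) ^ (p : ℕ)) •
      (X 0 p * permSum q k fun d e => X d.succ (p.succAbove e)) := by
  unfold permSum
  rw [← Function.Bijective.sum_comp (permCons_bijective k), Fintype.sum_prod_type]
  refine Finset.sum_congr rfl fun p _ => ?_
  rw [Finset.mul_sum, Finset.smul_sum]
  refine Finset.sum_congr rfl fun τ _ => ?_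
  simp only [List.ofFn_succ, List.prod_cons, permInversions_permCons, permCons_zero,
    permCons_succ, pow_add, mul_smul, mul_smul_comm]

/-- The quantum minor with rows listed in `L` and column set `J`, expanded along the first row. -/
noncomputable def rowMinor (q : K) (x : ℕ → ℕ → A) : List ℕ → Finset ℕ → A
  | [], J => if J = ∅ then 1 else 0
  | i :: L, J => ∑ k ∈ J, ((-q) ^ (J.filter (· < k)).card) • (x i k * rowMinor q x L (J.erase k))

theorem rowMinor_eq_zero (q : K) (x : ℕ → ℕ → A) (L : List ℕ) (J : Finset ℕ)
    (h : L.length ≠ J.card) : rowMinor q x L J = 0 := by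
  induction L generalizing J with
  | nil =>
    rw [rowMinor, if_neg]
    rintro rfl
    simp at h
  | cons i L ih =>
    rw [rowMinor]
    refine Finset.sum_eq_zero fun k hk => ?_
    rw [ih, mul_zero, smul_zero]
    have := Finset.card_erase_add_one hk
    simp only [List.length_cons] at h
    omega

theorem card_filter_lt_orderEmbOfFin {k : ℕ} (J : Finset ℕ) (h : J.card = k) (p : Fin k) :
    (J.filter (· < J.orderEmbOfFin h p)).card = p := by
  have : J.filter (· < J.orderEmbOfFin h p) =
      (Finset.Iio p).map (J.orderEmbOfFin h).toEmbedding := by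
    ext a
    simp only [Finset.mem_filter, Finset.mem_map, Finset.mem_Iio]
    constructor
    · rintro ⟨ha, hlt⟩
      have : a ∈ Set.range (J.orderEmbOfFin h) := by simpa using ha
      obtain ⟨e, rfl⟩ := this
      exact ⟨e, by simpa using hlt, rfl⟩
    · rintro ⟨e, he, rfl⟩
      exact ⟨J.orderEmbOfFin_mem h e, by simpa using he⟩
  rw [this, Finset.card_map, Fin.card_Iio]

theorem permSum_eq_rowMinor (q : K) (x : ℕ → ℕ → A) (k : ℕ) (r : Fin k → ℕ) (J : Finset ℕ)
    (h : J.card = k) :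
    permSum q k (fun d e => x (r d) (J.orderEmbOfFin h e)) = rowMinor q x (List.ofFn r) J := by
  induction k generalizing J with
  | zero =>
    have : J = ∅ := Finset.card_eq_zero.1 h
    subst this
    simp [permSum, rowMinor, permInversions]
  | succ k ih =>
    rw [permSum_succ, List.ofFn_succ, rowMinor]
    have hJ : J = Finset.univ.map (J.orderEmbOfFin h).toEmbedding := by
      ext a
      have : a ∈ Set.range (J.orderEmbOfFin h) ↔ a ∈ J := by simp
      rw [← this]
      simp
    conv_rhs => rw [show (∑ k ∈ J, ((-q) ^ (J.filter (· < k)).card) •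
      (x (r 0) k * rowMinor q x (List.ofFn fun i => r i.succ) (J.erase k))) =
      ∑ k ∈ Finset.univ.map (J.orderEmbOfFin h).toEmbedding, ((-q) ^ (J.filter (· < k)).card) •
      (x (r 0) k * rowMinor q x (List.ofFn fun i => r i.succ) (J.erase k)) by rw [← hJ]]
    rw [Finset.sum_map]
    refine Finset.sum_congr rfl fun p _ => ?_
    have hc : (J.erase (J.orderEmbOfFin h p)).card = k := by
      rw [Finset.card_erase_of_mem (J.orderEmbOfFin_mem h p), h]; rfl
    have he := Finset.orderEmbOfFin_unique hc
      (f := fun e => J.orderEmbOfFin h (p.succAbove e)) (fun e => by simp [Fin.succAbove_ne])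
      ((J.orderEmbOfFin h).strictMono.comp (Fin.strictMono_succAbove p))
    have := ih (fun d => r d.succ) _ hc
    rw [← he] at this
    simp only [RelEmbedding.coe_toEmbedding, card_filter_lt_orderEmbOfFin, this]

theorem qMinor_eq_rowMinor (q : K) (x : ℕ → ℕ → A) (I J : Finset ℕ) :
    qMinor q x I J = rowMinor q x (List.ofFn (I.orderEmbOfFin rfl)) J := by
  unfold qMinor
  split_ifs with h
  · exact permSum_eq_rowMinor q x _ _ J h.symm
  · rw [rowMinor_eq_zero]
    simpa using h

end Expansion

section ColumnOperation

variable {K : Type} [Field K] {A : Type} [Ring A] [Algebra K A]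

/-- The matrix obtained from `x` by right multiplication with the block `!![a, b; c, d]` placed in
rows and columns `j, j + 1`. -/
def colMul (x : ℕ → ℕ → A) (j : ℕ) (a b c d : A) : ℕ → ℕ → A := fun i k =>
  if k = j then x i j * a + x i (j + 1) * c
  else if k = j + 1 then x i j * b + x i (j + 1) * d
  else x i k

/-- A `2 × 2` `q`-matrix of quantum determinant one. -/
structure IsQBlock (q : K) (a b c d : A) : Prop where
  ab : a * b = q • (b * a)
  cd : c * d = q • (d * c)
  ac : a * c = q • (c * a)
  bd : b * d = q • (d * b)
  bc : b * c = c * b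
  ad : a * d = 1 + q • (b * c)
  da : d * a = 1 + q⁻¹ • (b * c)

/-- The minor with column set `J` and columns `j`, `j + 1` added according to two Booleans. -/
def addCols (J : Finset ℕ) (j : ℕ) (s t : Bool) : Finset ℕ :=
  J ∪ (if s then {j} else ∅) ∪ (if t then {j + 1} else ∅)

theorem rowMinor_cons_addCols (q : K) (x : ℕ → ℕ → A) (i : ℕ) (L : List ℕ) (J : Finset ℕ) (j : ℕ)
    (hj : j ∉ J) (hj' : j + 1 ∉ J) (s t : Bool) :
    rowMinor q x (i :: L) (addCols J j s t) =
      (∑ k ∈ J, ((-q) ^ ((addCols J j s t).filter (· < k)).card) •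
        (x i k * rowMinor q x L (addCols (J.erase k) j s t))) +
      (if s then ((-q) ^ (J.filter (· < j)).card) •
        (x i j * rowMinor q x L (addCols J j false t)) else 0) +
      (if t then ((-q) ^ ((J.filter (· < j)).card + if s then 1 else 0)) •
        (x i (j + 1) * rowMinor q x L (addCols J j s false)) else 0) := by
  have hjj : J.filter (· < j + 1) = J.filter (· < j) := by
    ext k
    simp only [Finset.mem_filter, and_congr_right_iff]
    intro hk
    have : k ≠ j := fun h => hj (h ▸ hk)
    omega
  have key : ∀ J' : Finset ℕ, (∀ k, k ∈ J' → k ∉ J) → ∀ f : ℕ → A,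
      ∑ k ∈ J ∪ J', f k = ∑ k ∈ J, f k + ∑ k ∈ J', f k := fun J' h f =>
    Finset.sum_union (Finset.disjoint_right.2 h)
  have herase : ∀ k ∈ J, (addCols J j s t).erase k = addCols (J.erase k) j s t := by
    intro k hk
    have h1 : k ≠ j := fun h => hj (h ▸ hk)
    have h2 : k ≠ j + 1 := fun h => hj' (h ▸ hk)
    ext l
    cases s <;> cases t <;> simp [addCols] <;> grind
  rw [rowMinor]
  have h3 : addCols J j s t = J ∪ ((if s then {j} else ∅) ∪ (if t then {j + 1} else ∅)) := by
    rw [addCols, Finset.union_assoc]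
  conv_lhs => rw [h3]
  rw [key _ (by cases s <;> cases t <;> simp [hj, hj'])]
  rw [← h3, add_assoc]
  congr 1
  · exact Finset.sum_congr rfl fun k hk => by rw [herase k hk]
  · have e1 : ∀ t, (addCols J j true t).erase j = addCols J j false t := by
      intro t
      ext l
      cases t <;> simp [addCols] <;> grind
    have e2 : ∀ s, (addCols J j s true).erase (j + 1) = addCols J j s false := by
      intro s
      ext l
      cases s <;> simp [addCols] <;> grind
    have c1 : ∀ s t, (addCols J j s t).filter (· < j) = J.filter (· < j) := by
      intro s t
      ext l
      cases s <;> cases t <;> simp [addCols] <;> grind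
    have c2 : ∀ s, ((addCols J j s true).filter (· < j + 1)).card =
        (J.filter (· < j)).card + if s then 1 else 0 := by
      intro s
      cases s
      · rw [← hjj]
        congr 1
        ext l
        simp [addCols]
        grind
      · have : (addCols J j true true).filter (· < j + 1) = insert j (J.filter (· < j)) := by
          rw [← hjj]
          ext l
          simp [addCols]
          grind
        rw [this, Finset.card_insert_of_notMem (by simp)]
        simp
    cases s <;> cases t <;> simp [e1, e2, c1, c2, -Order.lt_add_one_iff]

/-- The effect of a column operation by a quantum block of determinant one on minors. -/
theorem rowMinor_colMul {q : K} (hq : q ≠ 0) {a b c d : A} (hB : IsQBlock q a b c d)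
    (x : ℕ → ℕ → A)
    (hx : ∀ i k, Commute a (x i k) ∧ Commute b (x i k) ∧ Commute c (x i k) ∧ Commute d (x i k))
    (j : ℕ) (L : List ℕ) (J : Finset ℕ) (hj : j ∉ J) (hj' : j + 1 ∉ J) :
    let z := colMul x j a b c d
    rowMinor q z L (addCols J j false false) = rowMinor q x L (addCols J j false false) ∧
    rowMinor q z L (addCols J j true false) =
      rowMinor q x L (addCols J j true false) * a + rowMinor q x L (addCols J j false true) * c ∧
    rowMinor q z L (addCols J j false true) =
      rowMinor q x L (addCols J j true false) * b + rowMinor q x L (addCols J j false true) * d ∧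
    rowMinor q z L (addCols J j true true) = rowMinor q x L (addCols J j true true) := by
  intro z
  have hcomm : ∀ e : A, (∀ i k, Commute e (x i k)) → ∀ L J, Commute e (rowMinor q x L J) := by
    intro e he L
    induction L with
    | nil =>
      intro J
      rw [rowMinor]
      split_ifs
      · exact Commute.one_right e
      · exact Commute.zero_right e
    | cons i L ih =>
      intro J
      rw [rowMinor]
      exact Commute.sum_right _ _ _ fun k _ => ((he i k).mul_right (ih _)).smul_right _
  have ca := hcomm a fun i k => (hx i k).1
  have cb := hcomm b fun i k => (hx i k).2.1
  have cc := hcomm c fun i k => (hx i k).2.2.1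
  have cd := hcomm d fun i k => (hx i k).2.2.2
  have zj : ∀ i, z i j = x i j * a + x i (j + 1) * c := fun i => by simp [z, colMul]
  have zj' : ∀ i, z i (j + 1) = x i j * b + x i (j + 1) * d := fun i => by simp [z, colMul]
  have zk : ∀ i, ∀ k, k ≠ j → k ≠ j + 1 → z i k = x i k := fun i k h h' => by
    simp [z, colMul, h, h']
  induction L generalizing J with
  | nil =>
    refine ⟨rfl, ?_, ?_, ?_⟩
    all_goals simp [rowMinor, addCols]
  | cons i L ih =>
    have hne : ∀ k ∈ J, k ≠ j ∧ k ≠ j + 1 := fun k hk =>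
      ⟨fun h => hj (h ▸ hk), fun h => hj' (h ▸ hk)⟩
    have hcard : ∀ k ∈ J, (((addCols J j true false).filter (· < k)).card =
        ((addCols J j false true).filter (· < k)).card) := by
      intro k hk
      have := hne k hk
      by_cases hlt : k < j
      · congr 1
        ext l
        simp [addCols]
        grind
      · have h1 : (addCols J j true false).filter (· < k) = insert j (J.filter (· < k)) := by
          ext l
          simp [addCols]
          grind
        have h2 : (addCols J j false true).filter (· < k) = insert (j + 1) (J.filter (· < k)) := by
          ext l
          simp [addCols]
          grind
        rw [h1, h2, Finset.card_insert_of_notMem (by simp [hj]),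
          Finset.card_insert_of_notMem (by simp [hj'])]
    have ihJ := ih J hj hj'
    have ihk := fun k => ih (J.erase k) (fun h => hj (Finset.mem_of_mem_erase h))
      (fun h => hj' (Finset.mem_of_mem_erase h))
    simp only [rowMinor_cons_addCols _ _ _ _ _ _ hj hj', ihJ, zj, zj']
    have hsum1 : ∀ s t, (s = t) → ∑ k ∈ J, (-q) ^ ((addCols J j s t).filter (· < k)).card •
        (z i k * rowMinor q z L (addCols (J.erase k) j s t)) =
        ∑ k ∈ J, (-q) ^ ((addCols J j s t).filter (· < k)).card •
        (x i k * rowMinor q x L (addCols (J.erase k) j s t)) := by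
      rintro s _ rfl
      refine Finset.sum_congr rfl fun k hk => ?_
      rw [zk i k (hne k hk).1 (hne k hk).2]
      cases s
      · rw [(ihk k).1]
      · rw [(ihk k).2.2.2]
    have hsum2 : ∀ f : ℕ → A,
        ∑ k ∈ J, (-q) ^ ((addCols J j true false).filter (· < k)).card • f k =
        ∑ k ∈ J, (-q) ^ ((addCols J j false true).filter (· < k)).card • f k := fun f =>
      Finset.sum_congr rfl fun k hk => by rw [hcard k hk]
    refine ⟨?_, ?_, ?_, ?_⟩
    · simp [hsum1]
    · rw [Finset.sum_congr rfl fun k hk => by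
        rw [zk i k (hne k hk).1 (hne k hk).2, (ihk k).2.1]]
      simp only [hsum2, add_mul, Finset.sum_mul, mul_add, smul_add, Finset.sum_add_distrib,
        smul_mul_assoc, if_true, Bool.false_eq_true, if_false, add_zero, mul_assoc,
        (ca _ _).eq, (cc _ _).eq]
      abel
    · rw [Finset.sum_congr rfl fun k hk => by
        rw [zk i k (hne k hk).1 (hne k hk).2, (ihk k).2.2.1]]
      simp only [hsum2, add_mul, Finset.sum_mul, mul_add, smul_add, Finset.sum_add_distrib,
        smul_mul_assoc, if_true, Bool.false_eq_true, if_false, add_zero, mul_assoc,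
        (cb _ _).eq, (cd _ _).eq]
      abel
    · rw [hsum1 true true rfl]
      simp only [if_true, pow_succ, mul_smul]
      have p1 : ∀ u v : A, ∀ e f : A, Commute e v → (u * e) * (v * f) = (u * v) * (e * f) := by
        intro u v e f h
        rw [mul_assoc, ← mul_assoc e, h.eq, mul_assoc, mul_assoc]
      simp only [add_assoc]
      congr 1
      simp only [add_mul, mul_add, p1 _ _ _ _ (ca _ _), p1 _ _ _ _ (cb _ _), p1 _ _ _ _ (cc _ _),
        p1 _ _ _ _ (cd _ _), hB.ab, hB.cd, hB.ad, hB.da, hB.bc]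
      simp only [mul_smul_comm, mul_one]
      match_scalars <;> field_simp <;> ring

theorem IsQMatrix.map {B : Type} [Ring B] [Algebra K B] {q : K} {m n : ℕ} {x : ℕ → ℕ → A}
    (h : IsQMatrix q m n x) (f : A →ₐ[K] B) : IsQMatrix q m n fun i j => f (x i j) := by
  obtain ⟨h1, h2, h3, h4⟩ := h
  refine ⟨?_, ?_, ?_, ?_⟩
  · intro i j k a b c d e
    rw [← map_mul, h1 i j k a b c d e, map_smul, map_mul]
  · intro i l j a b c d e
    rw [← map_mul, h2 i l j a b c d e, map_smul, map_mul]
  · intro i l j k a b c d e g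
    rw [← map_mul, h3 i l j k a b c d e g, map_mul]
  · intro i l j k a b c d e g
    rw [← map_mul, ← map_mul, ← map_sub, h4 i l j k a b c d e g, map_smul, map_mul]

theorem rowMinor_map {B : Type} [Ring B] [Algebra K B] (q : K) (x : ℕ → ℕ → A) (f : A →ₐ[K] B)
    (L : List ℕ) (J : Finset ℕ) :
    rowMinor q (fun i j => f (x i j)) L J = f (rowMinor q x L J) := by
  induction L generalizing J with
  | nil => simp [rowMinor, apply_ite f]
  | cons i L ih => simp [rowMinor, ih]

theorem mul_mul_mul_of_commute {u v e f : A} (h : Commute e v) :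
    (u * e) * (v * f) = (u * v) * (e * f) := by
  rw [mul_assoc, ← mul_assoc e, h.eq, mul_assoc, mul_assoc]

theorem mul_mul_of_commute {u v e : A} (h : Commute e v) : (u * e) * v = (u * v) * e := by
  rw [mul_assoc, h.eq, mul_assoc]

theorem isQMatrix_colMul {q : K} (hq : q ≠ 0) {a b c d : A} (hB : IsQBlock q a b c d)
    {m n : ℕ} {x : ℕ → ℕ → A} (h : IsQMatrix q m n x)
    (hx : ∀ i k, Commute a (x i k) ∧ Commute b (x i k) ∧ Commute c (x i k) ∧ Commute d (x i k))
    {j : ℕ} (hj : 1 ≤ j) (hjn : j + 1 ≤ n) :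
    IsQMatrix q m n (colMul x j a b c d) := by
  obtain ⟨h1, h2, h3, h4⟩ := h
  have h4' : ∀ i l j k, 1 ≤ i → i < l → l ≤ m → 1 ≤ j → j < k → k ≤ n →
      x i j * x l k = x l k * x i j + (q - q⁻¹) • (x i k * x l j) :=
    fun i l j k a b c d e g => by rw [← h4 i l j k a b c d e g]; abel
  have ca := fun i k => (hx i k).1
  have cb := fun i k => (hx i k).2.1
  have cc := fun i k => (hx i k).2.2.1
  have cd := fun i k => (hx i k).2.2.2
  have zj : ∀ i, colMul x j a b c d i j = x i j * a + x i (j + 1) * c := fun i => by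
    simp [colMul]
  have zj' : ∀ i, colMul x j a b c d i (j + 1) = x i j * b + x i (j + 1) * d := fun i => by
    simp [colMul]
  have zk : ∀ i, ∀ k, k ≠ j → k ≠ j + 1 → colMul x j a b c d i k = x i k := fun i k h h' => by
    simp [colMul, h, h']
  have ad' : a * d = d * a + (q - q⁻¹) • (b * c) := by
    rw [hB.ad, hB.da, sub_smul]; abel
  have two : ∀ i l k k' : ℕ, ∀ e ∈ ({a, b, c, d} : Set A), ∀ f : A,
      (x i k * e) * (x l k' * f) = (x i k * x l k') * (e * f) := by
    rintro i l k k' e (rfl | rfl | rfl | rfl) f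
    exacts [mul_mul_mul_of_commute (ca _ _), mul_mul_mul_of_commute (cb _ _),
      mul_mul_mul_of_commute (cc _ _), mul_mul_mul_of_commute (cd _ _)]
  have one : ∀ i l k k' : ℕ, ∀ e ∈ ({a, b, c, d} : Set A),
      (x i k * e) * x l k' = (x i k * x l k') * e := by
    rintro i l k k' e (rfl | rfl | rfl | rfl)
    exacts [mul_mul_of_commute (ca _ _), mul_mul_of_commute (cb _ _),
      mul_mul_of_commute (cc _ _), mul_mul_of_commute (cd _ _)]
  have ma : a ∈ ({a, b, c, d} : Set A) := by simp
  have mb : b ∈ ({a, b, c, d} : Set A) := by simp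
  have mc : c ∈ ({a, b, c, d} : Set A) := by simp
  have md : d ∈ ({a, b, c, d} : Set A) := by simp
  have hjj : j < j + 1 := Nat.lt_succ_self j
  have hjn' : j ≤ n := by omega
  refine ⟨?_, ?_, ?_, ?_⟩
  · intro i k k' hi hi' hk hkk hk'
    have R := h1 i j (j + 1) hi hi' hj hjj hjn
    rcases eq_or_ne k j with rfl | hkj
    · rcases eq_or_ne k' (k + 1) with rfl | hkj'
      · simp only [zj, zj', add_mul, mul_add, two _ _ _ _ _ ma, two _ _ _ _ _ mb, two _ _ _ _ _ mc,
          two _ _ _ _ _ md, R, hB.ab, hB.cd, ad', ← hB.bc, smul_add, smul_mul_assoc,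
          mul_smul_comm, smul_smul]
        match_scalars <;> field_simp
        ring
      · rw [zj, zk _ _ (by omega) hkj', add_mul, mul_add, one _ _ _ _ _ ma, one _ _ _ _ _ mc,
          h1 i k k' hi hi' hk hkk hk', h1 i (k + 1) k' hi hi' (by omega) (by omega) hk']
        simp only [smul_add, smul_mul_assoc, mul_assoc]
    · rcases eq_or_ne k (j + 1) with rfl | hkj1
      · rw [zj', zk _ k' (by omega) (by omega), add_mul, mul_add, one _ _ _ _ _ mb,
          one _ _ _ _ _ md, h1 i j k' hi hi' hj (by omega) hk',
          h1 i (j + 1) k' hi hi' (by omega) (by omega) hk']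
        simp only [smul_add, smul_mul_assoc, mul_assoc]
      · rw [zk _ k hkj hkj1]
        rcases eq_or_ne k' j with rfl | hkj'
        · rw [zj, add_mul, mul_add, one _ _ _ _ _ ma, one _ _ _ _ _ mc, ← mul_assoc, ← mul_assoc,
            h1 i k k' hi hi' hk hkk hk', h1 i k (k' + 1) hi hi' (by omega) (by omega) hjn]
          simp only [smul_add, smul_mul_assoc, mul_assoc]
        · rcases eq_or_ne k' (j + 1) with rfl | hkj1'
          · rw [zj', add_mul, mul_add, one _ _ _ _ _ mb, one _ _ _ _ _ md, ← mul_assoc,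
              ← mul_assoc, h1 i k j hi hi' hk (by omega) hjn',
              h1 i k (j + 1) hi hi' (by omega) (by omega) hjn]
            simp only [smul_add, smul_mul_assoc, mul_assoc]
          · rw [zk _ k' hkj' hkj1']
            exact h1 i k k' hi hi' hk hkk hk'
  · intro i l k hi hil hl hk hk'
    have R1 := h2 i l j hi hil hl hj hjn'
    have R2 := h2 i l (j + 1) hi hil hl (by omega) hjn
    have R3 := h3 i l j (j + 1) hi hil hl hj hjj hjn
    have R4 := h4' i l j (j + 1) hi hil hl hj hjj hjn
    rcases eq_or_ne k j with rfl | hkj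
    · simp only [zj, add_mul, mul_add, two _ _ _ _ _ ma, two _ _ _ _ _ mc, R1, R2, R3, R4, hB.ac,
        smul_add, smul_mul_assoc, mul_smul_comm, smul_smul]
      match_scalars <;> field_simp
      ring
    · rcases eq_or_ne k (j + 1) with rfl | hkj1
      · simp only [zj', add_mul, mul_add, two _ _ _ _ _ mb, two _ _ _ _ _ md, R1, R2, R3, R4, hB.bd,
          smul_add, smul_mul_assoc, mul_smul_comm, smul_smul]
        match_scalars <;> field_simp
        ring
      · rw [zk _ k hkj hkj1, zk _ k hkj hkj1]
        exact h2 i l k hi hil hl hk hk'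
  · intro i l k k' hi hil hl hk hkk hk'
    have R1 := h2 i l j hi hil hl hj hjn'
    have R2 := h2 i l (j + 1) hi hil hl (by omega) hjn
    have R3 := h3 i l j (j + 1) hi hil hl hj hjj hjn
    have R4 := h4' i l j (j + 1) hi hil hl hj hjj hjn
    have G3 := fun k k' (hk : 1 ≤ k) (hkk : k < k') (hk' : k' ≤ n) =>
      h3 i l k k' hi hil hl hk hkk hk'
    rcases eq_or_ne k j with rfl | hkj
    · rcases eq_or_ne k' (k + 1) with rfl | hkj'
      · simp only [zj, zj', add_mul, mul_add, two _ _ _ _ _ ma, two _ _ _ _ _ mb, two _ _ _ _ _ mc,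
          two _ _ _ _ _ md, R1, R2, R3, R4, hB.ab, hB.cd, ad', ← hB.bc, smul_mul_assoc,
          mul_smul_comm]
        match_scalars <;> field_simp
      · rw [zj, zk _ _ (by omega) hkj', add_mul, mul_add, one _ _ _ _ _ ma, one _ _ _ _ _ mc,
          ← mul_assoc, ← mul_assoc, G3 k k' hk hkk hk', G3 (k + 1) k' (by omega) (by omega) hk']
    · rcases eq_or_ne k (j + 1) with rfl | hkj1
      · rw [zj', zk _ k' (by omega) (by omega), add_mul, mul_add, one _ _ _ _ _ mb,
          one _ _ _ _ _ md, ← mul_assoc, ← mul_assoc, G3 j k' hj (by omega) hk',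
          G3 (j + 1) k' (by omega) (by omega) hk']
      · rw [zk _ k hkj hkj1]
        rcases eq_or_ne k' j with rfl | hkj'
        · rw [zj, add_mul, mul_add, one _ _ _ _ _ ma, one _ _ _ _ _ mc, ← mul_assoc, ← mul_assoc,
            G3 k k' hk hkk hk', G3 k (k' + 1) (by omega) (by omega) hjn]
        · rcases eq_or_ne k' (j + 1) with rfl | hkj1'
          · rw [zj', add_mul, mul_add, one _ _ _ _ _ mb, one _ _ _ _ _ md, ← mul_assoc,
              ← mul_assoc, G3 k j hk (by omega) hjn', G3 k (j + 1) (by omega) (by omega) hjn]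
          · rw [zk _ k' hkj' hkj1']
            exact G3 k k' hk hkk hk'
  · intro i l k k' hi hil hl hk hkk hk'
    have R1 := h2 i l j hi hil hl hj hjn'
    have R2 := h2 i l (j + 1) hi hil hl (by omega) hjn
    have R3 := h3 i l j (j + 1) hi hil hl hj hjj hjn
    have R4 := h4' i l j (j + 1) hi hil hl hj hjj hjn
    have G4 := fun k k' (hk : 1 ≤ k) (hkk : k < k') (hk' : k' ≤ n) =>
      h4' i l k k' hi hil hl hk hkk hk'
    rw [sub_eq_iff_eq_add']
    rcases eq_or_ne k j with rfl | hkj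
    · rcases eq_or_ne k' (k + 1) with rfl | hkj'
      · simp only [zj, zj', add_mul, mul_add, two _ _ _ _ _ ma, two _ _ _ _ _ mb, two _ _ _ _ _ mc,
          two _ _ _ _ _ md, R1, R2, R3, R4, hB.ab, hB.cd, ad', ← hB.bc, smul_add, smul_mul_assoc,
          mul_smul_comm, smul_smul]
        match_scalars <;> field_simp <;> ring
      · simp only [zj, zk _ _ (show k' ≠ k by omega) hkj', add_mul, mul_add, one _ _ _ _ _ ma,
          one _ _ _ _ _ mc, ← mul_assoc, G4 k k' hk hkk hk',
          G4 (k + 1) k' (by omega) (by omega) hk', smul_add, smul_mul_assoc]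
        abel
    · rcases eq_or_ne k (j + 1) with rfl | hkj1
      · simp only [zj', zk _ k' (show k' ≠ j by omega) (show k' ≠ j + 1 by omega), add_mul, mul_add,
          one _ _ _ _ _ mb, one _ _ _ _ _ md, ← mul_assoc, G4 j k' hj (by omega) hk',
          G4 (j + 1) k' (by omega) (by omega) hk', smul_add, smul_mul_assoc]
        abel
      · simp only [zk _ k hkj hkj1]
        rcases eq_or_ne k' j with rfl | hkj'
        · simp only [zj, add_mul, mul_add, one _ _ _ _ _ ma, one _ _ _ _ _ mc, ← mul_assoc,
            G4 k k' hk hkk hk', G4 k (k' + 1) (by omega) (by omega) hjn, smul_add, smul_mul_assoc]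
          abel
        · rcases eq_or_ne k' (j + 1) with rfl | hkj1'
          · simp only [zj', add_mul, mul_add, one _ _ _ _ _ mb, one _ _ _ _ _ md, ← mul_assoc,
              G4 k j hk (by omega) hjn', G4 k (j + 1) (by omega) (by omega) hjn, smul_add,
              smul_mul_assoc]
            abel
          · rw [zk _ k' hkj' hkj1', zk _ k' hkj' hkj1']
            exact G4 k k' hk hkk hk'

end ColumnOperation

section Step

variable {K : Type} [Field K]

/-- The diagonal matrix `diag(1, t, t²)`. -/
def diagPow (t : K) : Matrix (Fin 3) (Fin 3) K := !![1, 0, 0; 0, t, 0; 0, 0, t ^ 2]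

variable (K) in
/-- The lower shift matrix of size three. -/
def shift : Matrix (Fin 3) (Fin 3) K := !![0, 0, 0; 1, 0, 0; 0, 1, 0]

theorem isQBlock_upper {q : K} (hq : q ≠ 0) :
    IsQBlock q (diagPow q) (shift K) 0 (diagPow q⁻¹) := by
  constructor
  all_goals
    ext i j
    fin_cases i <;> fin_cases j <;>
      simp [diagPow, shift, Matrix.mul_apply, Fin.sum_univ_three] <;> field_simp

theorem isQBlock_lower {q : K} (hq : q ≠ 0) :
    IsQBlock q (diagPow q) 0 (shift K) (diagPow q⁻¹) := by
  constructor
  all_goals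
    ext i j
    fin_cases i <;> fin_cases j <;>
      simp [diagPow, shift, Matrix.mul_apply, Fin.sum_univ_three] <;> field_simp

theorem IsQBlock.map {A B : Type} [Ring A] [Algebra K A] [Ring B] [Algebra K B] {q : K}
    {a b c d : A} (h : IsQBlock q a b c d) (f : A →ₐ[K] B) :
    IsQBlock q (f a) (f b) (f c) (f d) := by
  constructor
  · rw [← map_mul, h.ab, map_smul, map_mul]
  · rw [← map_mul, h.cd, map_smul, map_mul]
  · rw [← map_mul, h.ac, map_smul, map_mul]
  · rw [← map_mul, h.bd, map_smul, map_mul]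
  · rw [← map_mul, h.bc, map_mul]
  · rw [← map_mul, h.ad, map_add, map_one, map_smul, map_mul]
  · rw [← map_mul, h.da, map_add, map_one, map_smul, map_mul]

/-- The columns of the old matrix, with coefficients, contributing to a minor that uses columns
`j`, `j + 1` of the new one as prescribed by two Booleans. -/
def blockTerms {B : Type} [One B] (a b c d : B) : Bool → Bool → List ((Bool × Bool) × B)
  | false, false => [((false, false), 1)]
  | true, false => [((true, false), a), ((false, true), c)]
  | false, true => [((true, false), b), ((false, true), d)]
  | true, true => [((true, true), 1)]

theorem exists_step {q : K} (hq : q ≠ 0) {B : Type} [Ring B] [Algebra K B] {a b c d : B}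
    (hB : IsQBlock q a b c d) (ψ : B →ₗ[K] K) {A : Type} [Ring A] [Algebra K A] {m n : ℕ}
    {x : ℕ → ℕ → A} (hx : IsQMatrix q m n x) (φ : A →ₗ[K] K) {j : ℕ} (hj : 1 ≤ j)
    (hjn : j + 1 ≤ n) :
    ∃ (A' : Type) (instA : Ring A'), letI := instA; ∃ (instB : Algebra K A'), letI := instB
      ∃ (z : ℕ → ℕ → A') (φ' : A' →ₗ[K] K), IsQMatrix q m n z ∧
        ∀ (I I' J J' : Finset ℕ), j ∉ J → j + 1 ∉ J → j ∉ J' → j + 1 ∉ J' →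
          ∀ s t s' t' : Bool,
          φ' (qMinor q z I (addCols J j s t) * qMinor q z I' (addCols J' j s' t')) =
            ((blockTerms a b c d s t).map fun u => ((blockTerms a b c d s' t').map fun v =>
              φ (qMinor q x I (addCols J j u.1.1 u.1.2) *
                qMinor q x I' (addCols J' j v.1.1 v.1.2)) * ψ (u.2 * v.2)).sum).sum := by
  open TensorProduct in
  let f : A →ₐ[K] A ⊗[K] B := Algebra.TensorProduct.includeLeft
  let g : B →ₐ[K] A ⊗[K] B := Algebra.TensorProduct.includeRight
  have hfg : ∀ u v, Commute (g v) (f u) := fun u v => by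
    simp [f, g, Commute, SemiconjBy]
  let φ' : A ⊗[K] B →ₗ[K] K := LinearMap.mul' K K ∘ₗ TensorProduct.map φ ψ
  have hφ : ∀ u v, φ' (f u * g v) = φ u * ψ v := fun u v => by simp [f, g, φ']
  have hcomm : ∀ i k, Commute (g a) (f (x i k)) ∧ Commute (g b) (f (x i k)) ∧
      Commute (g c) (f (x i k)) ∧ Commute (g d) (f (x i k)) := fun i k =>
    ⟨hfg _ _, hfg _ _, hfg _ _, hfg _ _⟩
  refine ⟨A ⊗[K] B, inferInstance, inferInstance,
    colMul (fun i k => f (x i k)) j (g a) (g b) (g c) (g d), φ',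
    isQMatrix_colMul hq (hB.map g) (IsQMatrix.map hx f) hcomm hj hjn, ?_⟩
  intro I I' J J' h1 h2 h1' h2' s t s' t'
  have key : ∀ (I J : Finset ℕ), j ∉ J → j + 1 ∉ J → ∀ s t,
      qMinor q (colMul (fun i k => f (x i k)) j (g a) (g b) (g c) (g d)) I (addCols J j s t) =
      ((blockTerms a b c d s t).map fun u =>
        f (qMinor q x I (addCols J j u.1.1 u.1.2)) * g u.2).sum := by
    intro I J h1 h2 s t
    have := rowMinor_colMul hq (hB.map g) (fun i k => f (x i k)) hcomm j
      (List.ofFn (I.orderEmbOfFin rfl)) J h1 h2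
    simp only [rowMinor_map] at this
    simp only [qMinor_eq_rowMinor]
    obtain ⟨e1, e2, e3, e4⟩ := this
    cases s <;> cases t <;> simp [blockTerms, e1, e2, e3, e4]
  have hmul : ∀ u v u' v', f u * g v * (f u' * g v') = f (u * u') * g (v * v') := by
    intro u v u' v'
    rw [mul_mul_mul_of_commute (hfg _ _), map_mul, map_mul]
  rw [key I J h1 h2, key I' J' h1' h2']
  cases s <;> cases t <;> cases s' <;> cases t' <;>
    simp only [blockTerms, List.map_cons, List.map_nil, List.sum_cons, List.sum_nil, add_zero,
      add_mul, mul_add, hmul, map_add, hφ] <;> abel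

end Step

/-- How often an index occurs in a pair of sets. -/
inductive Occ
  | none
  | single
  | both
  deriving DecidableEq

namespace Occ

/-- Membership of an index in the first of two sets, for a list of colors (`true` is white)
attached to the indices occurring once. -/
def bit : Occ → List Bool → Bool
  | none, _ => false
  | single, γ => γ.headD false
  | both, _ => true

/-- The colors left after reading one index. -/
def rest : Occ → List Bool → List Bool
  | none, γ => γ
  | single, γ => γ.tail
  | both, γ => γ

end Occ

/-- The set of indices, starting with `k`, selected by occurrences `c` and colors `γ`. -/
def colSet : ℕ → List Occ → List Bool → Finset ℕ
  | _, [], _ => ∅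
  | k, x :: c, γ => (if x.bit γ then {k} else ∅) ∪ colSet (k + 1) c (x.rest γ)

theorem mem_colSet {k l : ℕ} {c : List Occ} {γ : List Bool} (h : l ∈ colSet k c γ) :
    k ≤ l ∧ l < k + c.length := by
  induction c generalizing k γ with
  | nil => simp [colSet] at h
  | cons x c ih =>
    simp only [colSet, Finset.mem_union] at h
    rcases h with h | h
    · split_ifs at h
      · simp only [Finset.mem_singleton] at h
        simp [h]
      · simp at h
    · have := ih h
      simp only [List.length_cons]
      omega

theorem colSet_append (k : ℕ) (c₁ c₂ : List Occ) (γ₁ γ₂ : List Bool)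
    (h : γ₁.length = c₁.count .single) :
    colSet k (c₁ ++ c₂) (γ₁ ++ γ₂) = colSet k c₁ γ₁ ∪ colSet (k + c₁.length) c₂ γ₂ := by
  induction c₁ generalizing k γ₁ with
  | nil =>
    have : γ₁ = [] := by simpa using h
    simp [this, colSet]
  | cons x c₁ ih =>
    have e : k + 1 + c₁.length = k + (c₁.length + 1) := by omega
    cases x with
    | none => simp [colSet, Occ.bit, Occ.rest, ih _ γ₁ (by simpa using h), e]
    | both => simp [colSet, Occ.bit, Occ.rest, ih _ γ₁ (by simpa using h), e]
    | single =>
      cases γ₁ with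
      | nil => simp at h
      | cons b γ₁ =>
        simp [colSet, Occ.bit, Occ.rest, ih _ γ₁ (by simpa using h), e]

theorem colSet_two (c₁ c₂ : List Occ) (x y : Occ) (γ₁ γ₂ : List Bool)
    (h : γ₁.length = c₁.count .single) :
    colSet 1 (c₁ ++ x :: y :: c₂) (γ₁ ++ γ₂) =
      addCols (colSet 1 c₁ γ₁ ∪ colSet (1 + c₁.length + 2) c₂ (y.rest (x.rest γ₂)))
        (1 + c₁.length) (x.bit γ₂) (y.bit (x.rest γ₂)) := by
  rw [colSet_append _ _ _ _ _ h]
  ext l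
  simp only [colSet, addCols, Finset.mem_union]
  have : 1 + c₁.length + 1 + 1 = 1 + c₁.length + 2 := rfl
  rw [this]
  tauto

theorem notMem_two (c₁ c₂ : List Occ) (γ₁ γ₂ : List Bool) :
    1 + c₁.length ∉ colSet 1 c₁ γ₁ ∪ colSet (1 + c₁.length + 2) c₂ γ₂ ∧
      1 + c₁.length + 1 ∉ colSet 1 c₁ γ₁ ∪ colSet (1 + c₁.length + 2) c₂ γ₂ := by
  constructor <;>
  · rw [Finset.mem_union]
    rintro (h | h)
    · have := mem_colSet h
      omega
    · have := mem_colSet h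
      omega

section Realizable

variable {K : Type} [Field K]

/-- There is a `q`-matrix and a linear functional on its algebra whose values on the products of
two minors with column sets of occurrence pattern `c` are given by `Ψ`. -/
def Realizable (q : K) (m : ℕ) (c : List Occ) (Ψ : Finset ℕ → Finset ℕ → List Bool → K) : Prop :=
  ∃ (A : Type) (instA : Ring A), letI := instA; ∃ (instB : Algebra K A), letI := instB
    ∃ (x : ℕ → ℕ → A) (φ : A →ₗ[K] K), IsQMatrix q m c.length x ∧
      ∀ I I' γ, γ.length = c.count .single →
        φ (qMinor q x I (colSet 1 c γ) * qMinor q x I' (colSet 1 c (γ.map not))) = Ψ I I' γ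

/-- A local modification of the columns `|c₁| + 1`, `|c₁| + 2` realizing a new functional. -/
theorem Realizable.step {q : K} (hq : q ≠ 0) {a b c d : Matrix (Fin 3) (Fin 3) K}
    (hB : IsQBlock q a b c d) (s : Fin 3) {m : ℕ} {c₁ c₂ : List Occ} {x y x' y' : Occ}
    {Ψ Ψ' : Finset ℕ → Finset ℕ → List Bool → K}
    (h : Realizable q m (c₁ ++ x :: y :: c₂) Ψ)
    (H : ∀ (Φ : Bool → Bool → Bool → Bool → K) (I I' : Finset ℕ) (γ₁ δ γ₂ : List Bool),
      γ₁.length = c₁.count .single → δ.length = [x', y'].count .single →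
      (∀ δ' : List Bool, δ'.length = [x, y].count .single →
        Φ (x.bit δ') (y.bit (x.rest δ')) (x.bit (δ'.map not)) (y.bit (x.rest (δ'.map not))) =
          Ψ I I' (γ₁ ++ (δ' ++ γ₂))) →
      ((blockTerms a b c d (x'.bit δ) (y'.bit (x'.rest δ))).map fun u =>
        ((blockTerms a b c d (x'.bit (δ.map not)) (y'.bit (x'.rest (δ.map not)))).map fun v =>
          Φ u.1.1 u.1.2 v.1.1 v.1.2 * (u.2 * v.2) s 0).sum).sum = Ψ' I I' (γ₁ ++ (δ ++ γ₂))) :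
    Realizable q m (c₁ ++ x' :: y' :: c₂) Ψ' := by
  obtain ⟨A, _, _, X, φ, hX, hφ⟩ := h
  have hbr : ∀ (x y : Occ) (δ γ : List Bool), δ.length = [x, y].count .single →
      x.bit (δ ++ γ) = x.bit δ ∧ y.bit (x.rest (δ ++ γ)) = y.bit (x.rest δ) ∧
        y.rest (x.rest (δ ++ γ)) = γ := by
    intro x y δ γ h
    cases x <;> cases y <;> rcases δ with _ | ⟨e, _ | ⟨e', _ | ⟨e'', δ⟩⟩⟩ <;>
      simp [Occ.bit, Occ.rest] at h ⊢
  let ψ : Matrix (Fin 3) (Fin 3) K →ₗ[K] K := Matrix.entryLinearMap K K s 0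
  obtain ⟨A', iA, iB, z, φ', hz, hφ'⟩ := exists_step hq hB ψ hX φ
    (j := 1 + c₁.length) (by omega) (by simp; omega)
  refine ⟨A', iA, iB, z, φ', by simpa using hz, ?_⟩
  intro I I' γ hγ
  obtain ⟨γ₁, δ, γ₂, rfl, h1, h2⟩ : ∃ γ₁ δ γ₂ : List Bool, γ = γ₁ ++ (δ ++ γ₂) ∧
      γ₁.length = c₁.count .single ∧ δ.length = [x', y'].count .single := by
    refine ⟨γ.take (c₁.count .single), (γ.drop (c₁.count .single)).take ([x', y'].count .single),
      (γ.drop (c₁.count .single)).drop ([x', y'].count .single), by simp, ?_, ?_⟩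
    · simp only [List.length_take, hγ, List.count_append]
      omega
    · simp only [List.length_take, List.length_drop, hγ, List.count_append, List.count_cons,
        List.count_nil]
      omega
  have h1' : (γ₁.map not).length = c₁.count .single := by simpa using h1
  have h2' : (δ.map not).length = [x', y'].count .single := by simpa using h2
  obtain ⟨b1, b2, b3⟩ := hbr x' y' δ γ₂ h2
  obtain ⟨b1', b2', b3'⟩ := hbr x' y' (δ.map not) (γ₂.map not) h2'
  rw [List.map_append, List.map_append, colSet_two _ _ _ _ _ _ h1, colSet_two _ _ _ _ _ _ h1',
    b1, b2, b3, b1', b2', b3', hφ' _ _ _ _ (notMem_two _ _ _ _).1 (notMem_two _ _ _ _).2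
    (notMem_two _ _ _ _).1 (notMem_two _ _ _ _).2]
  refine H (fun s t s' t' => φ (qMinor q X I (addCols (colSet 1 c₁ γ₁ ∪
      colSet (1 + c₁.length + 2) c₂ γ₂) (1 + c₁.length) s t) * qMinor q X I' (addCols
      (colSet 1 c₁ (γ₁.map not) ∪ colSet (1 + c₁.length + 2) c₂ (γ₂.map not)) (1 + c₁.length)
      s' t'))) I I' γ₁ δ γ₂ h1 h2 ?_
  intro δ' hδ'
  rw [← hφ]
  · have hδ'' : (δ'.map not).length = [x, y].count .single := by simpa using hδ'
    obtain ⟨b1, b2, b3⟩ := hbr x y δ' γ₂ hδ'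
    obtain ⟨b1', b2', b3'⟩ := hbr x y (δ'.map not) (γ₂.map not) hδ''
    rw [List.map_append, List.map_append, colSet_two _ _ _ _ _ _ h1, colSet_two _ _ _ _ _ _ h1',
      b1, b2, b3, b1', b2', b3']
  · have : γ₂.length = c₂.count .single := by
      simp only [List.length_append, h1, h2, List.count_append, List.count_cons,
        List.count_nil] at hγ
      omega
    simp only [List.length_append, h1, hδ', this, List.count_append, List.count_cons,
        List.count_nil]
    omega

end Realizable

section Operations

variable {K : Type} [Field K] {q : K} {m : ℕ} {c₁ c₂ c c' : List Occ}
  {Ψ : Finset ℕ → Finset ℕ → List Bool → K}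

theorem Realizable.swap (hq : q ≠ 0) (x y : Occ) (h : Realizable q m (c₁ ++ x :: y :: c₂) Ψ) :
    Realizable q m (c₁ ++ y :: x :: c₂) Ψ := by
  have hU := isQBlock_upper hq
  have hL := isQBlock_lower hq
  cases x <;> cases y
  · exact h
  · refine h.step hq hL 1 ?_
    intro Φ I I' γ₁ δ γ₂ _ hδ hΦ
    have hΦ := hΦ δ (by simpa using hδ)
    rcases δ with _ | ⟨_ | _, _ | ⟨e', δ⟩⟩ <;> simp at hδ <;>
      simpa [blockTerms, Occ.bit, Occ.rest, diagPow, shift, Matrix.mul_apply, Fin.sum_univ_three]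
        using hΦ
  · refine h.step hq hL 2 ?_
    intro Φ I I' γ₁ δ γ₂ _ hδ hΦ
    have hΦ := hΦ δ (by simpa using hδ)
    obtain rfl : δ = [] := by simpa using hδ
    simpa [blockTerms, Occ.bit, Occ.rest, diagPow, shift, Matrix.mul_apply, Fin.sum_univ_three]
      using hΦ
  · refine h.step hq hU 1 ?_
    intro Φ I I' γ₁ δ γ₂ _ hδ hΦ
    have hΦ := hΦ δ (by simpa using hδ)
    rcases δ with _ | ⟨_ | _, _ | ⟨e', δ⟩⟩ <;> simp at hδ <;>
      simpa [blockTerms, Occ.bit, Occ.rest, diagPow, shift, Matrix.mul_apply, Fin.sum_univ_three]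
        using hΦ
  · exact h
  · refine h.step hq hL 1 ?_
    intro Φ I I' γ₁ δ γ₂ _ hδ hΦ
    have hΦ := hΦ δ (by simpa using hδ)
    rcases δ with _ | ⟨_ | _, _ | ⟨e', δ⟩⟩ <;> simp at hδ <;>
      simpa [blockTerms, Occ.bit, Occ.rest, diagPow, shift, Matrix.mul_apply, Fin.sum_univ_three]
        using hΦ
  · refine h.step hq hU 2 ?_
    intro Φ I I' γ₁ δ γ₂ _ hδ hΦ
    have hΦ := hΦ δ (by simpa using hδ)
    obtain rfl : δ = [] := by simpa using hδ
    simpa [blockTerms, Occ.bit, Occ.rest, diagPow, shift, Matrix.mul_apply, Fin.sum_univ_three]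
      using hΦ
  · refine h.step hq hU 1 ?_
    intro Φ I I' γ₁ δ γ₂ _ hδ hΦ
    have hΦ := hΦ δ (by simpa using hδ)
    rcases δ with _ | ⟨_ | _, _ | ⟨e', δ⟩⟩ <;> simp at hδ <;>
      simpa [blockTerms, Occ.bit, Occ.rest, diagPow, shift, Matrix.mul_apply, Fin.sum_univ_three]
        using hΦ
  · exact h

/-- The effect on color functionals of contracting the colors at positions `k`, `k + 1`. -/
def capOp (q : K) (k : ℕ) (f : List Bool → K) (γ : List Bool) : K :=
  q * f (γ.take k ++ true :: false :: γ.drop k) + f (γ.take k ++ false :: true :: γ.drop k)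

/-- The weight of a couple of colors lying within one side. -/
def arcWt (q : K) (e e' : Bool) : K := if e = e' then 0 else if e then q else 1

/-- The effect on color functionals of inserting a couple of colors at positions `k`, `k + 1`. -/
def cupOp (q : K) (k : ℕ) (f : List Bool → K) (γ : List Bool) : K :=
  match γ.drop k with
  | e :: e' :: γ₂ => arcWt q e e' * f (γ.take k ++ γ₂)
  | _ => 0

theorem Realizable.smul (t : K) (h : Realizable q m c Ψ) :
    Realizable q m c fun I I' γ => t * Ψ I I' γ := by
  obtain ⟨A, iA, iB, x, φ, hx, hφ⟩ := h
  refine ⟨A, iA, iB, x, t • φ, hx, fun I I' γ hγ => ?_⟩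
  rw [LinearMap.smul_apply, hφ I I' γ hγ, smul_eq_mul]

theorem Realizable.congr {Ψ' : Finset ℕ → Finset ℕ → List Bool → K} (h : Realizable q m c Ψ)
    (e : ∀ I I' γ, γ.length = c.count .single → Ψ I I' γ = Ψ' I I' γ) : Realizable q m c Ψ' := by
  obtain ⟨A, iA, iB, x, φ, hx, hφ⟩ := h
  exact ⟨A, iA, iB, x, φ, hx, fun I I' γ hγ => (hφ I I' γ hγ).trans (e I I' γ hγ)⟩

theorem Realizable.cap (hq : q ≠ 0) (h : Realizable q m (c₁ ++ .single :: .single :: c₂) Ψ) :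
    Realizable q m (c₁ ++ .none :: .both :: c₂) fun I I' =>
      capOp q (c₁.count .single) (Ψ I I') := by
  have := h.step (x' := .none) (y' := .both) (Ψ' := fun I I' γ =>
    q⁻¹ * capOp q (c₁.count .single) (Ψ I I') γ) hq (isQBlock_upper hq) 1 ?_
  · refine (this.smul q).congr fun I I' γ _ => ?_
    rw [← mul_assoc, mul_inv_cancel₀ hq, one_mul]
  · intro Φ I I' γ₁ δ γ₂ hγ₁ hδ hΦ
    have h1 := hΦ [true, false] rfl
    have h2 := hΦ [false, true] rfl
    obtain rfl : δ = [] := by simpa using hδ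
    simp [Occ.bit, Occ.rest] at h1 h2
    simp [blockTerms, Occ.bit, diagPow, shift, Matrix.mul_apply, Fin.sum_univ_three,
      capOp, ← hγ₁, h1, h2]
    field_simp

theorem Realizable.cup (hq : q ≠ 0) (h : Realizable q m (c₁ ++ .both :: .none :: c₂) Ψ) :
    Realizable q m (c₁ ++ .single :: .single :: c₂) fun I I' =>
      cupOp q (c₁.count .single) (Ψ I I') := by
  refine h.step hq (isQBlock_upper hq) 1 ?_
  intro Φ I I' γ₁ δ γ₂ hγ₁ hδ hΦ
  have h1 := hΦ [] rfl
  simp [Occ.bit] at h1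
  rcases δ with _ | ⟨_ | _, _ | ⟨_ | _, _ | ⟨e'', δ⟩⟩⟩ <;> simp at hδ <;>
    simp [blockTerms, Occ.bit, Occ.rest, diagPow, shift, Matrix.mul_apply, Fin.sum_univ_three,
      cupOp, ← hγ₁, h1, arcWt, mul_comm]

theorem Realizable.perm_append (hq : q ≠ 0) (p : List Occ) (hc : c.Perm c')
    (h : Realizable q m (p ++ c) Ψ) : Realizable q m (p ++ c') Ψ := by
  induction hc generalizing p with
  | nil => exact h
  | cons x _ ih => simpa using ih (p ++ [x]) (by simpa using h)
  | swap x y l => exact h.swap hq _ _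
  | trans _ _ ih ih' => exact ih' _ (ih _ h)

theorem Realizable.perm (hq : q ≠ 0) (hc : c.Perm c') (h : Realizable q m c Ψ) :
    Realizable q m c' Ψ :=
  Realizable.perm_append hq [] hc h

end Operations

section Identity

variable {K : Type} [Field K]

/-- The identity matrix, with rows and columns indexed by the natural numbers. -/
def idMat : ℕ → ℕ → K := fun i j => if i = j then 1 else 0

theorem isQMatrix_idMat (q : K) (m n : ℕ) : IsQMatrix q m n (idMat : ℕ → ℕ → K) := by
  have h : ∀ i l j k : ℕ, i < l → j < k → (idMat i k * idMat l j : K) = 0 := by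
    intro i l j k h1 h2
    simp only [idMat, mul_ite, mul_one, mul_zero, ite_eq_right_iff, one_ne_zero, imp_false]
    rintro rfl
    omega
  refine ⟨?_, ?_, ?_, ?_⟩
  · intro i j k _ _ _ hjk _
    have : (idMat i j * idMat i k : K) = 0 := by
      simp only [idMat, mul_ite, mul_one, mul_zero, ite_eq_right_iff, one_ne_zero, imp_false]
      rintro rfl
      omega
    rw [mul_comm (idMat i k), this, smul_zero]
  · intro i l j _ hil _ _ _
    have : (idMat i j * idMat l j : K) = 0 := by
      simp only [idMat, mul_ite, mul_one, mul_zero, ite_eq_right_iff, one_ne_zero, imp_false]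
      rintro rfl
      omega
    rw [mul_comm (idMat l j), this, smul_zero]
  · intro i l j k _ _ _ _ _ _
    exact mul_comm _ _
  · intro i l j k _ hil _ _ hjk _
    rw [h i l j k hil hjk, mul_comm, sub_self, smul_zero]

theorem rowMinor_idMat (q : K) {L : List ℕ} (hL : L.Pairwise (· < ·)) (J : Finset ℕ) :
    rowMinor q (idMat : ℕ → ℕ → K) L J = if L.toFinset = J then 1 else 0 := by
  induction L generalizing J with
  | nil => simp [rowMinor, eq_comm]
  | cons i L ih =>
    rw [List.pairwise_cons] at hL
    simp only [rowMinor, ih hL.2, idMat]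
    have hi : i ∉ L.toFinset := fun h => lt_irrefl _ (hL.1 i (by simpa using h))
    by_cases hJ : (i :: L).toFinset = J
    · subst hJ
      have h0 : (insert i L.toFinset).filter (· < i) = ∅ := by
        rw [Finset.filter_eq_empty_iff]
        intro k hk
        rw [Finset.mem_insert, List.mem_toFinset] at hk
        rcases hk with rfl | hk
        · exact lt_irrefl _
        · exact (hL.1 k hk).not_gt
      rw [if_pos rfl, List.toFinset_cons, Finset.sum_eq_single i]
      · simp [h0, Finset.erase_insert hi]
      · intro k _ hk
        simp [hk.symm]
      · simp
    · rw [if_neg hJ]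
      refine Finset.sum_eq_zero fun k hk => ?_
      by_cases hik : i = k
      · subst hik
        have h : ¬ L.toFinset = J.erase i := fun h =>
          hJ (by rw [List.toFinset_cons, h, Finset.insert_erase hk])
        simp [h]
      · simp [hik]

theorem qMinor_idMat (q : K) (I J : Finset ℕ) :
    qMinor q (idMat : ℕ → ℕ → K) I J = if I = J then 1 else 0 := by
  rw [qMinor_eq_rowMinor, rowMinor_idMat]
  · congr 2
    ext i
    have := congrArg (i ∈ ·) (Finset.range_orderEmbOfFin I rfl)
    simp only [Set.mem_range, Finset.mem_coe] at this
    simp [List.mem_ofFn, ← this]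
  · rw [List.pairwise_ofFn]
    intro i j h
    exact (I.orderEmbOfFin rfl).strictMono h

theorem realizable_base (q : K) (m : ℕ) (c : List Occ) :
    Realizable q m c fun I I' γ =>
      if γ.length = c.count .single ∧ I = colSet 1 c γ ∧ I' = colSet 1 c (γ.map not)
      then 1 else 0 := by
  refine ⟨K, inferInstance, inferInstance, idMat, LinearMap.id, isQMatrix_idMat _ _ _,
    fun I I' γ hγ => ?_⟩
  simp only [LinearMap.id_apply, qMinor_idMat]
  split_ifs <;> simp_all

end Identity

section Kernel

/-- Noncrossing diagrams with rows `L` on one side and columns `C` on the other, built from through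
couples by inserting couples of neighbors on either side. -/
inductive NC : List ℕ → List ℕ → Multiset (Elt × Elt) → Prop
  | base (L C : List ℕ) (h : L.length = C.length) :
      NC L C (List.zipWith (fun i j => (Sum.inl i, Sum.inr j)) L C : List (Elt × Elt))
  | row (L₁ L₂ C : List ℕ) (a b : ℕ) (M : Multiset (Elt × Elt)) (hab : a < b)
      (h : NC (L₁ ++ L₂) C M) : NC (L₁ ++ a :: b :: L₂) C ((Sum.inl a, Sum.inl b) ::ₘ M)
  | col (L C₁ C₂ : List ℕ) (a b : ℕ) (M : Multiset (Elt × Elt)) (hab : a < b)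
      (h : NC L (C₁ ++ C₂) M) : NC L (C₁ ++ a :: b :: C₂) ((Sum.inr b, Sum.inr a) ::ₘ M)

variable {K : Type} [Field K]

/-- The weight of a couple for a coloring (`true` is white). -/
def coupleWt (q : K) (col : Elt → Bool) (p : Elt × Elt) : K :=
  if sameSide p.1 p.2 then
    if col p.1 = col p.2 then 0 else if col (numMin p) then q else 1
  else if col p.1 = col p.2 then 1 else 0

theorem exists_perm_single_single {c : List Occ} {k l : ℕ} (h : c.count .single = k + l + 2) :
    ∃ c₁ c₂ : List Occ, c₁.count .single = k ∧ c₂.count .single = l ∧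
      c.Perm (c₁ ++ .single :: .single :: c₂) := by
  refine ⟨List.replicate k .single, List.replicate l .single ++ c.filter (· ≠ .single),
    by simp, by simp [List.count_eq_zero], ?_⟩
  rw [List.perm_iff_count]
  intro a
  by_cases ha : a = .single
  · subst ha
    have : (c.filter (· ≠ .single)).count .single = 0 := by simp [List.count_eq_zero]
    simp only [List.count_append, List.count_cons_self, List.count_replicate_self, this, h]
    omega
  · rw [List.count_append, List.count_cons_of_ne (Ne.symm ha), List.count_cons_of_ne (Ne.symm ha),
      List.count_append, List.count_replicate, List.count_replicate, List.count_filter (by simpa)]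
    simp [Ne.symm ha]

theorem capOp_smul (q : K) (k : ℕ) (t : K) (f : List Bool → K) :
    capOp q k (t • f) = t • capOp q k f := by
  funext γ
  simp only [capOp, Pi.smul_apply, smul_eq_mul]
  ring

theorem cupOp_smul (q : K) (k : ℕ) (t : K) (f : List Bool → K) :
    cupOp q k (t • f) = t • cupOp q k f := by
  funext γ
  simp only [cupOp, Pi.smul_apply, smul_eq_mul]
  split
  · ring
  · simp

theorem capOp_delta (q : K) (ρ₁ ρ₂ : List Bool) (e e' : Bool) :
    capOp q ρ₁.length (fun γ => if γ = ρ₁ ++ e :: e' :: ρ₂ then 1 else 0) =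
      arcWt q e e' • fun γ => if γ = ρ₁ ++ ρ₂ then 1 else 0 := by
  have key : ∀ (γ : List Bool) (x y : Bool),
      γ.take ρ₁.length ++ x :: y :: γ.drop ρ₁.length = ρ₁ ++ e :: e' :: ρ₂ ↔
        γ = ρ₁ ++ ρ₂ ∧ x = e ∧ y = e' := by
    intro γ x y
    constructor
    · intro h
      have hl := congrArg List.length h
      have hl' : (γ.take ρ₁.length).length = ρ₁.length := by
        simp at hl ⊢
        omega
      obtain ⟨h1, h2⟩ := List.append_inj h hl'
      simp only [List.cons.injEq] at h2
      refine ⟨?_, h2.1, h2.2.1⟩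
      conv_lhs => rw [← List.take_append_drop ρ₁.length γ, h1, h2.2.2]
    · rintro ⟨rfl, rfl, rfl⟩
      simp
  funext γ
  simp only [capOp, key, Pi.smul_apply, smul_eq_mul, arcWt]
  cases e <;> cases e' <;> simp

theorem cupOp_append (q : K) (f : List Bool → K) (ρ₁ ρ₂ : List Bool) (e e' : Bool) :
    cupOp q ρ₁.length f (ρ₁ ++ e :: e' :: ρ₂) = arcWt q e e' * f (ρ₁ ++ ρ₂) := by
  simp [cupOp]

theorem coupleWt_row (q : K) (col : Elt → Bool) {a b : ℕ} (h : a < b) :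
    coupleWt q col (Sum.inl a, Sum.inl b) = arcWt q (col (Sum.inl a)) (col (Sum.inl b)) := by
  simp [coupleWt, numMin, arcWt, h.le]

theorem coupleWt_col (q : K) (col : Elt → Bool) {a b : ℕ} (h : a < b) :
    coupleWt q col (Sum.inr b, Sum.inr a) = arcWt q (col (Sum.inr a)) (col (Sum.inr b)) := by
  simp [coupleWt, numMin, arcWt, h.not_ge, eq_comm (a := col (Sum.inr b))]

theorem prod_zipWith_coupleWt (q : K) (col : Elt → Bool) (L C : List ℕ)
    (h : L.length = C.length) :
    ((List.zipWith (fun i j => (Sum.inl i, Sum.inr j)) L C : List (Elt × Elt)).map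
      (coupleWt q col)).prod =
        if C.map (fun j => col (Sum.inr j)) = L.map (fun i => col (Sum.inl i)) then 1 else 0 := by
  induction L generalizing C with
  | nil =>
    obtain rfl : C = [] := by simpa using h.symm
    simp
  | cons i L ih =>
    rcases C with _ | ⟨j, C⟩
    · simp at h
    · simp only [List.zipWith_cons_cons, List.map_cons, List.prod_cons, ih C (by simpa using h),
        List.cons.injEq]
      have h2 : ¬ sameSide (Sum.inl i : Elt) (Sum.inr j) := by simp [sameSide]
      by_cases h1 : col (Sum.inl i) = col (Sum.inr j)
      · simp [coupleWt, h1, h2]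
      · simp [coupleWt, h1, h2, Ne.symm h1]

/-- A noncrossing diagram gives an operator from color functionals on its rows to color functionals
on its columns which preserves realizability and has the products of couple weights as its
kernel. -/
theorem NC.exists_operator {q : K} (hq : q ≠ 0) {L C : List ℕ} {M : Multiset (Elt × Elt)}
    (h : NC L C M) :
    ∃ T : (List Bool → K) → List Bool → K,
      (∀ (t : K) f, T (t • f) = t • T f) ∧
      (∀ col : Elt → Bool,
        T (fun γ => if γ = L.map (fun i => col (Sum.inl i)) then 1 else 0)
          (C.map fun j => col (Sum.inr j)) = (M.map (coupleWt q col)).prod) ∧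
      ∀ (m : ℕ) (c c' : List Occ) (Ψ : Finset ℕ → Finset ℕ → List Bool → K),
        c.count .single = L.length → c'.count .single = C.length → c.length = c'.length →
        c.count .single + 2 * c.count .both = c'.count .single + 2 * c'.count .both →
        Realizable q m c Ψ → Realizable q m c' fun I I' => T (Ψ I I') := by
  have hlen : ∀ c : List Occ,
      c.length = c.count .none + c.count .single + c.count .both := by
    intro c
    induction c with
    | nil => rfl
    | cons x c ih => cases x <;> simp [ih] <;> omega
  induction h with
  | base L C h =>
    refine ⟨id, fun _ _ => rfl, fun col => ?_, fun m c c' Ψ h1 h2 h3 h4 hΨ => ?_⟩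
    · rw [Multiset.map_coe, Multiset.prod_coe, prod_zipWith_coupleWt q col L C h]
      rfl
    · refine Realizable.perm hq (List.perm_iff_count.2 fun a => ?_) hΨ
      rw [hlen c, hlen c'] at h3
      cases a <;> omega
  | row L₁ L₂ C a b M hab h ih =>
    obtain ⟨T, hT, hTM, hR⟩ := ih
    refine ⟨fun f => T (capOp q L₁.length f), fun t f => ?_, fun col => ?_,
      fun m c c' Ψ h1 h2 h3 h4 hΨ => ?_⟩
    · simp only [capOp_smul, hT]
    · have := capOp_delta q (L₁.map fun i => col (Sum.inl i)) (L₂.map fun i => col (Sum.inl i))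
        (col (Sum.inl a)) (col (Sum.inl b))
      rw [List.length_map] at this
      simp only [List.map_append, List.map_cons] at hTM ⊢
      rw [this, hT, Pi.smul_apply, hTM, Multiset.map_cons, Multiset.prod_cons, smul_eq_mul,
        coupleWt_row q col hab]
    · obtain ⟨c₁, c₂, hc₁, hc₂, hc⟩ := exists_perm_single_single
        (c := c) (k := L₁.length) (l := L₂.length) (by simp at h1; omega)
      have := (Realizable.perm hq hc hΨ).cap hq
      rw [hc₁] at this
      have e1 := hc.length_eq
      have e2 := hc.count_eq .single
      have e3 := hc.count_eq .both
      simp at e1 e2 e3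
      refine hR m _ c' _ ?_ h2 ?_ ?_ this
      · simp [hc₁, hc₂]
      · simp
        omega
      · simp
        omega
  | col L C₁ C₂ a b M hab h ih =>
    obtain ⟨T, hT, hTM, hR⟩ := ih
    refine ⟨fun f => cupOp q C₁.length (T f), fun t f => ?_, fun col => ?_,
      fun m c c' Ψ h1 h2 h3 h4 hΨ => ?_⟩
    · simp only [hT, cupOp_smul]
    · have := cupOp_append q (T fun γ => if γ = L.map (fun i => col (Sum.inl i)) then 1 else 0)
        (C₁.map fun i => col (Sum.inr i)) (C₂.map fun i => col (Sum.inr i))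
        (col (Sum.inr a)) (col (Sum.inr b))
      rw [List.length_map] at this
      simp only [List.map_append, List.map_cons] at hTM ⊢
      rw [this, hTM, Multiset.map_cons, Multiset.prod_cons, coupleWt_col q col hab]
    · obtain ⟨c₁, c₂, hc₁, hc₂, hc⟩ := exists_perm_single_single
        (c := c') (k := C₁.length) (l := C₂.length) (by simp at h2; omega)
      have e1 := hc.length_eq
      have e2 := hc.count_eq .single
      have e3 := hc.count_eq .both
      simp at e1 e2 e3
      have := (hR m c (c₁ ++ .both :: .none :: c₂) Ψ h1 (by simp [hc₁, hc₂]) (by simp; omega)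
        (by simp; omega) hΨ).cup hq
      rw [hc₁] at this
      exact this.perm hq hc.symm

end Kernel

section Planar

/-- `M` is a noncrossing perfect matching of `G`. -/
structure IsPlanar (G : Finset Elt) (M : Finset (Elt × Elt)) : Prop where
  mem : ∀ p ∈ M, p.1 ∈ G ∧ p.2 ∈ G ∧ cLT p.1 p.2
  existsUnique : ∀ y ∈ G, ∃! p, p ∈ M ∧ (p.1 = y ∨ p.2 = y)
  noncrossing : ∀ p ∈ M, ∀ p' ∈ M, ¬ (cLT p.1 p'.1 ∧ cLT p'.1 p.2 ∧ cLT p.2 p'.2)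

variable {G G' : Finset Elt} {M : Finset (Elt × Elt)}

theorem IsPlanar.eq_of_mem (h : IsPlanar G M) {p p' : Elt × Elt} (hp : p ∈ M) (hp' : p' ∈ M)
    {y : Elt} (hy : p.1 = y ∨ p.2 = y) (hy' : p'.1 = y ∨ p'.2 = y) : p = p' := by
  have hG : y ∈ G := by
    rcases hy with rfl | rfl
    · exact (h.mem p hp).1
    · exact (h.mem p hp).2.1
  exact (h.existsUnique y hG).unique ⟨hp, hy⟩ ⟨hp', hy'⟩

theorem IsPlanar.erase (h : IsPlanar G M) {p : Elt × Elt} (hp : p ∈ M)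
    (hG' : ∀ y, y ∈ G' ↔ y ∈ G ∧ y ≠ p.1 ∧ y ≠ p.2) : IsPlanar G' (M.erase p) := by
  refine ⟨fun p' hp' => ?_, fun y hy => ?_, fun a ha b hb =>
    h.noncrossing a (Finset.mem_of_mem_erase ha) b (Finset.mem_of_mem_erase hb)⟩
  · obtain ⟨hne, hp'⟩ := Finset.mem_erase.1 hp'
    obtain ⟨h1, h2, h3⟩ := h.mem p' hp'
    refine ⟨(hG' _).2 ⟨h1, fun e => hne ?_, fun e => hne ?_⟩,
      (hG' _).2 ⟨h2, fun e => hne ?_, fun e => hne ?_⟩, h3⟩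
    · exact h.eq_of_mem hp' hp (.inl e) (.inl rfl)
    · exact h.eq_of_mem hp' hp (.inl e) (.inr rfl)
    · exact h.eq_of_mem hp' hp (.inr e) (.inl rfl)
    · exact h.eq_of_mem hp' hp (.inr e) (.inr rfl)
  · obtain ⟨hyG, h1, h2⟩ := (hG' y).1 hy
    obtain ⟨p', ⟨hp', hy'⟩, -⟩ := h.existsUnique y hyG
    refine ⟨p', ⟨Finset.mem_erase.2 ⟨?_, hp'⟩, hy'⟩, fun p'' h'' =>
      h.eq_of_mem (Finset.mem_of_mem_erase h''.1) hp' h''.2 hy'⟩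
    rintro rfl
    rcases hy' with e | e
    · exact h1 e.symm
    · exact h2 e.symm

/-- The numerical gap of a couple. -/
def gap (p : Elt × Elt) : ℕ := Nat.dist (eVal p.1) (eVal p.2)

theorem IsPlanar.not_between (h : IsPlanar G M) {p : Elt × Elt} (hp : p ∈ M)
    (hs : sameSide p.1 p.2) (hmin : ∀ p' ∈ M, sameSide p'.1 p'.2 → gap p ≤ gap p') :
    ∀ y ∈ G, ¬ (cLT p.1 y ∧ cLT y p.2) := by
  rintro y hy ⟨h1, h2⟩
  obtain ⟨p', ⟨hp', hy'⟩, -⟩ := h.existsUnique y hy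
  have hne : p' ≠ p := by
    rintro rfl
    have hirr : ∀ z : Elt, ¬ cLT z z := by rintro (z | z) <;> simp [cLT]
    rcases hy' with rfl | rfl
    · exact hirr _ h1
    · exact hirr _ h2
  have hm := hmin p' hp'
  have hc := h.noncrossing p hp p' hp'
  have hc' := h.noncrossing p' hp' p hp
  have hlt := (h.mem p' hp').2.2
  have e1 : p'.1 ≠ p.1 := fun e => hne (h.eq_of_mem hp' hp (.inl e) (.inl rfl))
  have e2 : p'.2 ≠ p.2 := fun e => hne (h.eq_of_mem hp' hp (.inr e) (.inr rfl))
  obtain ⟨a, b⟩ := p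
  obtain ⟨a', b'⟩ := p'
  rcases hy' with rfl | rfl <;> rcases a with a | a <;> rcases b with b | b <;>
    rcases a' with a' | a' <;> rcases b' with b' | b' <;>
    simp only [cLT, gap, sameSide, eVal, Sum.isLeft_inl, Sum.isLeft_inr, Nat.dist, Sum.elim_inl,
      Sum.elim_inr, id, ne_eq, Sum.inl.injEq, Sum.inr.injEq, true_and, and_true, forall_const,
      reduceCtorEq] at * <;>
    omega

theorem exists_eq_append_cons_cons {L : List ℕ} (hL : L.Pairwise (· < ·)) {a b : ℕ} (ha : a ∈ L)
    (hb : b ∈ L) (hab : a < b) (h : ∀ e ∈ L, ¬ (a < e ∧ e < b)) :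
    ∃ L₁ L₂, L = L₁ ++ a :: b :: L₂ := by
  obtain ⟨L₁, L', rfl⟩ := List.append_of_mem ha
  rw [List.pairwise_append, List.pairwise_cons] at hL
  obtain ⟨-, ⟨h1, h2⟩, h3⟩ := hL
  have hbL : b ∈ L' := by
    rcases List.mem_append.1 hb with hb | hb
    · have := h3 b hb a (by simp)
      omega
    · rcases List.mem_cons.1 hb with rfl | hb
      · omega
      · exact hb
  rcases L' with _ | ⟨e, L₂⟩
  · simp at hbL
  · have he : e = b := by
      rcases List.mem_cons.1 hbL with rfl | hb'
      · rfl
      · have := (List.pairwise_cons.1 h2).1 b hb'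
        exact absurd ⟨h1 e (by simp), this⟩ (h e (by simp))
    exact ⟨L₁, L₂, by rw [he]⟩

/-- The set of rows listed in `L` and columns listed in `C`. -/
def board (L C : List ℕ) : Finset Elt := L.toFinset.image Sum.inl ∪ C.toFinset.image Sum.inr

theorem inl_mem_board {L C : List ℕ} {i : ℕ} : Sum.inl i ∈ board L C ↔ i ∈ L := by
  simp [board]

theorem inr_mem_board {L C : List ℕ} {j : ℕ} : Sum.inr j ∈ board L C ↔ j ∈ C := by
  simp [board]

theorem IsPlanar.eq_zipWith {L C : List ℕ} (hL : L.Pairwise (· < ·)) (hC : C.Pairwise (· < ·))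
    (h : IsPlanar (board L C) M) (hs : ∀ p ∈ M, ¬ sameSide p.1 p.2) :
    L.length = C.length ∧
      M.val = (List.zipWith (fun i j => (Sum.inl i, Sum.inr j)) L C : List (Elt × Elt)) := by
  have hside : ∀ p ∈ M, ∃ i j, p = (Sum.inl i, Sum.inr j) := by
    rintro ⟨i | i, j | j⟩ hp
    · exact absurd rfl (hs _ hp)
    · exact ⟨i, j, rfl⟩
    · exact absurd (h.mem _ hp).2.2 (by simp [cLT])
    · exact absurd rfl (hs _ hp)
  induction L generalizing C M with
  | nil =>
    have hM : M = ∅ := by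
      refine Finset.eq_empty_of_forall_notMem fun p hp => ?_
      obtain ⟨i, j, rfl⟩ := hside p hp
      simpa [inl_mem_board] using (h.mem _ hp).1
    rcases C with _ | ⟨j, C⟩
    · simp [hM]
    · obtain ⟨p, ⟨hp, -⟩, -⟩ := h.existsUnique (Sum.inr j) (inr_mem_board.2 (by simp))
      simp [hM] at hp
  | cons i L ih =>
    obtain ⟨p, ⟨hp, hpi⟩, -⟩ := h.existsUnique (Sum.inl i) (inl_mem_board.2 (by simp))
    obtain ⟨i', j, rfl⟩ := hside p hp
    obtain rfl : i' = i := by simpa using hpi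
    have hjC := inr_mem_board.1 (h.mem _ hp).2.1
    rcases C with _ | ⟨j₀, C⟩
    · simp at hjC
    · rw [List.pairwise_cons] at hL hC
      obtain rfl : j₀ = j := by
        rcases List.mem_cons.1 hjC with rfl | hj
        · rfl
        · have hlt := hC.1 j hj
          obtain ⟨p', ⟨hp', hpj⟩, -⟩ := h.existsUnique (Sum.inr j₀) (inr_mem_board.2 (by simp))
          obtain ⟨l, j', rfl⟩ := hside p' hp'
          obtain rfl : j' = j₀ := by simpa using hpj
          have hl := inl_mem_board.1 (h.mem _ hp').1
          rcases List.mem_cons.1 hl with rfl | hl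
          · have := h.eq_of_mem hp hp' (.inl rfl) (.inl rfl)
            simpa using this.symm
          · exact absurd ⟨hL.1 l hl, trivial, hlt⟩ (h.noncrossing _ hp _ hp')
      have hi : i' ∉ L := fun hi => lt_irrefl _ (hL.1 _ hi)
      have hj : j₀ ∉ C := fun hj => lt_irrefl _ (hC.1 _ hj)
      have := ih hL.2 hC.2 (M := M.erase (Sum.inl i', Sum.inr j₀)) (h.erase hp ?_)
        (fun p hp => hs p (Finset.mem_of_mem_erase hp))
        (fun p hp => hside p (Finset.mem_of_mem_erase hp))
      · refine ⟨by simpa using this.1, ?_⟩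
        rw [List.zipWith_cons_cons, ← Multiset.cons_coe, ← this.2, Finset.erase_val,
          Multiset.cons_erase (Finset.mem_def.1 hp)]
      · rintro (l | l)
        · simp only [inl_mem_board, List.mem_cons, ne_eq, Sum.inl.injEq, reduceCtorEq,
            not_false_eq_true, and_true]
          exact ⟨fun hl => ⟨.inr hl, fun e => hi (e ▸ hl)⟩, fun hl => hl.1.resolve_left hl.2⟩
        · simp only [inr_mem_board, List.mem_cons, ne_eq, Sum.inr.injEq, reduceCtorEq,
            not_false_eq_true, true_and]
          exact ⟨fun hl => ⟨.inr hl, fun e => hj (e ▸ hl)⟩, fun hl => hl.1.resolve_left hl.2⟩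

theorem mem_append_iff_of_nodup {L₁ L₂ : List ℕ} {a b l : ℕ}
    (h : (L₁ ++ a :: b :: L₂).Nodup) :
    l ∈ L₁ ++ L₂ ↔ l ∈ L₁ ++ a :: b :: L₂ ∧ l ≠ a ∧ l ≠ b := by
  have h' : (a :: b :: (L₁ ++ L₂)).Nodup := by
    refine (List.Perm.nodup_iff ?_).1 h
    exact List.perm_middle.trans (List.Perm.cons _ List.perm_middle)
  simp only [List.nodup_cons, List.mem_cons, not_or] at h'
  simp only [List.mem_append, List.mem_cons] at h' ⊢
  grind

theorem IsPlanar.nc {L C : List ℕ} (hL : L.Pairwise (· < ·)) (hC : C.Pairwise (· < ·))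
    (h : IsPlanar (board L C) M) : NC L C M.val := by
  induction hn : M.card using Nat.strong_induction_on generalizing L C M with
  | _ n ih =>
  by_cases hs : ∀ p ∈ M, ¬ sameSide p.1 p.2
  · obtain ⟨h1, h2⟩ := h.eq_zipWith hL hC hs
    rw [h2]
    exact NC.base L C h1
  · push Not at hs
    obtain ⟨p₀, hp₀, hs₀⟩ := hs
    obtain ⟨p, hp, hmin⟩ := Finset.exists_min_image (M.filter fun p => sameSide p.1 p.2) gap
      ⟨p₀, Finset.mem_filter.2 ⟨hp₀, hs₀⟩⟩
    obtain ⟨hp, hps⟩ := Finset.mem_filter.1 hp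
    have hb := h.not_between hp hps fun p' hp' hs' => hmin p' (Finset.mem_filter.2 ⟨hp', hs'⟩)
    have hcard : (M.erase p).card < n := by
      rw [← hn]
      exact Finset.card_erase_lt_of_mem hp
    rw [← Multiset.cons_erase (Finset.mem_def.1 hp), ← Finset.erase_val]
    obtain ⟨h1, h2, h3⟩ := h.mem p hp
    rcases p with ⟨a | a, b | b⟩
    · obtain ⟨L₁, L₂, rfl⟩ := exists_eq_append_cons_cons hL (inl_mem_board.1 h1)
        (inl_mem_board.1 h2) h3 fun e he => hb (Sum.inl e) (inl_mem_board.2 he)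
      refine NC.row L₁ L₂ C a b _ h3 (ih _ hcard (hL.sublist ?_) hC (h.erase hp ?_) rfl)
      · exact (List.Sublist.refl _).append
          ((List.sublist_cons_self b L₂).trans (List.sublist_cons_self a _))
      · rintro (l | l)
        · simpa only [inl_mem_board, ne_eq, Sum.inl.injEq] using
            mem_append_iff_of_nodup (hL.imp fun h => h.ne)
        · simp [inr_mem_board]
    · simp [sameSide] at hps
    · simp [sameSide] at hps
    · obtain ⟨C₁, C₂, rfl⟩ := exists_eq_append_cons_cons hC (inr_mem_board.1 h2)
        (inr_mem_board.1 h1) h3 fun e he h' => hb (Sum.inr e) (inr_mem_board.2 he) ⟨h'.2, h'.1⟩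
      refine NC.col L C₁ C₂ b a _ h3 (ih _ hcard hL (hC.sublist ?_) (h.erase hp ?_) rfl)
      · exact (List.Sublist.refl _).append
          ((List.sublist_cons_self a C₂).trans (List.sublist_cons_self b _))
      · rintro (l | l)
        · simp [inl_mem_board]
        · simpa only [inr_mem_board, ne_eq, Sum.inr.injEq, and_comm (a := ¬ l = a)] using
            mem_append_iff_of_nodup (hC.imp fun h => h.ne)

end Planar

section Pattern

theorem colSet_injective {k : ℕ} {c : List Occ} {γ ρ : List Bool} (hγ : γ.length = c.count .single)
    (hρ : ρ.length = c.count .single) (h : colSet k c γ = colSet k c ρ) : γ = ρ := by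
  induction c generalizing k γ ρ with
  | nil =>
    simp only [List.count_nil, List.length_eq_zero_iff] at hγ hρ
    rw [hγ, hρ]
  | cons x c ih =>
    have hk : ∀ γ, k ∉ colSet (k + 1) c γ := fun γ hk => by
      have := mem_colSet hk
      omega
    have key : ∀ s t : Bool, ∀ γ ρ, (if s then {k} else ∅) ∪ colSet (k + 1) c γ =
        (if t then {k} else ∅) ∪ colSet (k + 1) c ρ →
          s = t ∧ colSet (k + 1) c γ = colSet (k + 1) c ρ := by
      intro s t γ ρ h
      constructor
      · have := congrArg (k ∈ ·) h
        cases s <;> cases t <;> simp [hk] at this ⊢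
      · ext l
        have hl := congrArg (l ∈ ·) h
        by_cases e : l = k
        · subst e
          simp [hk]
        · have : ∀ s : Bool, l ∉ if s then ({k} : Finset ℕ) else ∅ := by
            intro s
            cases s <;> simp [e]
          simpa only [Finset.mem_union, this, false_or, eq_iff_iff] using hl
    obtain ⟨h1, h2⟩ := key _ _ _ _ h
    cases x with
    | none => exact ih (by simpa using hγ) (by simpa using hρ) h2
    | both => exact ih (by simpa using hγ) (by simpa using hρ) h2
    | single =>
      rcases γ with _ | ⟨e, γ⟩
      · simp at hγ
      rcases ρ with _ | ⟨e', ρ⟩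
      · simp at hρ
      rw [show e = e' from h1, ih (γ := γ) (ρ := ρ) (by simpa using hγ) (by simpa using hρ) h2]

theorem colSet_map_range' (occ : ℕ → Occ) (f : ℕ → Bool) (k N : ℕ) :
    colSet k ((List.range' k N).map occ)
      (((List.range' k N).filter fun l => occ l = .single).map f) =
        (List.range' k N).toFinset.filter fun l => occ l = .both ∨ occ l = .single ∧ f l := by
  induction N generalizing k with
  | zero => simp [colSet]
  | succ N ih =>
    rw [List.range'_succ, List.map_cons, List.toFinset_cons, Finset.filter_insert, List.filter_cons]
    cases h : occ k with
    | none => simp [colSet, Occ.bit, Occ.rest, ih]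
    | both => simp [colSet, Occ.bit, Occ.rest, ih]
    | single =>
      simp [colSet, Occ.bit, Occ.rest, ih]
      split_ifs <;> simp

/-- The occurrence of an index in two sets with intersection `X` and union `U`. -/
def occOf (X U : Finset ℕ) (l : ℕ) : Occ :=
  if l ∈ X then .both else if l ∈ U then .single else .none

/-- The occurrences of the indices `1, …, N` in two sets with intersection `X` and union `U`. -/
def pattern (N : ℕ) (X U : Finset ℕ) : List Occ := (List.range' 1 N).map (occOf X U)

/-- The indices among `1, …, N` which lie in exactly one of two sets with intersection `X` and
union `U`. -/
def singles (N : ℕ) (X U : Finset ℕ) : List ℕ :=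
  (List.range' 1 N).filter fun l => occOf X U l = .single

theorem count_map_eq_length_filter (occ : ℕ → Occ) (L : List ℕ) (a : Occ) :
    (L.map occ).count a = (L.filter fun l => occ l = a).length := by
  induction L with
  | nil => rfl
  | cons l L ih =>
    rw [List.map_cons, List.count_cons, ih, List.filter_cons]
    by_cases h : occ l = a <;> simp [h]

theorem length_pattern (N : ℕ) (X U : Finset ℕ) : (pattern N X U).length = N := by
  simp [pattern]

theorem count_single_pattern (N : ℕ) (X U : Finset ℕ) :
    (pattern N X U).count .single = (singles N X U).length := by
  rw [pattern, count_map_eq_length_filter]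
  rfl

theorem pairwise_singles (N : ℕ) (X U : Finset ℕ) : (singles N X U).Pairwise (· < ·) :=
  List.Pairwise.filter _ List.pairwise_lt_range'

theorem occOf_eq_single {X U : Finset ℕ} {l : ℕ} : occOf X U l = .single ↔ l ∈ U ∧ l ∉ X := by
  unfold occOf
  split_ifs <;> simp_all

theorem occOf_eq_both {X U : Finset ℕ} {l : ℕ} : occOf X U l = .both ↔ l ∈ X := by
  unfold occOf
  split_ifs <;> simp_all

variable {N : ℕ} {I I' : Finset ℕ}

theorem mem_singles {X U : Finset ℕ} (hU : U ⊆ Finset.Icc 1 N) {l : ℕ} :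
    l ∈ singles N X U ↔ l ∈ U ∧ l ∉ X := by
  simp only [singles, List.mem_filter, List.mem_range'_1, decide_eq_true_eq, occOf_eq_single]
  refine ⟨fun h => h.2, fun h => ⟨?_, h⟩⟩
  have := Finset.mem_Icc.1 (hU h.1)
  omega

theorem colSet_pattern (hI : I ⊆ Finset.Icc 1 N) (f : ℕ → Bool)
    (hf : ∀ l, l ∈ I ∪ I' → l ∉ I ∩ I' → (f l = true ↔ l ∈ I)) :
    colSet 1 (pattern N (I ∩ I') (I ∪ I')) ((singles N (I ∩ I') (I ∪ I')).map f) = I := by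
  unfold pattern singles
  rw [colSet_map_range']
  ext l
  simp only [Finset.mem_filter, List.mem_toFinset, List.mem_range'_1, occOf_eq_both,
    occOf_eq_single]
  have h1 := hf l
  have h2 : l ∈ I → 1 ≤ l ∧ l < 1 + N := fun h => by
    have := Finset.mem_Icc.1 (hI h)
    omega
  simp only [Finset.mem_union, Finset.mem_inter] at h1 ⊢
  tauto

theorem count_pattern (hI : I ⊆ Finset.Icc 1 N) (hI' : I' ⊆ Finset.Icc 1 N) :
    (pattern N (I ∩ I') (I ∪ I')).count .single + 2 * (pattern N (I ∩ I') (I ∪ I')).count .both =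
      I.card + I'.card := by
  have hc : ∀ a, (pattern N (I ∩ I') (I ∪ I')).count a =
      ((Finset.Icc 1 N).filter fun l => occOf (I ∩ I') (I ∪ I') l = a).card := by
    intro a
    have : (Finset.Icc 1 N).filter (fun l => occOf (I ∩ I') (I ∪ I') l = a) =
        ((List.range' 1 N).filter fun l => occOf (I ∩ I') (I ∪ I') l = a).toFinset := by
      ext l
      simp only [Finset.mem_filter, Finset.mem_Icc, List.mem_toFinset, List.mem_filter,
        List.mem_range'_1, decide_eq_true_eq]
      have : l < 1 + N ↔ l ≤ N := by omega
      rw [this]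
    rw [this, List.toFinset_card_of_nodup (List.Nodup.filter _ List.nodup_range'), pattern,
      count_map_eq_length_filter]
  have hU : I ∪ I' ⊆ Finset.Icc 1 N := Finset.union_subset hI hI'
  have h1 : (Finset.Icc 1 N).filter (fun l => occOf (I ∩ I') (I ∪ I') l = .single) =
      (I ∪ I') \ (I ∩ I') := by
    ext l
    simp only [Finset.mem_filter, occOf_eq_single, Finset.mem_sdiff]
    exact ⟨fun h => h.2, fun h => ⟨hU h.1, h⟩⟩
  have hXU : I ∩ I' ⊆ I ∪ I' := Finset.inter_subset_left.trans Finset.subset_union_left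
  have h2 : (Finset.Icc 1 N).filter (fun l => occOf (I ∩ I') (I ∪ I') l = .both) = I ∩ I' := by
    ext l
    simp only [Finset.mem_filter, occOf_eq_both]
    exact ⟨fun h => h.2, fun h => ⟨hU (hXU h), h⟩⟩
  rw [hc, hc, h1, h2, Finset.card_sdiff_of_subset hXU]
  have := Finset.card_union_add_card_inter I I'
  have := Finset.card_le_card hXU
  omega

end Pattern

section Functional

variable {m n : ℕ} {K : Type} [Field K]

theorem isPlanar_of_isFeasible {S : Cortege m n} {M : Finset (Elt × Elt)} (h : IsFeasible S M) :
    IsPlanar S.ground M :=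
  ⟨h.1, h.2.1, h.2.2.2⟩

theorem ground_eq_board (S : Cortege m n) {N : ℕ} (hm : m ≤ N) (hn : n ≤ N) :
    S.ground = board (singles N (S.I ∩ S.I') (S.I ∪ S.I'))
      (singles N (S.J ∩ S.J') (S.J ∪ S.J')) := by
  have h1 : S.I ∪ S.I' ⊆ Finset.Icc 1 N :=
    (Finset.union_subset S.hIm S.hI'm).trans (Finset.Icc_subset_Icc_right hm)
  have h2 : S.J ∪ S.J' ⊆ Finset.Icc 1 N :=
    (Finset.union_subset S.hJn S.hJ'n).trans (Finset.Icc_subset_Icc_right hn)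
  ext (l | l)
  · rw [inl_mem_board, mem_singles h1]
    simp [Cortege.ground, Cortege.whites, Cortege.blacks]
    tauto
  · rw [inr_mem_board, mem_singles h2]
    simp [Cortege.ground, Cortege.whites, Cortege.blacks]
    tauto

/-- Two corteges have the same unions and intersections of row sets and of column sets. -/
def SameShape (S T : Cortege m n) : Prop :=
  S.I ∪ S.I' = T.I ∪ T.I' ∧ S.I ∩ S.I' = T.I ∩ T.I' ∧
    S.J ∪ S.J' = T.J ∪ T.J' ∧ S.J ∩ S.J' = T.J ∩ T.J'

theorem SameShape.ground_eq {S T : Cortege m n} (h : SameShape S T) : S.ground = T.ground := by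
  obtain ⟨h1, h2, h3, h4⟩ := h
  rw [ground_eq_board S (le_max_left m n) (le_max_right m n),
    ground_eq_board T (le_max_left m n) (le_max_right m n), h1, h2, h3, h4]

/-- The coloring of a cortege (`true` is white). -/
def coloring (S : Cortege m n) (y : Elt) : Bool := decide (y ∈ S.whites)

/-- For a feasible matching `M`, some functional of quadratic expressions in quantum minors
evaluates products attached to corteges as products of weights of the couples of `M`. -/
theorem exists_functional {q : K} (hq : q ≠ 0) {S : Cortege m n} {M : Finset (Elt × Elt)}
    (hM : IsFeasible S M) :
    ∃ (A : Type) (instA : Ring A), letI := instA; ∃ (instB : Algebra K A), letI := instB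
      ∃ (x : ℕ → ℕ → A) (φ : A →ₗ[K] K), IsQMatrix q m n x ∧
        ∀ T : Cortege m n, SameShape S T →
          φ (qMinor q x T.I T.J * qMinor q x T.I' T.J') = ∏ p ∈ M, coupleWt q (coloring T) p := by
  have hm := le_max_left m n
  have hn := le_max_right m n
  set N := max m n
  have hM' := isPlanar_of_isFeasible hM
  rw [ground_eq_board S hm hn] at hM'
  obtain ⟨Tr, -, hTr, hR⟩ :=
    (hM'.nc (pairwise_singles _ _ _) (pairwise_singles _ _ _)).exists_operator hq
  have hr := fun T : Cortege m n => T.hIm.trans (Finset.Icc_subset_Icc_right hm)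
  have hr' := fun T : Cortege m n => T.hI'm.trans (Finset.Icc_subset_Icc_right hm)
  have hc := fun T : Cortege m n => T.hJn.trans (Finset.Icc_subset_Icc_right hn)
  have hc' := fun T : Cortege m n => T.hJ'n.trans (Finset.Icc_subset_Icc_right hn)
  obtain ⟨A, iA, iB, x, φ, hx, hφ⟩ := hR m _ (pattern N (S.J ∩ S.J') (S.J ∪ S.J')) _
    (count_single_pattern N (S.I ∩ S.I') (S.I ∪ S.I')) (count_single_pattern _ _ _)
    (by simp only [length_pattern])
    (by rw [count_pattern (hr S) (hr' S), count_pattern (hc S) (hc' S), S.hIJ, S.hI'J'])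
    (realizable_base q m _)
  rw [length_pattern] at hx
  refine ⟨A, iA, iB, x, φ, ?_, fun T hST => ?_⟩
  · obtain ⟨h1, h2, h3, h4⟩ := hx
    exact ⟨fun i j k a b c d e => h1 i j k a b c d (e.trans hn),
      fun i l j a b c d e => h2 i l j a b c d (e.trans hn),
      fun i l j k a b c d e f => h3 i l j k a b c d e (f.trans hn),
      fun i l j k a b c d e f => h4 i l j k a b c d e (f.trans hn)⟩
  · obtain ⟨e1, e2, e3, e4⟩ := hST
    have hJ := colSet_pattern (I' := T.J') (hc T) (fun j => coloring T (Sum.inr j)) (by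
      intro l h1 h2
      simp [coloring, Cortege.whites] at h1 h2 ⊢
      tauto)
    have hJ' := colSet_pattern (I' := T.J) (hc' T) (fun j => ! coloring T (Sum.inr j)) (by
      intro l h1 h2
      simp [coloring, Cortege.whites] at h1 h2 ⊢
      tauto)
    have hI := colSet_pattern (I' := T.I') (hr T) (fun j => coloring T (Sum.inl j)) (by
      intro l h1 h2
      simp [coloring, Cortege.whites] at h1 h2 ⊢
      tauto)
    have hI' := colSet_pattern (I' := T.I) (hr' T) (fun j => ! coloring T (Sum.inl j)) (by
      intro l h1 h2
      simp [coloring, Cortege.whites] at h1 h2 ⊢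
      tauto)
    rw [Finset.inter_comm, Finset.union_comm] at hJ' hI'
    rw [← e1, ← e2] at hI hI'
    rw [← e3, ← e4] at hJ hJ'
    have hmap : ∀ (L : List ℕ) (f : ℕ → Bool), (L.map f).map not = L.map fun j => ! f j := by
      intro L f
      rw [List.map_map]
      rfl
    have := hφ T.I T.I' ((singles N (S.J ∩ S.J') (S.J ∪ S.J')).map fun j =>
      coloring T (Sum.inr j)) (by rw [List.length_map, count_single_pattern])
    rw [hJ, hmap, hJ'] at this
    rw [this]
    refine Eq.trans ?_ (hTr (coloring T))
    refine congrFun (congrArg Tr (funext fun γ => ?_)) _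
    refine if_congr ⟨fun h => ?_, fun h => ?_⟩ rfl rfl
    · refine colSet_injective h.1 (by rw [List.length_map, count_single_pattern]) ?_ (k := 1)
      rw [hI, h.2.1]
    · subst h
      rw [hmap, hI, hI', List.length_map, count_single_pattern]
      exact ⟨rfl, rfl, rfl⟩

end Functional

section Matching

variable {m n : ℕ} {S T : Cortege m n} {M : Finset (Elt × Elt)}

theorem mem_blacks_iff {y : Elt} (h : y ∈ S.ground) : y ∈ S.blacks ↔ y ∉ S.whites := by
  rcases y with y | y <;>
  · simp [Cortege.ground, Cortege.whites, Cortege.blacks] at h ⊢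
    tauto

/-- The number of couples within one side whose numerically smaller element is white. -/
def whiteCount (S : Cortege m n) (M : Finset (Elt × Elt)) : ℕ :=
  (M.filter fun p => sameSide p.1 p.2 ∧ numMin p ∈ S.whites).card

open Classical in
theorem prod_coupleWt {K : Type} [Field K] (q : K) (hM : IsFeasible S M) (h : SameShape S T) :
    ∏ p ∈ M, coupleWt q (coloring T) p = if IsFeasible T M then q ^ whiteCount T M else 0 := by
  have hg := h.ground_eq
  have hp : ∀ p ∈ M, coupleWt q (coloring T) p =
      if (sameSide p.1 p.2 → (p.1 ∈ T.whites ↔ p.2 ∈ T.blacks)) ∧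
          (¬ sameSide p.1 p.2 → (p.1 ∈ T.whites ↔ p.2 ∈ T.whites)) then
        if sameSide p.1 p.2 ∧ numMin p ∈ T.whites then q else 1
      else 0 := by
    intro p hp
    simp only [mem_blacks_iff (hg ▸ (hM.1 p hp).2.1 : p.2 ∈ T.ground)]
    by_cases h1 : Sum.isLeft p.1 = Sum.isLeft p.2 <;> by_cases h2 : p.1 ∈ T.whites <;>
      by_cases h3 : p.2 ∈ T.whites <;> simp [coupleWt, coloring, sameSide, h1, h2, h3]
  rw [Finset.prod_congr rfl hp]
  split_ifs with hT
  · rw [whiteCount, ← Finset.prod_const, Finset.prod_filter]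
    exact Finset.prod_congr rfl fun p hp => if_pos (hT.2.2.1 p hp)
  · have : ∃ p ∈ M, ¬ ((sameSide p.1 p.2 → (p.1 ∈ T.whites ↔ p.2 ∈ T.blacks)) ∧
        (¬ sameSide p.1 p.2 → (p.1 ∈ T.whites ↔ p.2 ∈ T.whites))) := by
      by_contra! hall
      exact hT ⟨hg ▸ hM.1, hg ▸ hM.2.1, hall, hM.2.2.2⟩
    obtain ⟨p, hp, hn⟩ := this
    exact Finset.prod_eq_zero hp (if_neg hn)

theorem agree_iff_of_mem (hS : IsFeasible S M) (hT : IsFeasible T M) {p : Elt × Elt} (hp : p ∈ M) :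
    (p.1 ∈ S.whites ↔ p.1 ∈ T.whites) ↔ (p.2 ∈ S.whites ↔ p.2 ∈ T.whites) := by
  have h1 := hS.2.2.1 p hp
  have h2 := hT.2.2.1 p hp
  rw [mem_blacks_iff (hS.1 p hp).2.1] at h1
  rw [mem_blacks_iff (hT.1 p hp).2.1] at h2
  by_cases hs : sameSide p.1 p.2
  · rw [h1.1 hs, h2.1 hs, not_iff_not]
  · rw [h1.2 hs, h2.2 hs]

theorem agree_iff_notMem_differSet (hS : IsFeasible S M) (hT : IsFeasible T M) {p : Elt × Elt}
    (hp : p ∈ M) {y : Elt} (hy : p.1 = y ∨ p.2 = y) :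
    (y ∈ S.whites ↔ y ∈ T.whites) ↔ p ∉ differSet S T M := by
  have := agree_iff_of_mem hS hT hp
  simp only [differSet, Finset.mem_filter, hp, true_and]
  rcases hy with rfl | rfl <;> tauto

theorem isExchange_differSet (hS : IsFeasible S M) (hT : IsFeasible T M) (h : SameShape S T) :
    IsExchange S T (differSet S T M) := by
  have hg := h.ground_eq
  obtain ⟨h1, h2, h3, h4⟩ := h
  refine ⟨h2, h4, h1, h3, fun a ha => ⟨fun hc => ?_, fun hc => ?_⟩⟩
  · obtain ⟨p, hp, hpa⟩ : ∃ p ∈ differSet S T M, p.1 = a ∨ p.2 = a := by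
      simp only [coveredBy, Finset.mem_union, Finset.mem_image] at hc
      rcases hc with ⟨p, hp, e⟩ | ⟨p, hp, e⟩
      · exact ⟨p, hp, .inl e⟩
      · exact ⟨p, hp, .inr e⟩
    have := (agree_iff_notMem_differSet hS hT (Finset.mem_filter.1 hp).1 hpa).not.2
      (not_not.2 hp)
    rw [mem_blacks_iff (hg ▸ ha)]
    tauto
  · obtain ⟨p, ⟨hp, hpa⟩, -⟩ := hS.2.1 a ha
    refine (agree_iff_notMem_differSet hS hT hp hpa).2 fun hd => hc ?_
    simp only [coveredBy, Finset.mem_union, Finset.mem_image]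
    rcases hpa with e | e
    · exact .inl ⟨p, hd, e⟩
    · exact .inr ⟨p, hd, e⟩

theorem whiteCount_sub_whiteCount (hS : IsFeasible S M) (hT : IsFeasible T M) :
    (whiteCount S M : ℤ) - whiteCount T M =
      (zetaWhite S (differSet S T M) : ℤ) - zetaBlack S (differSet S T M) := by
  have hdiff : ∀ P : Elt × Elt → Prop, ∀ [DecidablePred P],
      (((differSet S T M).filter P).card : ℤ) =
        ∑ p ∈ M, if p ∈ differSet S T M ∧ P p then 1 else 0 := by
    intro P _
    rw [Finset.card_filter, ← Finset.sum_filter_add_sum_filter_not M (· ∈ differSet S T M)]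
    have : M.filter (· ∈ differSet S T M) = differSet S T M :=
      Finset.filter_mem_eq_inter.trans (Finset.inter_eq_right.2 (Finset.filter_subset _ _))
    rw [this, Finset.sum_eq_zero (s := M.filter _), add_zero]
    · push_cast
      exact Finset.sum_congr rfl fun p hp => by simp [hp]
    · intro p hp
      rw [if_neg fun h => (Finset.mem_filter.1 hp).2 h.1]
  rw [zetaWhite, zetaBlack, hdiff, hdiff, whiteCount, whiteCount, Finset.card_filter,
    Finset.card_filter]
  push_cast
  rw [← Finset.sum_sub_distrib, ← Finset.sum_sub_distrib]
  refine Finset.sum_congr rfl fun p hp => ?_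
  have hmin : p.1 = numMin p ∨ p.2 = numMin p := by
    unfold numMin
    split_ifs <;> simp
  have h1 := agree_iff_notMem_differSet hS hT hp hmin
  have h2 : numMin p ∈ S.blacks ↔ numMin p ∉ S.whites := by
    apply mem_blacks_iff
    rcases hmin with e | e
    · exact e ▸ (hS.1 p hp).1
    · exact e ▸ (hS.1 p hp).2.1
  by_cases e1 : sameSide p.1 p.2 <;> by_cases e2 : numMin p ∈ S.whites <;>
    by_cases e3 : numMin p ∈ T.whites <;> by_cases e4 : p ∈ differSet S T M <;>
    simp only [e1, e2, e3, e4, h2] at h1 ⊢ <;> simp at h1 ⊢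

end Matching

open Polynomial in
theorem card_fiber_eq_of_sum_zpow_eq {K : Type} [Field K] [CharZero K] {q : K} (hq : q ≠ 0)
    (htr : Transcendental ℚ q) {ι κ : Type} (s : Finset ι) (t : Finset κ) (a : ι → ℤ) (b : κ → ℤ)
    (h : ∑ i ∈ s, q ^ a i = ∑ k ∈ t, q ^ b k) (e : ℤ) :
    (s.filter (a · = e)).card = (t.filter (b · = e)).card := by
  obtain ⟨N, hNa, hNb, hNe⟩ : ∃ N : ℤ, (∀ i ∈ s, 0 ≤ a i + N) ∧ (∀ k ∈ t, 0 ≤ b k + N) ∧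
      0 ≤ e + N := by
    refine ⟨∑ i ∈ s, |a i| + ∑ k ∈ t, |b k| + |e|, fun i hi => ?_, fun k hk => ?_, ?_⟩
    · have := Finset.single_le_sum (fun i _ => abs_nonneg (a i)) hi
      have := Finset.sum_nonneg fun k (_ : k ∈ t) => abs_nonneg (b k)
      have := neg_abs_le (a i)
      have := abs_nonneg e
      linarith
    · have := Finset.single_le_sum (fun i _ => abs_nonneg (b i)) hk
      have := Finset.sum_nonneg fun k (_ : k ∈ s) => abs_nonneg (a k)
      have := neg_abs_le (b k)
      have := abs_nonneg e
      linarith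
    · have := Finset.sum_nonneg fun k (_ : k ∈ s) => abs_nonneg (a k)
      have := Finset.sum_nonneg fun k (_ : k ∈ t) => abs_nonneg (b k)
      have := neg_abs_le e
      linarith
  have hpow : ∀ z : ℤ, 0 ≤ z + N → q ^ (z + N).toNat = q ^ z * q ^ N := by
    intro z hz
    rw [← zpow_natCast, Int.toNat_of_nonneg hz, zpow_add₀ hq]
  let P : ℚ[X] := ∑ i ∈ s, X ^ (a i + N).toNat - ∑ k ∈ t, X ^ (b k + N).toNat
  have hP : P = 0 := by
    refine (transcendental_iff.1 htr) P ?_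
    simp only [P, map_sub, map_sum, map_pow, aeval_X]
    rw [Finset.sum_congr rfl fun i hi => hpow _ (hNa i hi),
      Finset.sum_congr rfl fun k hk => hpow _ (hNb k hk), ← Finset.sum_mul, ← Finset.sum_mul, h,
      sub_self]
  have hcoeff : ∀ {ι : Type} (s : Finset ι) (a : ι → ℤ), (∀ i ∈ s, 0 ≤ a i + N) →
      (∑ i ∈ s, (X : ℚ[X]) ^ (a i + N).toNat).coeff (e + N).toNat = (s.filter (a · = e)).card := by
    intro ι s a ha
    rw [finsetSum_coeff, Finset.card_filter]
    push_cast
    refine Finset.sum_congr rfl fun i hi => ?_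
    rw [coeff_X_pow]
    have := ha i hi
    congr 1
    simp only [eq_iff_iff]
    omega
  have := congrArg (coeff · (e + N).toNat) hP
  simp only [P, coeff_sub, hcoeff s a hNa, hcoeff t b hNb, coeff_zero, sub_eq_zero] at this
  exact_mod_cast this

theorem exists_equiv_comp_eq {α β δ : Type} (f : α → δ) (g : β → δ)
    (h : ∀ y, Nonempty ({a // f a = y} ≃ {b // g b = y})) :
    ∃ e : α ≃ β, ∀ a, g (e a) = f a := by
  refine ⟨(Equiv.sigmaFiberEquiv f).symm.trans ((Equiv.sigmaCongrRight fun y => (h y).some).trans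
    (Equiv.sigmaFiberEquiv g)), fun a => ?_⟩
  exact ((h (f a)).some ⟨a, rfl⟩).2

end QMinors

/-- Necessity of `q`-balancedness: if the quadruple is not `q`-balanced (with `q`
transcendental over `ℚ` in a field of characteristic zero), then some `q`-matrix
violates the corresponding quadratic relation. -/
theorem exists_qMatrix_violating_of_not_qBalanced
    {m n : ℕ}
    (K : Type) [Field K] [CharZero K] (q : K) (hq : q ≠ 0)
    (htr : Transcendental ℚ q)
    {ι κ : Type} [Fintype ι] [Fintype κ]
    (F : ι → Cortege m n) (G : κ → Cortege m n)
    (hhom : Homogeneous F G)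
    (α : ι → ℤ) (β : κ → ℤ)
    (hbal : ¬ QBalanced F G α β) :
    ∃ (A : Type) (instA : Ring A),
      letI := instA
      ∃ (instB : Algebra K A),
        letI := instB
        ∃ x : ℕ → ℕ → A, IsQMatrix q m n x ∧
          ∑ i, (q ^ α i) • (qMinor q x (F i).I (F i).J * qMinor q x (F i).I' (F i).J') ≠
            ∑ k, (q ^ β k) • (qMinor q x (G k).I (G k).J * qMinor q x (G k).I' (G k).J') := by
  classical
  open QMinors in
  by_contra! hcon
  have hF : ∀ S, ((∃ i, F i = S) ∨ ∃ k, G k = S) →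
      (∀ i, SameShape S (F i)) ∧ ∀ k, SameShape S (G k) := fun S hS =>
    ⟨fun i => hhom S _ hS (.inl ⟨i, rfl⟩), fun k => hhom S _ hS (.inr ⟨k, rfl⟩)⟩
  have hsum : ∀ M, ∑ i, q ^ α i * (if IsFeasible (F i) M then q ^ whiteCount (F i) M else 0) =
      ∑ k, q ^ β k * (if IsFeasible (G k) M then q ^ whiteCount (G k) M else 0) := by
    intro M
    by_cases hM : ∃ S, ((∃ i, F i = S) ∨ ∃ k, G k = S) ∧ IsFeasible S M
    · obtain ⟨S, hS, hM⟩ := hM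
      obtain ⟨A, _, _, x, φ, hx, hφ⟩ := exists_functional hq hM
      have := congrArg φ (hcon A inferInstance inferInstance x hx)
      simp only [map_sum, map_smul, smul_eq_mul] at this
      calc _ = _ := Finset.sum_congr rfl fun i _ => by
            rw [hφ _ ((hF S hS).1 i), prod_coupleWt q hM ((hF S hS).1 i)]
        _ = _ := this
        _ = _ := Finset.sum_congr rfl fun k _ => by
            rw [hφ _ ((hF S hS).2 k), prod_coupleWt q hM ((hF S hS).2 k)]
    · rw [Finset.sum_eq_zero, Finset.sum_eq_zero]
      · exact fun k _ => by rw [if_neg fun h => hM ⟨_, .inr ⟨k, rfl⟩, h⟩, mul_zero]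
      · exact fun i _ => by rw [if_neg fun h => hM ⟨_, .inl ⟨i, rfl⟩, h⟩, mul_zero]
  have hrw : ∀ {ι : Type} [Fintype ι] (F : ι → Cortege m n) (α : ι → ℤ) (M : Finset (Elt × Elt)),
      ∑ i, q ^ α i * (if IsFeasible (F i) M then q ^ whiteCount (F i) M else 0) =
        ∑ i with IsFeasible (F i) M, q ^ (α i + whiteCount (F i) M) := by
    intro ι _ F α M
    rw [Finset.sum_filter]
    refine Finset.sum_congr rfl fun i _ => ?_
    rw [mul_ite, mul_zero, zpow_add₀ hq, zpow_natCast]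
  let f : Config F → Finset (Elt × Elt) × ℤ := fun c =>
    (c.1.2, α c.1.1 + whiteCount (F c.1.1) c.1.2)
  let g : Config G → Finset (Elt × Elt) × ℤ := fun c =>
    (c.1.2, β c.1.1 + whiteCount (G c.1.1) c.1.2)
  obtain ⟨γ, hγ⟩ := exists_equiv_comp_eq f g fun ⟨M, e⟩ => by
    have := card_fiber_eq_of_sum_zpow_eq hq htr _ _ _ _
      ((hrw F α M).symm.trans ((hsum M).trans (hrw G β M))) e
    have hfib : ∀ {ι : Type} [Fintype ι] (F : ι → Cortege m n) (α : ι → ℤ),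
        Nonempty ({c : Config F // (c.1.2, α c.1.1 + (whiteCount (F c.1.1) c.1.2 : ℤ)) = (M, e)} ≃
          ((Finset.univ.filter fun i => IsFeasible (F i) M).filter
            fun i => α i + (whiteCount (F i) M : ℤ) = e)) := by
      intro ι _ F α
      refine ⟨⟨fun c => ⟨c.1.1.1, ?_⟩, fun i => ⟨⟨(i.1, M), ?_⟩, ?_⟩, ?_, fun _ => rfl⟩⟩
      · obtain ⟨⟨⟨i, M'⟩, h⟩, h'⟩ := c
        obtain ⟨hM, he⟩ := Prod.mk.inj h'
        subst hM
        simp only [Finset.mem_filter, Finset.mem_univ, true_and]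
        exact ⟨h, he⟩
      · have := i.2
        simp only [Finset.mem_filter, Finset.mem_univ, true_and] at this
        exact this.1
      · have := i.2
        simp only [Finset.mem_filter, Finset.mem_univ, true_and] at this
        exact Prod.ext rfl this.2
      · rintro ⟨⟨⟨i, M'⟩, h⟩, h'⟩
        obtain ⟨rfl, -⟩ := Prod.mk.inj h'
        rfl
    exact ⟨(hfib F α).some.trans ((Finset.equivOfCardEq this).trans (hfib G β).some.symm)⟩
  refine hbal ⟨γ, fun c => ?_⟩
  obtain ⟨h1, h2⟩ := Prod.mk.inj (hγ c)
  have hS : IsFeasible (F c.1.1) c.1.2 := c.2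
  have hT : IsFeasible (G (γ c).1.1) c.1.2 := h1 ▸ (γ c).2
  have hST := (hF (F c.1.1) (.inl ⟨_, rfl⟩)).2 (γ c).1.1
  refine ⟨h1, isExchange_differSet hS hT hST, ?_⟩
  rw [← whiteCount_sub_whiteCount hS hT]
  rw [h1] at h2
  linarith
end

section
/- Let K be a field, q a nonzero element of K, and x an m×n q-matrix with entries in an associative unital K-algebra A. Let I' ⊆ I ⊆ {1,…,m} and J' ⊆ J ⊆ {1,…,n} with |I| = |J| and |I'| = |J'|. Then the quantum minors commute: [I|J]·[I'|J'] = [I'|J']·[I|J]. -/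
section QuantumDeterminant

variable {K A : Type} [Field K] [Ring A] [Algebra K A]

/-- The quantum determinant of a square array indexed by `Fin n`. -/
noncomputable def qDet (q : K) {n : ℕ} (x : Fin n → Fin n → A) : A :=
  ∑ σ : Equiv.Perm (Fin n),
    ((-q) ^ permInversions σ) • (List.ofFn (fun d => x d (σ d))).prod

/-- Manin's relations for a square array indexed by `Fin n`. -/
structure IsQArray (q : K) {n : ℕ} (x : Fin n → Fin n → A) : Prop where
  row : ∀ i j k, j < k → x i j * x i k = q • (x i k * x i j)
  col : ∀ i l j, i < l → x i j * x l j = q • (x l j * x i j)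
  anti : ∀ i l j k, i < l → j < k → x i k * x l j = x l j * x i k
  diag : ∀ i l j k, i < l → j < k →
    x i j * x l k - x l k * x i j = (q - q⁻¹) • (x i k * x l j)

lemma IsQArray.reindex {q : K} {m n : ℕ} {x : Fin n → Fin n → A} (hx : IsQArray q x)
    {r c : Fin m → Fin n} (hr : StrictMono r) (hc : StrictMono c) :
    IsQArray q (fun a b => x (r a) (c b)) where
  row _ _ _ h := hx.row _ _ _ (hc h)
  col _ _ _ h := hx.col _ _ _ (hr h)
  anti _ _ _ _ h h' := hx.anti _ _ _ _ (hr h) (hc h')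
  diag _ _ _ _ h h' := hx.diag _ _ _ _ (hr h) (hc h')

/-- The permutation of `Fin (n + 1)` with first value `j` whose remaining values are arranged
according to `τ`. -/
noncomputable def permCons {n : ℕ} (j : Fin (n + 1)) (τ : Equiv.Perm (Fin n)) :
    Equiv.Perm (Fin (n + 1)) :=
  Equiv.ofBijective (Fin.cons j (fun a => j.succAbove (τ a)) : Fin (n + 1) → Fin (n + 1)) <| by
    rw [← Finite.injective_iff_bijective, Fin.cons_injective_iff]
    refine ⟨?_, Fin.succAbove_right_injective.comp τ.injective⟩
    rintro ⟨a, ha⟩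
    exact Fin.succAbove_ne _ _ ha

@[simp] lemma permCons_zero {n : ℕ} (j : Fin (n + 1)) (τ : Equiv.Perm (Fin n)) :
    permCons j τ 0 = j := rfl

@[simp] lemma permCons_succ {n : ℕ} (j : Fin (n + 1)) (τ : Equiv.Perm (Fin n)) (a : Fin n) :
    permCons j τ a.succ = j.succAbove (τ a) := rfl

lemma permCons_bijective (n : ℕ) :
    Function.Bijective
      (fun p : Fin (n + 1) × Equiv.Perm (Fin n) => permCons p.1 p.2) := by
  rw [Fintype.bijective_iff_injective_and_card]
  constructor
  · rintro ⟨j, τ⟩ ⟨j', τ'⟩ h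
    have h0 : j = j' := by simpa using congrArg (fun σ => σ 0) h
    subst h0
    refine Prod.ext rfl (Equiv.ext fun a => ?_)
    have := congrArg (fun σ => σ a.succ) h
    simpa using this
  · simp [Fintype.card_perm, Nat.factorial_succ]

lemma permInversions_eq_sum {n : ℕ} (σ : Equiv.Perm (Fin n)) :
    permInversions σ = ∑ a, ∑ b, if a < b ∧ σ b < σ a then 1 else 0 := by
  rw [permInversions, Finset.card_filter, Fintype.sum_prod_type]

lemma permInversions_permCons {n : ℕ} (j : Fin (n + 1)) (τ : Equiv.Perm (Fin n)) :
    permInversions (permCons j τ) = j + permInversions τ := by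
  rw [permInversions_eq_sum, permInversions_eq_sum, Fin.sum_univ_succ]
  simp only [Fin.sum_univ_succ, permCons_zero, permCons_succ, Fin.succ_lt_succ_iff,
    Fin.succ_pos, lt_self_iff_false, false_and, if_false, zero_add, true_and,
    Fin.not_lt_zero, (Fin.strictMono_succAbove j).lt_iff_lt, Fin.succAbove_lt_iff_castSucc_lt]
  congr 1
  rw [Equiv.sum_comp τ (fun b => if b.castSucc < j then 1 else 0), ← Finset.card_filter]
  simp only [Fin.lt_def, Fin.val_castSucc]
  rw [Fin.card_filter_val_lt]
  have := j.is_lt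
  omega

lemma qDet_succ (q : K) {n : ℕ} (x : Fin (n + 1) → Fin (n + 1) → A) :
    qDet q x = ∑ j : Fin (n + 1), (-q) ^ (j : ℕ) •
      (x 0 j * qDet q (fun a b => x a.succ (j.succAbove b))) := by
  rw [qDet, ← (permCons_bijective n).sum_comp, Fintype.sum_prod_type]
  refine Finset.sum_congr rfl fun j _ => ?_
  rw [qDet, Finset.mul_sum, Finset.smul_sum]
  refine Finset.sum_congr rfl fun τ _ => ?_
  simp [permInversions_permCons, List.ofFn_succ, pow_add, mul_smul]

lemma sum_sum_succAbove_eq_zero {n : ℕ} {M : Type*} [AddCommGroup M]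
    (F : Fin (n + 2) → Fin (n + 1) → M)
    (hF : ∀ j j', j ≤ Fin.castSucc j' → F j j' + F j'.succ (j'.predAbove j) = 0) :
    ∑ j, ∑ j', F j j' = 0 := by
  rw [← Fintype.sum_prod_type']
  refine Finset.sum_involution (fun p _ => (p.1.succAbove p.2, p.2.predAbove p.1))
    ?_ ?_ (fun _ _ => Finset.mem_univ _) ?_
  · rintro ⟨j, j'⟩ -
    rcases le_or_gt j j'.castSucc with h | h
    · simpa [Fin.succAbove_of_le_castSucc _ _ h] using hF j j' h
    · have hj : j ≠ 0 := (Fin.zero_le _ |>.trans_lt h).ne'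
      have h1 : j'.castSucc ≤ (j.pred hj).castSucc := by
        simp only [Fin.le_def, Fin.lt_def, Fin.val_castSucc, Fin.val_pred] at h ⊢
        omega
      have := hF j'.castSucc (j.pred hj) h1
      rw [Fin.succ_pred, Fin.predAbove_of_le_castSucc _ _ h1, Fin.castPred_castSucc] at this
      rw [Fin.succAbove_of_castSucc_lt _ _ h, Fin.predAbove_of_castSucc_lt _ _ h, add_comm]
      exact this
  · rintro ⟨j, j'⟩ - - h
    exact Fin.succAbove_ne j j' (congrArg Prod.fst h)
  · rintro ⟨j, j'⟩ -
    simp [Fin.succAbove_succAbove_predAbove, Fin.predAbove_predAbove_succAbove]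

lemma sum_sum_succAbove_mul_eq_zero (q : K) {n : ℕ} (T : Fin (n + 2) → Fin (n + 2) → A)
    (C : (Fin n → Fin (n + 2)) → A) (hT : ∀ j k, j < k → T j k = q • T k j) :
    ∑ j : Fin (n + 2), ∑ j' : Fin (n + 1), (-q) ^ ((j : ℕ) + j') •
      (T j (j.succAbove j') * C (fun b => j.succAbove (j'.succAbove b))) = 0 := by
  apply sum_sum_succAbove_eq_zero
  intro j j' h
  have e1 : j.succAbove j' = j'.succ := Fin.succAbove_of_le_castSucc _ _ h
  have e2 : j'.succ.succAbove (j'.predAbove j) = j := by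
    rw [← e1, Fin.succAbove_succAbove_predAbove]
  have e3 : ((j'.predAbove j : Fin (n + 1)) : ℕ) = j := by
    rw [Fin.predAbove_of_le_castSucc _ _ h, Fin.coe_castPred]
  have e4 : (fun b => j'.succ.succAbove ((j'.predAbove j).succAbove b))
      = fun b => j.succAbove (j'.succAbove b) := by
    funext b
    rw [← e1, Fin.succAbove_succAbove_succAbove_predAbove]
  have hlt : j < j'.succ := Fin.le_castSucc_iff.mp h
  rw [e2, e3, e4, e1, hT _ _ hlt, Fin.val_succ, smul_mul_assoc, smul_smul, ← add_smul,
    show (-q) ^ ((j : ℕ) + j') * q + (-q) ^ ((j' : ℕ) + 1 + j) = 0 by ring, zero_smul]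

/-- Laplace expansion of a quantum determinant along a row, with the alien cofactors. -/
lemma IsQArray.sum_row_mul_minor {q : K} (hq : q ≠ 0) {n : ℕ}
    {x : Fin (n + 1) → Fin (n + 1) → A} (hx : IsQArray q x) (i k : Fin (n + 1)) :
    ∑ j : Fin (n + 1), (-q) ^ (j : ℕ) •
      (x i j * qDet q (fun a b => x (k.succAbove a) (j.succAbove b)))
      = if i = k then (-q) ^ (i : ℕ) • qDet q x else 0 := by
  induction n with
  | zero =>
    obtain rfl : i = 0 := Fin.fin_one_eq_zero i
    obtain rfl : k = 0 := Fin.fin_one_eq_zero k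
    simp [qDet_succ q x]
  | succ n ih =>
    have ih' : ∀ (j : Fin (n + 2)) (i k : Fin (n + 1)), _ := fun j i k =>
      ih (hx.reindex (Fin.strictMono_succ) (Fin.strictMono_succAbove j)) i k
    have expand : ∀ (r s : Fin (n + 2)) (k : Fin (n + 1)) (D : Fin (n + 2) → A),
        (∀ j, D j = ∑ j' : Fin (n + 1), (-q) ^ (j' : ℕ) • (x s (j.succAbove j') *
          qDet q (fun a b => x (k.succAbove a).succ (j.succAbove (j'.succAbove b))))) →
        ∑ j : Fin (n + 2), (-q) ^ (j : ℕ) • (x r j * D j) =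
        ∑ j : Fin (n + 2), ∑ j' : Fin (n + 1), (-q) ^ ((j : ℕ) + j') •
          (x r j * x s (j.succAbove j') *
          qDet q (fun a b => x (k.succAbove a).succ (j.succAbove (j'.succAbove b)))) := by
      intro r s k D hD
      refine Finset.sum_congr rfl fun j _ => ?_
      rw [hD, Finset.mul_sum, Finset.smul_sum]
      refine Finset.sum_congr rfl fun j' _ => ?_
      rw [mul_smul_comm, smul_smul, pow_add, mul_assoc]
    induction k using Fin.cases with
    | zero =>
      induction i using Fin.cases with
      | zero => simp [qDet_succ q x]
      | succ i =>
        rw [if_neg (Fin.succ_ne_zero i)]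
        have hne : (-q) ^ (i : ℕ) ≠ 0 := pow_ne_zero _ (neg_ne_zero.mpr hq)
        rw [← smul_eq_zero_iff_right hne, Finset.smul_sum]
        simp only [smul_comm ((-q) ^ (i : ℕ)), ← mul_smul_comm ((-q) ^ (i : ℕ))]
        rw [expand i.succ i.succ i]
        · exact sum_sum_succAbove_mul_eq_zero q (fun j k => x i.succ j * x i.succ k)
            (fun c => qDet q (fun a b => x (i.succAbove a).succ (c b)))
            (fun j k h => hx.row _ _ _ h)
        · intro j
          have := ih' j i i
          rw [if_pos rfl] at this
          simpa using this.symm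
    | succ k =>
      have hD : ∀ j : Fin (n + 2),
          qDet q (fun a b => x (k.succ.succAbove a) (j.succAbove b)) =
          ∑ j' : Fin (n + 1), (-q) ^ (j' : ℕ) • (x 0 (j.succAbove j') *
          qDet q (fun a b => x (k.succAbove a).succ (j.succAbove (j'.succAbove b)))) := by
        intro j
        rw [qDet_succ]
        simp
      rw [expand i 0 k _ hD]
      induction i using Fin.cases with
      | zero =>
        rw [if_neg (Fin.succ_ne_zero k).symm]
        exact sum_sum_succAbove_mul_eq_zero q (fun j k => x 0 j * x 0 k)
            (fun c => qDet q (fun a b => x (k.succAbove a).succ (c b)))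
            (fun j k h => hx.row _ _ _ h)
      | succ i =>
        have key := sum_sum_succAbove_mul_eq_zero q
            (fun j k => x i.succ j * x 0 k + q • (x 0 j * x i.succ k))
            (fun c => qDet q (fun a b => x (k.succAbove a).succ (c b))) (by
              intro j k h
              have h1 := hx.anti 0 i.succ j k (Fin.succ_pos i) h
              have h2 := hx.diag 0 i.succ j k (Fin.succ_pos i) h
              rw [sub_eq_iff_eq_add] at h2
              simp only [h2, ← h1, smul_add, smul_smul]
              rw [mul_sub, mul_inv_cancel₀ hq, sub_smul, one_smul]
              abel)
        simp only [add_mul, smul_add, Finset.sum_add_distrib] at key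
        rw [add_eq_zero_iff_eq_neg] at key
        rw [key]
        simp only [smul_mul_assoc, smul_comm _ q, ← Finset.smul_sum]
        rw [← expand 0 i.succ k _ (fun j => rfl)]
        simp only [ih']
        by_cases hik : i = k
        · simp only [hik, if_true, mul_smul_comm, smul_comm _ ((-q) ^ (k : ℕ)),
            ← Finset.smul_sum]
          rw [qDet_succ q x, Fin.val_succ, pow_succ, mul_smul, neg_smul, smul_neg]
        · simp [hik]

lemma List.Perm.prod_map_eq_of_pairwise {ι M : Type*} [Monoid M] (f : ι → M)
    {r s : ι → ι → Prop} (hf : ∀ a b, r a b → s b a → Commute (f a) (f b)) :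
    ∀ {l₁ l₂ : List ι}, l₁.Perm l₂ → l₁.Pairwise r → l₂.Pairwise s →
      (l₁.map f).prod = (l₂.map f).prod
  | [], l₂, h, _, _ => by simp [h.nil_eq.symm]
  | a :: t, l₂, h, hr, hs => by
    obtain ⟨u, v, rfl⟩ := List.append_of_mem (h.subset List.mem_cons_self)
    have ht : t.Perm (u ++ v) := (h.trans List.perm_middle).cons_inv
    rw [List.pairwise_cons] at hr
    have ih := List.Perm.prod_map_eq_of_pairwise f hf ht hr.2
      (hs.sublist (by simp))
    have hc : Commute (f a) (u.map f).prod := by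
      apply Commute.list_prod_right
      intro y hy
      obtain ⟨b, hb, rfl⟩ := List.mem_map.mp hy
      refine hf a b (hr.1 b (ht.symm.subset (List.mem_append_left _ hb))) ?_
      exact (List.pairwise_append.mp hs).2.2 b hb a List.mem_cons_self
    rw [List.map_cons, List.prod_cons, ih]
    simp only [List.map_append, List.prod_append, List.map_cons, List.prod_cons, ← mul_assoc]
    rw [hc.eq]

lemma IsQArray.prod_row_eq_prod_col {q : K} {n : ℕ} {x : Fin n → Fin n → A}
    (hx : IsQArray q x) (σ : Equiv.Perm (Fin n)) :
    (List.ofFn (fun d => x d (σ d))).prod = (List.ofFn (fun d => x (σ.symm d) d)).prod := by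
  have h2 : List.ofFn (fun d => x (σ.symm d) d)
      = ((List.finRange n).map σ.symm).map (fun d => x d (σ d)) := by
    simp [List.ofFn_eq_map]
  rw [h2, List.ofFn_eq_map]
  refine List.Perm.prod_map_eq_of_pairwise _ (r := (· < ·)) (s := fun a b => σ a < σ b)
    (fun a b h h' => hx.anti _ _ _ _ h h') ?_ (List.pairwise_lt_finRange n) ?_
  · exact (Equiv.Perm.map_finRange_perm σ.symm).symm
  · rw [List.pairwise_map]
    simpa using List.pairwise_lt_finRange n

lemma permInversions_rev_symm_rev {n : ℕ} (σ : Equiv.Perm (Fin n)) :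
    permInversions (Fin.revPerm.trans (σ.symm.trans Fin.revPerm)) = permInversions σ := by
  symm
  refine Finset.card_equiv
    ((σ.trans Fin.revPerm).prodCongr (σ.trans Fin.revPerm)) ?_
  rintro ⟨a, b⟩
  simp [and_comm]

open MulOpposite in
/-- Transposing, reversing rows and columns, and passing to the opposite algebra preserves
Manin's relations. -/
lemma IsQArray.op_rev {q : K} {n : ℕ} {x : Fin n → Fin n → A} (hx : IsQArray q x) :
    IsQArray q (fun i j => op (x j.rev i.rev)) where
  row i j k h := by
    rw [← op_mul, ← op_mul, ← op_smul, hx.col _ _ _ (Fin.rev_lt_rev.mpr h)]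
  col i l j h := by
    rw [← op_mul, ← op_mul, ← op_smul, hx.row _ _ _ (Fin.rev_lt_rev.mpr h)]
  anti i l j k h h' := by
    rw [← op_mul, ← op_mul, hx.anti _ _ _ _ (Fin.rev_lt_rev.mpr h') (Fin.rev_lt_rev.mpr h)]
  diag i l j k h h' := by
    have h1 := hx.anti _ _ _ _ (Fin.rev_lt_rev.mpr h') (Fin.rev_lt_rev.mpr h)
    have h2 := hx.diag _ _ _ _ (Fin.rev_lt_rev.mpr h') (Fin.rev_lt_rev.mpr h)
    rw [← op_mul, ← op_mul, ← op_mul, ← op_smul, ← op_sub, h2, h1]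

open MulOpposite in
lemma IsQArray.qDet_op_rev {q : K} {n : ℕ} {x : Fin n → Fin n → A} (hx : IsQArray q x) :
    qDet q (fun i j => op (x j.rev i.rev)) = op (qDet q x) := by
  let e : Equiv.Perm (Equiv.Perm (Fin n)) :=
    { toFun := fun σ => Fin.revPerm.trans (σ.symm.trans Fin.revPerm)
      invFun := fun σ => Fin.revPerm.trans (σ.symm.trans Fin.revPerm)
      left_inv := fun σ => by ext; simp
      right_inv := fun σ => by ext; simp }
  rw [qDet, qDet, ← Equiv.sum_comp e, Finset.op_sum]
  refine Finset.sum_congr rfl fun σ _ => ?_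
  rw [show permInversions (e σ) = permInversions σ from permInversions_rev_symm_rev σ, op_smul,
    hx.prod_row_eq_prod_col σ, op_list_prod]
  congr 2
  rw [List.map_ofFn]
  refine List.ext_getElem (by simp) fun d hd _ => ?_
  simp only [List.length_ofFn] at hd
  have hrev : (⟨n - 1 - d, by omega⟩ : Fin n) = Fin.rev ⟨d, hd⟩ := by
    ext
    simp only [Fin.val_rev]
    omega
  simp [e, hrev]

/-- Laplace expansion of a quantum determinant along a column, with the alien cofactors. -/
lemma IsQArray.sum_minor_mul_col {q : K} (hq : q ≠ 0) {n : ℕ}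
    {x : Fin (n + 1) → Fin (n + 1) → A} (hx : IsQArray q x) (i k : Fin (n + 1)) :
    ∑ j : Fin (n + 1), (-q) ^ (j.rev : ℕ) •
      (qDet q (fun a b => x (j.succAbove a) (k.succAbove b)) * x j i)
      = if i = k then (-q) ^ (i.rev : ℕ) • qDet q x else 0 := by
  have h := hx.op_rev.sum_row_mul_minor hq i.rev k.rev
  rw [← Equiv.sum_comp Fin.revPerm] at h
  have hm : ∀ j : Fin (n + 1),
      qDet q (fun a b : Fin n => MulOpposite.op
        (x ((j.rev.succAbove b).rev) ((k.rev.succAbove a).rev))) =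
      MulOpposite.op (qDet q (fun a b => x (j.succAbove a) (k.succAbove b))) := by
    intro j
    rw [← (hx.reindex (Fin.strictMono_succAbove j) (Fin.strictMono_succAbove k)).qDet_op_rev]
    simp [Fin.rev_succAbove]
  simp only [Fin.revPerm_apply, hm, hx.qDet_op_rev, Fin.rev_rev, Fin.rev_inj] at h
  apply MulOpposite.op_injective
  rw [Finset.op_sum]
  simp only [MulOpposite.op_smul, MulOpposite.op_mul, h]
  split_ifs <;> simp

/-- The quantum determinant is central. -/
lemma IsQArray.commute_qDet {q : K} (hq : q ≠ 0) {n : ℕ} {x : Fin n → Fin n → A}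
    (hx : IsQArray q x) (i l : Fin n) : Commute (qDet q x) (x i l) := by
  cases n with
  | zero => exact i.elim0
  | succ n =>
    have hne : (-q) ^ n ≠ 0 := pow_ne_zero _ (neg_ne_zero.mpr hq)
    have hrev : ∀ j : Fin (n + 1), (-q) ^ (j : ℕ) * (-q) ^ (j.rev : ℕ) = (-q) ^ n := by
      intro j
      rw [← pow_add]
      congr 1
      have := j.is_lt
      rw [Fin.val_rev]
      omega
    let M : Fin (n + 1) → Fin (n + 1) → A := fun k j =>
      qDet q (fun a b => x (k.succAbove a) (j.succAbove b))
    have h1 : ∑ k : Fin (n + 1), ∑ j : Fin (n + 1),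
        ((-q) ^ (j : ℕ) * (-q) ^ (k.rev : ℕ)) • (x i j * M k j * x k l)
        = (-q) ^ n • (qDet q x * x i l) := by
      calc _ = ∑ k : Fin (n + 1), (-q) ^ (k.rev : ℕ) •
            ((∑ j : Fin (n + 1), (-q) ^ (j : ℕ) • (x i j * M k j)) * x k l) := by
            simp only [Finset.sum_mul, Finset.smul_sum, smul_mul_assoc, smul_smul,
              mul_comm]
        _ = _ := by
            simp only [M, hx.sum_row_mul_minor hq, ite_mul, zero_mul, smul_ite, smul_zero,
              Finset.sum_ite_eq, Finset.mem_univ, if_true, smul_mul_assoc, smul_smul]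
            rw [mul_comm, hrev]
    have h2 : ∑ k : Fin (n + 1), ∑ j : Fin (n + 1),
        ((-q) ^ (j : ℕ) * (-q) ^ (k.rev : ℕ)) • (x i j * M k j * x k l)
        = (-q) ^ n • (x i l * qDet q x) := by
      rw [Finset.sum_comm]
      calc _ = ∑ j : Fin (n + 1), (-q) ^ (j : ℕ) •
            (x i j * (∑ k : Fin (n + 1), (-q) ^ (k.rev : ℕ) • (M k j * x k l))) := by
            simp only [Finset.mul_sum, Finset.smul_sum, mul_smul_comm, smul_smul, mul_assoc]
        _ = _ := by
            simp only [M, hx.sum_minor_mul_col hq, mul_ite, mul_zero, smul_ite, smul_zero,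
              Finset.sum_ite_eq, Finset.mem_univ, if_true, mul_smul_comm, smul_smul]
            rw [hrev]
    exact smul_right_injective A hne (h1.symm.trans h2)

lemma IsQMatrix.isQArray {q : K} {m n : ℕ} {x : ℕ → ℕ → A} (hx : IsQMatrix q m n x)
    {k : ℕ} {r c : Fin k → ℕ} (hr : StrictMono r) (hc : StrictMono c)
    (hrm : ∀ a, r a ∈ Finset.Icc 1 m) (hcn : ∀ a, c a ∈ Finset.Icc 1 n) :
    IsQArray q (fun a b => x (r a) (c b)) := by
  simp only [Finset.mem_Icc] at hrm hcn
  obtain ⟨h1, h2, h3, h4⟩ := hx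
  exact
    { row := fun i j k h => h1 _ _ _ (hrm i).1 (hrm i).2 (hcn j).1 (hc h) (hcn k).2
      col := fun i l j h => h2 _ _ _ (hrm i).1 (hr h) (hrm l).2 (hcn j).1 (hcn j).2
      anti := fun i l j k h h' =>
        h3 _ _ _ _ (hrm i).1 (hr h) (hrm l).2 (hcn j).1 (hc h') (hcn k).2
      diag := fun i l j k h h' =>
        h4 _ _ _ _ (hrm i).1 (hr h) (hrm l).2 (hcn j).1 (hc h') (hcn k).2 }

/-- A quantum minor commutes with the matrix entries in its rows and columns. -/
lemma IsQMatrix.commute_qMinor {q : K} (hq : q ≠ 0) {m n : ℕ} {x : ℕ → ℕ → A}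
    (hx : IsQMatrix q m n x) {I J : Finset ℕ} (hIm : I ⊆ Finset.Icc 1 m)
    (hJn : J ⊆ Finset.Icc 1 n) (hIJ : I.card = J.card) {i j : ℕ} (hi : i ∈ I) (hj : j ∈ J) :
    Commute (qMinor q x I J) (x i j) := by
  obtain ⟨a, rfl⟩ : i ∈ Set.range (I.orderEmbOfFin rfl) := by simpa using hi
  obtain ⟨b, rfl⟩ : j ∈ Set.range (J.orderEmbOfFin hIJ.symm) := by simpa using hj
  rw [qMinor, dif_pos hIJ]
  exact (hx.isQArray (I.orderEmbOfFin rfl).strictMono (J.orderEmbOfFin hIJ.symm).strictMono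
    (fun a => hIm (I.orderEmbOfFin_mem rfl a))
    (fun a => hJn (J.orderEmbOfFin_mem hIJ.symm a))).commute_qDet hq a b

end QuantumDeterminant

/-- A quantum minor commutes with any of its quantum subminors. -/
theorem qMinor_commute_subminor
    {K A : Type} [Field K] [Ring A] [Algebra K A] {m n : ℕ}
    (q : K) (hq : q ≠ 0) (x : ℕ → ℕ → A) (hx : IsQMatrix q m n x)
    (I J I' J' : Finset ℕ)
    (hIm : I ⊆ Finset.Icc 1 m) (hJn : J ⊆ Finset.Icc 1 n)
    (hI'I : I' ⊆ I) (hJ'J : J' ⊆ J)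
    (hIJ : I.card = J.card) (hI'J' : I'.card = J'.card) :
    qMinor q x I J * qMinor q x I' J' = qMinor q x I' J' * qMinor q x I J := by
  have key : Commute (qMinor q x I J) (qMinor q x I' J') := by
    conv => arg 2; rw [qMinor, dif_pos hI'J']
    refine Commute.sum_right _ _ _ fun σ _ => Commute.smul_right ?_ _
    refine Commute.list_prod_right _ _ fun y hy => ?_
    obtain ⟨d, rfl⟩ := (List.mem_ofFn' _ _).mp hy
    exact hx.commute_qMinor hq hIm hJn hIJ (hI'I (Finset.orderEmbOfFin_mem _ _ _))
      (hJ'J (Finset.orderEmbOfFin_mem _ _ _))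
  exact key.eq
end

section
/- Let K be a field, q a nonzero element of K, and x an m×n q-matrix with entries in an associative unital K-algebra A. Let I, J ⊆ {1,…,n} with |J| ≤ |I| ≤ m, and suppose J − I admits a partition J − I = J₁ ∪ J₂ with J₁ < I − J < J₂. Then the flag quantum minors quasicommute: [I]·[J] = q^{|J₂|−|J₁|} [J]·[I]. -/
/-- `X < Y` elementwise: every element of `X` is smaller than every element of `Y`. -/
def finsetLT (X Y : Finset ℕ) : Prop := ∀ a ∈ X, ∀ b ∈ Y, a < b

/-- One-sided weak separation: `|I| ≥ |J|` and `J - I` has a partition `J₁ ∪ J₂`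
with `J₁ < I - J < J₂`. -/
def WShalf (I J : Finset ℕ) : Prop :=
  J.card ≤ I.card ∧ ∃ J₁ J₂ : Finset ℕ, Disjoint J₁ J₂ ∧ J₁ ∪ J₂ = J \ I ∧
    finsetLT J₁ (I \ J) ∧ finsetLT (I \ J) J₂

/-- `I` and `J` are weakly separated. -/
def WeaklySeparated (I J : Finset ℕ) : Prop := WShalf I J ∨ WShalf J I

/-- `Inv(A,B)`: the number of pairs `(a,b) ∈ A × B` with `a > b`. -/
def invPairs (A B : Finset ℕ) : ℕ := ((A ×ˢ B).filter (fun p => p.2 < p.1)).card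

namespace QuantumMinor

variable {K A : Type} [Field K] [Ring A] [Algebra K A]

/-- The number of elements of `S` that are smaller than `c`. -/
def below (S : Finset ℕ) (c : ℕ) : ℕ := (S.filter (· < c)).card

theorem below_erase_of_le {S : Finset ℕ} {c e : ℕ} (h : e ≤ c) :
    below (S.erase c) e = below S e := by
  unfold below
  congr 1
  ext s
  simp only [Finset.mem_filter, Finset.mem_erase]
  grind

theorem below_erase_add_one {S : Finset ℕ} {c e : ℕ} (hc : c ∈ S) (h : c < e) :
    below (S.erase c) e + 1 = below S e := by
  unfold below
  rw [Finset.filter_erase, Finset.card_erase_add_one]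
  simp [hc, h]

/-- Left multiplication by the vector `v` in the quantum exterior algebra with coefficients
in `A`, whose elements are given by their coefficients. -/
def wedge (q : K) (v : ℕ → A) (F : Finset ℕ → A) (S : Finset ℕ) : A :=
  ∑ c ∈ S, (-q) ^ below S c • (v c * F (S.erase c))

theorem wedge_smul (q s : K) (v : ℕ → A) (F : Finset ℕ → A) :
    wedge q v (s • F) = s • wedge q v F := by
  funext S
  simp only [wedge, Pi.smul_apply, Finset.smul_sum, mul_smul_comm]
  exact Finset.sum_congr rfl fun c _ => smul_comm _ _ _

theorem sum_erase_eq_sum_lt {M : Type*} [AddCommMonoid M] (S : Finset ℕ) (f : ℕ → ℕ → M) :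
    ∑ c ∈ S, ∑ e ∈ S.erase c, f c e =
      ∑ c ∈ S, ∑ e ∈ S.filter (c < ·), (f c e + f e c) := by
  have h : ∀ c ∈ S, ∑ e ∈ S.erase c, f c e =
      ∑ e ∈ S.filter (c < ·), f c e + ∑ e ∈ S.filter (· < c), f c e := by
    intro c _
    rw [← Finset.sum_union]
    · congr 1
      ext e
      simp only [Finset.mem_erase, Finset.mem_union, Finset.mem_filter]
      grind
    · rw [Finset.disjoint_left]
      simp only [Finset.mem_filter]
      grind
  rw [Finset.sum_congr rfl h]
  simp only [Finset.sum_add_distrib]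
  congr 1
  refine Finset.sum_comm' ?_
  simp only [Finset.mem_filter]
  tauto

theorem wedge_wedge (q : K) (v w : ℕ → A) (F : Finset ℕ → A) (S : Finset ℕ) :
    wedge q v (wedge q w F) S = ∑ c ∈ S, ∑ e ∈ S.filter (c < ·),
      (-q) ^ (below S c + below (S.erase c) e) •
        ((v c * w e - q • (v e * w c)) * F ((S.erase c).erase e)) := by
  simp only [wedge, Finset.mul_sum, Finset.smul_sum]
  rw [sum_erase_eq_sum_lt]
  refine Finset.sum_congr rfl fun c hc => Finset.sum_congr rfl fun e he => ?_
  obtain ⟨he, hce⟩ := Finset.mem_filter.1 he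
  rw [below_erase_of_le hce.le, ← below_erase_add_one hc hce, Finset.erase_right_comm,
    mul_smul_comm, mul_smul_comm, smul_smul, smul_smul, sub_mul, smul_sub, smul_mul_assoc,
    smul_smul, sub_eq_add_neg, ← neg_smul, mul_assoc, mul_assoc, ← pow_add, ← pow_add]
  congr 2
  ring

/-- Manin's relations, for a matrix indexed by all pairs of natural numbers. -/
structure Manin (q : K) (x : ℕ → ℕ → A) : Prop where
  row : ∀ i j k, j < k → x i j * x i k = q • (x i k * x i j)
  col : ∀ i l j, i < l → x i j * x l j = q • (x l j * x i j)
  anti : ∀ i l j k, i < l → j < k → x i k * x l j = x l j * x i k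
  diag : ∀ i l j k, i < l → j < k →
    x i j * x l k - x l k * x i j = (q - q⁻¹) • (x i k * x l j)

/-- The transpose of a matrix indexed by the natural numbers. -/
def transp (x : ℕ → ℕ → A) : ℕ → ℕ → A := fun i j => x j i

theorem Manin.transp {q : K} {x : ℕ → ℕ → A} (hx : Manin q x) : Manin q (transp x) where
  row i j k h := hx.col j k i h
  col i l j h := hx.row j i l h
  anti i l j k h h' := (hx.anti j k i l h' h).symm
  diag i l j k h h' := by
    simp only [QuantumMinor.transp]
    rw [hx.diag j k i l h' h, hx.anti j k i l h' h]

theorem wedge_self {q : K} {x : ℕ → ℕ → A} (hx : Manin q x) (i : ℕ) (F : Finset ℕ → A) :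
    wedge q (x i) (wedge q (x i) F) = 0 := by
  funext S
  rw [wedge_wedge]
  refine Finset.sum_eq_zero fun c _ => Finset.sum_eq_zero fun e he => ?_
  rw [hx.row i c e (Finset.mem_filter.1 he).2, sub_self, zero_mul, smul_zero]

theorem wedge_swap {q : K} (hq : q ≠ 0) {x : ℕ → ℕ → A} (hx : Manin q x) {i l : ℕ} (h : i < l)
    (F : Finset ℕ → A) :
    wedge q (x l) (wedge q (x i) F) = (-q) • wedge q (x i) (wedge q (x l) F) := by
  funext S
  rw [Pi.smul_apply, wedge_wedge, wedge_wedge, Finset.smul_sum]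
  refine Finset.sum_congr rfl fun c _ => ?_
  rw [Finset.smul_sum]
  refine Finset.sum_congr rfl fun e he => ?_
  have hce := (Finset.mem_filter.1 he).2
  rw [smul_comm (-q), ← smul_mul_assoc (-q)]
  congr 2
  have h1 := hx.anti i l c e h hce
  have h2 := hx.diag i l c e h hce
  have h3 : x l e * x i c = x i c * x l e - (q - q⁻¹) • (x i e * x l c) := by
    rw [← h2]; abel
  rw [h3, ← h1, smul_sub, smul_sub, smul_smul, smul_smul, mul_sub, mul_inv_cancel₀ hq]
  module

/-- The iterated wedge product of the rows of `x` listed in `l` with `F`. -/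
def wedgeList (q : K) (x : ℕ → ℕ → A) (l : List ℕ) (F : Finset ℕ → A) : Finset ℕ → A :=
  l.foldr (fun i G => wedge q (x i) G) F

@[simp] theorem wedgeList_nil (q : K) (x : ℕ → ℕ → A) (F : Finset ℕ → A) :
    wedgeList q x [] F = F := rfl

@[simp] theorem wedgeList_cons (q : K) (x : ℕ → ℕ → A) (i : ℕ) (l : List ℕ)
    (F : Finset ℕ → A) : wedgeList q x (i :: l) F = wedge q (x i) (wedgeList q x l F) := rfl

theorem wedgeList_append (q : K) (x : ℕ → ℕ → A) (l l' : List ℕ) (F : Finset ℕ → A) :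
    wedgeList q x (l ++ l') F = wedgeList q x l (wedgeList q x l' F) := by
  simp [wedgeList]

theorem wedgeList_smul (q s : K) (x : ℕ → ℕ → A) (l : List ℕ) (F : Finset ℕ → A) :
    wedgeList q x l (s • F) = s • wedgeList q x l F := by
  induction l with
  | nil => rfl
  | cons i l ih => rw [wedgeList_cons, ih, wedge_smul, wedgeList_cons]

theorem wedgeList_perm {q : K} (hq : q ≠ 0) {x : ℕ → ℕ → A} (hx : Manin q x)
    {l l' : List ℕ} (h : l.Perm l') :
    ∃ s : K, ∀ F : Finset ℕ → A, wedgeList q x l F = s • wedgeList q x l' F := by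
  induction h with
  | nil => exact ⟨1, fun F => (one_smul _ _).symm⟩
  | cons i _ ih =>
    obtain ⟨s, hs⟩ := ih
    exact ⟨s, fun F => by rw [wedgeList_cons, hs, wedge_smul, wedgeList_cons]⟩
  | swap i j l =>
    simp only [wedgeList_cons]
    rcases lt_trichotomy i j with h | rfl | h
    · exact ⟨-q, fun F => wedge_swap hq hx h _⟩
    · exact ⟨1, fun F => (one_smul _ _).symm⟩
    · refine ⟨(-q)⁻¹, fun F => ?_⟩
      rw [wedge_swap hq hx h, inv_smul_smul₀ (neg_ne_zero.2 hq)]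
  | trans _ _ ih ih' =>
    obtain ⟨s, hs⟩ := ih
    obtain ⟨t, ht⟩ := ih'
    exact ⟨s * t, fun F => by rw [hs, ht, smul_smul]⟩

theorem wedgeList_eq_zero {q : K} (hq : q ≠ 0) {x : ℕ → ℕ → A} (hx : Manin q x)
    {l : List ℕ} (h : ¬ l.Nodup) (F : Finset ℕ → A) : wedgeList q x l F = 0 := by
  obtain ⟨a, ha⟩ := List.exists_duplicate_iff_not_nodup.2 h
  obtain ⟨s, hs⟩ := wedgeList_perm hq hx
    (List.duplicate_iff_sublist.1 ha).exists_perm_append.choose_spec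
  rw [hs, List.cons_append, List.cons_append, wedgeList_cons, wedgeList_cons, wedge_self hx,
    smul_zero]

/-- Moving a row to the right across smaller rows. -/
theorem wedge_wedgeList_of_lt {q : K} (hq : q ≠ 0) {x : ℕ → ℕ → A} (hx : Manin q x) {k : ℕ}
    {l : List ℕ} (h : ∀ i ∈ l, i < k) (F : Finset ℕ → A) :
    wedge q (x k) (wedgeList q x l F) = (-q) ^ l.length • wedgeList q x l (wedge q (x k) F) := by
  induction l with
  | nil => simp
  | cons i l ih =>
    rw [List.forall_mem_cons] at h
    rw [wedgeList_cons, wedge_swap hq hx h.1, ih h.2, wedge_smul, smul_smul, wedgeList_cons,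
      List.length_cons, pow_succ']

/-- Moving a row to the left across larger rows. -/
theorem wedgeList_wedge_of_lt {q : K} (hq : q ≠ 0) {x : ℕ → ℕ → A} (hx : Manin q x) {k : ℕ}
    {l : List ℕ} (h : ∀ i ∈ l, k < i) (F : Finset ℕ → A) :
    wedgeList q x l (wedge q (x k) F) = (-q) ^ l.length • wedge q (x k) (wedgeList q x l F) := by
  induction l with
  | nil => simp
  | cons i l ih =>
    rw [List.forall_mem_cons] at h
    rw [wedgeList_cons, ih h.2, wedge_smul, wedge_swap hq hx h.1, smul_smul, wedgeList_cons,
      List.length_cons, pow_succ]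

/-- The number of elements of `S` that are larger than `c`. -/
def above (S : Finset ℕ) (c : ℕ) : ℕ := (S.filter (c < ·)).card

theorem above_erase_of_le {S : Finset ℕ} {c e : ℕ} (h : c ≤ e) :
    above (S.erase c) e = above S e := by
  unfold above
  congr 1
  ext s
  simp only [Finset.mem_filter, Finset.mem_erase]
  grind

theorem above_erase_add_one {S : Finset ℕ} {c e : ℕ} (hc : c ∈ S) (h : e < c) :
    above (S.erase c) e + 1 = above S e := by
  unfold above
  rw [Finset.filter_erase, Finset.card_erase_add_one]
  simp [hc, h]

theorem below_add_above {S : Finset ℕ} {c : ℕ} (hc : c ∉ S) :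
    below S c + above S c = S.card := by
  unfold below above
  rw [← Finset.card_union_of_disjoint]
  · congr 1
    ext e
    simp only [Finset.mem_union, Finset.mem_filter]
    grind
  · rw [Finset.disjoint_left]
    simp only [Finset.mem_filter]
    grind

theorem sort_union {S T : Finset ℕ} (h : ∀ a ∈ S, ∀ b ∈ T, a < b) :
    (S ∪ T).sort = S.sort ++ T.sort := by
  have hd : (S.sort ++ T.sort).Nodup :=
    List.Nodup.append (Finset.sort_nodup _ _) (Finset.sort_nodup _ _) fun a ha hb =>
      (h a (by simpa using ha) a (by simpa using hb)).false
  have hs : (S.sort ++ T.sort).Pairwise (· ≤ ·) := by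
    rw [List.pairwise_append]
    exact ⟨Finset.pairwise_sort _ _, Finset.pairwise_sort _ _, fun a ha b hb =>
      (h a (by simpa using ha) b (by simpa using hb)).le⟩
  rw [← (List.toFinset_sort (· ≤ ·) hd).2 hs]
  congr 1
  ext a
  simp

theorem sort_insert_eq {S : Finset ℕ} (k : ℕ) :
    (insert k S).sort = (S.filter (· < k)).sort ++ (k :: (S.filter (k < ·)).sort) := by
  have h : insert k S = S.filter (· < k) ∪ insert k (S.filter (k < ·)) := by
    ext e
    simp only [Finset.mem_union, Finset.mem_insert, Finset.mem_filter]
    grind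
  rw [h, sort_union (by simp; grind), Finset.sort_insert _ (by simp; grind) (by simp)]

theorem sort_eq_append {S : Finset ℕ} {k : ℕ} (hk : k ∉ S) :
    S.sort = (S.filter (· < k)).sort ++ (S.filter (k < ·)).sort := by
  have h : S = S.filter (· < k) ∪ S.filter (k < ·) := by
    ext e
    simp only [Finset.mem_union, Finset.mem_filter]
    grind
  conv_lhs => rw [h]
  exact sort_union (by simp; grind)

theorem wedge_wedgeList_sort {q : K} (hq : q ≠ 0) {x : ℕ → ℕ → A} (hx : Manin q x) {k : ℕ}
    {S : Finset ℕ} (hk : k ∉ S) (F : Finset ℕ → A) :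
    wedge q (x k) (wedgeList q x S.sort F) =
      (-q) ^ below S k • wedgeList q x (insert k S).sort F := by
  rw [sort_eq_append hk, sort_insert_eq, wedgeList_append, wedgeList_append,
    wedge_wedgeList_of_lt hq hx (by simp), wedgeList_cons, Finset.length_sort, below]

theorem wedgeList_sort_wedge {q : K} (hq : q ≠ 0) {x : ℕ → ℕ → A} (hx : Manin q x) {k : ℕ}
    {S : Finset ℕ} (hk : k ∉ S) (F : Finset ℕ → A) :
    wedgeList q x S.sort (wedge q (x k) F) =
      (-q) ^ above S k • wedgeList q x (insert k S).sort F := by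
  rw [sort_eq_append hk, sort_insert_eq, wedgeList_append, wedgeList_append,
    wedgeList_wedge_of_lt hq hx (by simp), wedgeList_smul, wedgeList_cons, Finset.length_sort,
    above]

/-- Right multiplication by the vector `v` in the quantum exterior algebra. -/
def rwedge (q : K) (F : Finset ℕ → A) (v : ℕ → A) (S : Finset ℕ) : A :=
  ∑ c ∈ S, (-q) ^ above S c • (F (S.erase c) * v c)

theorem wedge_rwedge (q : K) (v w : ℕ → A) (F : Finset ℕ → A) :
    wedge q v (rwedge q F w) = rwedge q (wedge q v F) w := by
  funext S
  simp only [wedge, rwedge, Finset.mul_sum, Finset.sum_mul, Finset.smul_sum]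
  rw [Finset.sum_comm' (t' := S) (s' := fun e => S.erase e)
    (by simp only [Finset.mem_erase]; grind)]
  refine Finset.sum_congr rfl fun c hc => Finset.sum_congr rfl fun e he => ?_
  obtain ⟨hne, he⟩ := Finset.mem_erase.1 he
  rw [Finset.erase_right_comm, mul_smul_comm, smul_mul_assoc, smul_smul, smul_smul, mul_assoc,
    ← pow_add, ← pow_add]
  congr 2
  rcases hne.lt_or_gt with h | h
  · rw [above_erase_of_le h.le, below_erase_of_le h.le, add_comm]
  · rw [← above_erase_add_one he h, ← below_erase_add_one hc h]
    ring

/-- The unit of the quantum exterior algebra. -/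
def vac (A : Type) [Ring A] (S : Finset ℕ) : A := if S = ∅ then 1 else 0

theorem wedge_vac (q : K) (v : ℕ → A) : wedge q v (vac A) = rwedge q (vac A) v := by
  funext S
  refine Finset.sum_congr rfl fun c hc => ?_
  by_cases h : S.erase c = ∅
  · have hS : S = {c} := by
      rw [← Finset.insert_erase hc, h]; rfl
    subst hS
    simp [vac, above, below, Finset.filter_singleton]
  · simp [vac, h]

theorem wedgeList_wedge_vac (q : K) (x : ℕ → ℕ → A) (l : List ℕ) (v : ℕ → A) :
    wedgeList q x l (wedge q v (vac A)) = rwedge q (wedgeList q x l (vac A)) v := by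
  induction l with
  | nil => exact wedge_vac q v
  | cons i l ih => rw [wedgeList_cons, ih, wedge_rwedge, wedgeList_cons]

/-- The quantum minor with row set `R` and column set `S`, as a coefficient of a wedge product
of rows. -/
def minor (q : K) (x : ℕ → ℕ → A) (R S : Finset ℕ) : A := wedgeList q x R.sort (vac A) S

theorem minor_empty_left (q : K) (x : ℕ → ℕ → A) (S : Finset ℕ) :
    minor q x ∅ S = if S = ∅ then 1 else 0 := by
  simp [minor, vac]

theorem minor_eq_sum (q : K) (x : ℕ → ℕ → A) {r : ℕ} {R : Finset ℕ} (hr : r ∈ R)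
    (hR : ∀ i ∈ R, r ≤ i) (S : Finset ℕ) : minor q x R S =
      ∑ c ∈ S, (-q) ^ below S c • (x r c * minor q x (R.erase r) (S.erase c)) := by
  unfold minor
  conv_lhs => rw [← Finset.insert_erase hr, Finset.sort_insert _
    (fun b hb => hR b (Finset.mem_of_mem_erase hb)) (Finset.notMem_erase r R)]
  rfl

theorem minor_transp_of_nonempty {q : K} {x : ℕ → ℕ → A} (hx : Manin q x) {R S : Finset ℕ}
    (hR : R.Nonempty) (hS : S.Nonempty)
    (ih : ∀ R' ⊂ R, ∀ S' : Finset ℕ, minor q x R' S' = minor q (transp x) S' R') :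
    minor q x R S = minor q (transp x) S R := by
  have hr := R.min'_mem hR
  have hj := S.min'_mem hS
  have hrR : ∀ i ∈ R, R.min' hR ≤ i := fun i hi => R.min'_le i hi
  have hjS : ∀ i ∈ S, S.min' hS ≤ i := fun i hi => S.min'_le i hi
  generalize R.min' hR = r at *
  generalize S.min' hS = j at *
  have hb : ∀ {T : Finset ℕ} {t : ℕ}, (∀ i ∈ T, t ≤ i) → below T t = 0 := by
    intro T t h
    simpa [below, Finset.filter_eq_empty_iff] using h
  rw [minor_eq_sum q x hr hrR, minor_eq_sum q (transp x) hj hjS,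
    ← Finset.add_sum_erase _ _ hj, ← Finset.add_sum_erase _ _ hr, hb hrR, hb hjS,
    ih _ (Finset.erase_ssubset hr)]
  congr 1
  have h1 : ∀ c ∈ S.erase j, minor q x (R.erase r) (S.erase c) = ∑ l ∈ R.erase r,
      (-q) ^ below (R.erase r) l •
        (x l j * minor q (transp x) ((S.erase c).erase j) ((R.erase r).erase l)) := by
    intro c hc
    rw [ih _ (Finset.erase_ssubset hr), minor_eq_sum q (transp x) (r := j)
      (Finset.mem_erase.2 ⟨(Finset.ne_of_mem_erase hc).symm, hj⟩)
      (fun i hi => hjS i (Finset.mem_of_mem_erase hi))]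
    rfl
  have h2 : ∀ l ∈ R.erase r, minor q (transp x) (S.erase j) (R.erase l) = ∑ c ∈ S.erase j,
      (-q) ^ below (S.erase j) c •
        (x r c * minor q (transp x) ((S.erase c).erase j) ((R.erase r).erase l)) := by
    intro l hl
    rw [← ih _ (Finset.erase_ssubset (Finset.mem_of_mem_erase hl)), minor_eq_sum q x (r := r)
      (Finset.mem_erase.2 ⟨(Finset.ne_of_mem_erase hl).symm, hr⟩)
      (fun i hi => hrR i (Finset.mem_of_mem_erase hi))]
    refine Finset.sum_congr rfl fun c _ => ?_
    rw [Finset.erase_right_comm (a := l), Finset.erase_right_comm (a := j), ih]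
    exact (Finset.erase_subset _ _).trans_ssubset (Finset.erase_ssubset hr)
  refine (Finset.sum_congr rfl fun c hc =>
      congrArg (fun t => (-q) ^ below S c • (x r c * t)) (h1 c hc)).trans
    (Eq.trans ?_ (Finset.sum_congr rfl fun l hl =>
      congrArg (fun t => (-q) ^ below R l • (x l j * t)) (h2 l hl)).symm)
  simp only [Finset.mul_sum, Finset.smul_sum]
  rw [Finset.sum_comm]
  refine Finset.sum_congr rfl fun l hl => Finset.sum_congr rfl fun c hc => ?_
  obtain ⟨hlr, hl⟩ := Finset.mem_erase.1 hl
  obtain ⟨hcj, hc⟩ := Finset.mem_erase.1 hc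
  have hrl : r < l := lt_of_le_of_ne (hrR l hl) hlr.symm
  have hjc : j < c := lt_of_le_of_ne (hjS c hc) hcj.symm
  rw [← below_erase_add_one hr hrl, ← below_erase_add_one hj hjc, mul_smul_comm, mul_smul_comm,
    smul_smul, smul_smul, ← mul_assoc, ← mul_assoc, ← pow_add, ← pow_add, hx.anti r l j c hrl hjc]
  congr 2
  ring

theorem minor_transp {q : K} {x : ℕ → ℕ → A} (hx : Manin q x) (R S : Finset ℕ) :
    minor q x R S = minor q (transp x) S R := by
  induction R using Finset.strongInduction generalizing S with
  | H R ih =>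
    rcases S.eq_empty_or_nonempty with rfl | hS
    · rw [minor_empty_left]
      rcases R.eq_empty_or_nonempty with rfl | hR
      · simp [minor_empty_left]
      · rw [minor_eq_sum q x (R.min'_mem hR) (fun i hi => R.min'_le i hi), Finset.sum_empty,
          if_neg hR.ne_empty]
    · rcases R.eq_empty_or_nonempty with rfl | hR
      · rw [minor_empty_left, minor_eq_sum q _ (S.min'_mem hS) (fun i hi => S.min'_le i hi),
          Finset.sum_empty, if_neg hS.ne_empty]
      · exact minor_transp_of_nonempty hx hR hS ih

theorem below_add_above_of_mem {S : Finset ℕ} {c : ℕ} (hc : c ∈ S) :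
    below S c + above S c = S.card - 1 := by
  rw [← below_erase_of_le le_rfl, ← above_erase_of_le le_rfl,
    below_add_above (Finset.notMem_erase c S), Finset.card_erase_of_mem hc]

theorem sum_mul_minor_erase {q : K} (hq : q ≠ 0) {x : ℕ → ℕ → A} (hx : Manin q x)
    {R : Finset ℕ} {i l : ℕ} (hi : i ∈ R) (I : Finset ℕ) :
    ∑ c ∈ I, (-q) ^ below I c • (x i c * minor q x (R.erase l) (I.erase c)) =
      if i = l then (-q) ^ below R l • minor q x R I else 0 := by
  change wedge q (x i) (wedgeList q x (R.erase l).sort (vac A)) I = _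
  split_ifs with h
  · subst h
    rw [wedge_wedgeList_sort hq hx (Finset.notMem_erase i R), Finset.insert_erase hi,
      below_erase_of_le le_rfl]
    rfl
  · rw [← wedgeList_cons, wedgeList_eq_zero hq hx]
    · rfl
    · simp [h, hi]

theorem sum_mul_minor_erase_insert {q : K} (hq : q ≠ 0) {x : ℕ → ℕ → A} (hx : Manin q x)
    {R : Finset ℕ} {i : ℕ} (hi : i ∈ R) (I : Finset ℕ) :
    ∑ c ∈ I, (-q) ^ below I c • (x i c * minor q x R (I.erase c)) = 0 := by
  change wedge q (x i) (wedgeList q x R.sort (vac A)) I = _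
  rw [← wedgeList_cons, wedgeList_eq_zero hq hx]
  · rfl
  · simp [hi]

theorem sum_minor_erase_mul {q : K} (hq : q ≠ 0) {x : ℕ → ℕ → A} (hx : Manin q x)
    (R T : Finset ℕ) (j : ℕ) :
    ∑ l ∈ R, (-q) ^ above R l • (minor q x (R.erase l) T * x l j) =
      if j ∈ T then 0 else (-q) ^ above T j • minor q x R (insert j T) := by
  simp only [minor_transp hx]
  change rwedge q (wedgeList q (transp x) T.sort (vac A)) (transp x j) R = _
  rw [← wedgeList_wedge_vac]
  split_ifs with h
  · have := wedgeList_append q (transp x) T.sort [j] (vac A)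
    rw [wedgeList_cons, wedgeList_nil] at this
    rw [← this, wedgeList_eq_zero hq hx.transp]
    · rfl
    · simp [List.nodup_append, h]
  · rw [wedgeList_sort_wedge hq hx.transp h]
    rfl

theorem minor_mul_entry {q : K} (hq : q ≠ 0) {x : ℕ → ℕ → A} (hx : Manin q x)
    {R : Finset ℕ} {i : ℕ} (hi : i ∈ R) (I : Finset ℕ) (j : ℕ) :
    (-q) ^ (R.card - 1) • (minor q x R I * x i j) =
      ∑ c ∈ I, (-q) ^ below I c • (x i c * (if j ∈ I.erase c then 0 else
        (-q) ^ above (I.erase c) j • minor q x R (insert j (I.erase c)))) := by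
  have h : (-q) ^ (R.card - 1) • (minor q x R I * x i j) = ∑ l ∈ R, (-q) ^ above R l •
      ((∑ c ∈ I, (-q) ^ below I c • (x i c * minor q x (R.erase l) (I.erase c))) * x l j) := by
    rw [Finset.sum_eq_single_of_mem i hi, sum_mul_minor_erase hq hx hi, if_pos rfl,
      smul_mul_assoc, smul_smul, ← pow_add, add_comm, below_add_above_of_mem hi]
    intro l _ hl
    rw [sum_mul_minor_erase hq hx hi, if_neg hl.symm, zero_mul, smul_zero]
  rw [h]
  simp only [← sum_minor_erase_mul hq hx, Finset.sum_mul, Finset.mul_sum, Finset.smul_sum]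
  rw [Finset.sum_comm]
  refine Finset.sum_congr rfl fun c _ => Finset.sum_congr rfl fun l _ => ?_
  rw [smul_mul_assoc, mul_smul_comm, smul_comm, mul_assoc]

theorem minor_mul_entry_of_mem {q : K} (hq : q ≠ 0) {x : ℕ → ℕ → A} (hx : Manin q x)
    {R I : Finset ℕ} (hRI : R.card = I.card) {i j : ℕ} (hi : i ∈ R) (hj : j ∈ I) :
    minor q x R I * x i j = x i j * minor q x R I := by
  have h := minor_mul_entry hq hx hi I j
  rw [Finset.sum_eq_single_of_mem j hj, if_neg (Finset.notMem_erase j I),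
    Finset.insert_erase hj, above_erase_of_le le_rfl, mul_smul_comm, smul_smul, ← pow_add,
    below_add_above_of_mem hj, hRI] at h
  · exact smul_right_injective A (pow_ne_zero _ (neg_ne_zero.2 hq)) h
  · intro c _ hc
    rw [if_pos (Finset.mem_erase.2 ⟨hc.symm, hj⟩), mul_zero, smul_zero]

theorem entry_mul_minor {q : K} (hq : q ≠ 0) {x : ℕ → ℕ → A} (hx : Manin q x)
    {R I : Finset ℕ} (hRI : R.card = I.card) {i j : ℕ} (hi : i ∈ R) (hj : j ∉ I) :
    (-q) ^ (R.card - 1) • (q • (x i j * minor q x R I)) =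
      ∑ c ∈ I, (-q) ^ (below (insert j I) c + above I j) •
        (x i c * minor q x R (insert j (I.erase c))) := by
  have h := sum_mul_minor_erase_insert hq hx hi (insert j I)
  rw [Finset.sum_insert hj, Finset.erase_insert hj, add_eq_zero_iff_eq_neg'] at h
  have h' := congrArg (fun t => (-q) ^ above I j • t) h
  have hb : below (insert j I) j = below I j := by
    rw [← below_erase_of_le (S := insert j I) le_rfl, Finset.erase_insert hj]
  have hR : R.card = R.card - 1 + 1 := (Nat.succ_pred_eq_of_pos (Finset.card_pos.2 ⟨i, hi⟩)).symm
  simp only [hb, smul_neg, smul_smul, ← pow_add, Finset.smul_sum] at h'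
  rw [add_comm, below_add_above hj, ← hRI, hR, pow_succ, mul_neg, neg_smul, neg_neg] at h'
  rw [smul_smul, ← h']
  refine Finset.sum_congr rfl fun c hc => ?_
  have hjc : j ≠ c := fun h => hj (by rwa [h])
  rw [add_comm, Finset.erase_insert_of_ne hjc]

/-- Up to the factor `t` and a combination of columns from `C`, the element `D` commutes with
the `j`-th column of `x`. -/
def CommutesModulo (x : ℕ → ℕ → A) (D : A) (t : K) (C : Finset ℕ) (j : ℕ) : Prop :=
  ∃ a : ℕ → A, ∀ i, D * x i j = t • (x i j * D) + ∑ c ∈ C, x i c * a c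

theorem commutesModulo_of_mem {q : K} (hq : q ≠ 0) {x : ℕ → ℕ → A} (hx : Manin q x)
    {R I : Finset ℕ} (hRI : R.card = I.card) (hR : ∀ i ∉ R, ∀ j, x i j = 0)
    (C : Finset ℕ) {j : ℕ} (hj : j ∈ I) :
    CommutesModulo x (minor q x R I) (1 : K) C j := by
  refine ⟨0, fun i => ?_⟩
  by_cases hi : i ∈ R
  · simp [minor_mul_entry_of_mem hq hx hRI hi hj]
  · simp [hR i hi]

theorem commutesModulo_of_notMem {q : K} (hq : q ≠ 0) {x : ℕ → ℕ → A} (hx : Manin q x)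
    {R I : Finset ℕ} (hRI : R.card = I.card) (hR : ∀ i ∉ R, ∀ j, x i j = 0)
    {C : Finset ℕ} {j : ℕ} (hj : j ∉ I) (s : K)
    (hC : ∀ c ∈ I, c ∉ C → (-q) ^ (below I c + above (I.erase c) j) =
      s * (-q) ^ (below (insert j I) c + above I j)) :
    CommutesModulo x (minor q x R I) (s * q) C j := by
  set b : ℕ → A := fun c => ((-q) ^ (R.card - 1))⁻¹ •
    (((-q) ^ (below I c + above (I.erase c) j) -
      s * (-q) ^ (below (insert j I) c + above I j)) • minor q x R (insert j (I.erase c))) with hb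
  refine ⟨fun c => if c ∈ I then b c else 0, fun i => ?_⟩
  by_cases hi : i ∈ R
  swap
  · simp [hR i hi]
  have hCI : ∑ c ∈ C, x i c * (if c ∈ I then b c else 0) = ∑ c ∈ I, x i c * b c := by
    simp only [mul_ite, mul_zero]
    rw [← Finset.sum_filter, ← Finset.sum_filter_of_ne (s := I) (p := (· ∈ C))]
    · congr 1
      ext c
      simp only [Finset.mem_filter]
      tauto
    · intro c hc h
      by_contra hcC
      apply h
      rw [hb]
      simp only
      rw [hC c hc hcC, sub_self, zero_smul, smul_zero, mul_zero]
  have hu : (-q) ^ (R.card - 1) ≠ 0 := pow_ne_zero _ (neg_ne_zero.2 hq)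
  rw [hCI, ← sub_eq_iff_eq_add']
  apply smul_right_injective A hu
  simp only
  rw [smul_sub, mul_smul, smul_comm _ s, entry_mul_minor hq hx hRI hi hj,
    minor_mul_entry hq hx hi, Finset.smul_sum, Finset.smul_sum, ← Finset.sum_sub_distrib]
  refine Finset.sum_congr rfl fun c _ => ?_
  rw [if_neg fun h => hj (Finset.mem_of_mem_erase h), hb]
  simp only
  rw [mul_smul_comm, mul_smul_comm, smul_inv_smul₀ hu, mul_smul_comm, smul_smul, ← pow_add,
    sub_smul, smul_smul]

theorem commutesModulo_of_gt {q : K} (hq : q ≠ 0) {x : ℕ → ℕ → A} (hx : Manin q x)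
    {R I : Finset ℕ} (hRI : R.card = I.card) (hR : ∀ i ∉ R, ∀ j, x i j = 0)
    {C : Finset ℕ} {j : ℕ} (hj : j ∉ I) (hC : ∀ c ∈ I, c ∉ C → c < j) :
    CommutesModulo x (minor q x R I) q C j := by
  have h := commutesModulo_of_notMem hq hx hRI hR (C := C) hj 1 fun c hc hcC => by
    have hcj := hC c hc hcC
    rw [one_mul, above_erase_of_le hcj.le, ← below_erase_of_le (S := insert j I) hcj.le,
      Finset.erase_insert hj]
  rwa [one_mul] at h

theorem commutesModulo_of_lt {q : K} (hq : q ≠ 0) {x : ℕ → ℕ → A} (hx : Manin q x)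
    {R I : Finset ℕ} (hRI : R.card = I.card) (hR : ∀ i ∉ R, ∀ j, x i j = 0)
    {C : Finset ℕ} {j : ℕ} (hj : j ∉ I) (hC : ∀ c ∈ I, c ∉ C → j < c) :
    CommutesModulo x (minor q x R I) q⁻¹ C j := by
  have h := commutesModulo_of_notMem hq hx hRI hR (C := C) hj (q⁻¹ * q⁻¹) fun c hc hcC => by
    have hcj := hC c hc hcC
    rw [← above_erase_add_one hc hcj,
      ← below_erase_add_one (Finset.mem_insert_self j I) hcj, Finset.erase_insert hj]
    field_simp
    ring
  rwa [mul_assoc, inv_mul_cancel₀ hq, mul_one] at h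

theorem wedge_add (q : K) (v : ℕ → A) (F G : Finset ℕ → A) :
    wedge q v (F + G) = wedge q v F + wedge q v G := by
  funext S
  simp only [wedge, Pi.add_apply, mul_add, smul_add, Finset.sum_add_distrib]

/-- The iterated wedge product as a linear map. -/
def wedgeListHom (q : K) (x : ℕ → ℕ → A) (l : List ℕ) :
    (Finset ℕ → A) →ₗ[K] (Finset ℕ → A) where
  toFun := wedgeList q x l
  map_smul' s F := wedgeList_smul q s x l F
  map_add' F G := by
    induction l with
    | nil => rfl
    | cons i l ih => rw [wedgeList_cons, ih, wedge_add, wedgeList_cons, wedgeList_cons]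

theorem mul_wedge (q : K) {x : ℕ → ℕ → A} {D : A} {t : K} {C : Finset ℕ} {j : ℕ} {a : ℕ → A}
    (h : ∀ i, D * x i j = t • (x i j * D) + ∑ c ∈ C, x i c * a c) (F : Finset ℕ → A) :
    (fun S => D * wedge q (transp x j) F S) = t • wedge q (transp x j) (fun S => D * F S) +
      ∑ c ∈ C, wedge q (transp x c) (fun S => a c * F S) := by
  funext S
  simp only [Pi.add_apply, Pi.smul_apply, Finset.sum_apply, wedge, Finset.mul_sum]
  rw [Finset.sum_comm, Finset.smul_sum, ← Finset.sum_add_distrib]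
  refine Finset.sum_congr rfl fun i _ => ?_
  rw [mul_smul_comm, ← mul_assoc, transp, h, ← Finset.smul_sum, smul_comm t, ← smul_add, add_mul,
    smul_mul_assoc, mul_assoc, Finset.sum_mul]
  simp only [mul_assoc, transp]

theorem wedgeList_mul_wedgeList {q : K} (hq : q ≠ 0) {x : ℕ → ℕ → A} (hx : Manin q x) {D : A}
    {t : K} {C : Finset ℕ} {l : List ℕ} (h : ∀ j ∈ l, CommutesModulo x D t C j) {P : List ℕ}
    (hP : ∀ c ∈ C, c ∈ P) (F : Finset ℕ → A) :
    wedgeList q (transp x) P (fun S => D * wedgeList q (transp x) l F S) =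
      t ^ l.length • wedgeList q (transp x) (P ++ l) (fun S => D * F S) := by
  induction l generalizing P with
  | nil => simp
  | cons j l ih =>
    rw [List.forall_mem_cons] at h
    obtain ⟨⟨a, ha⟩, h⟩ := h
    have hz : ∀ c ∈ C, wedgeListHom q (transp x) P (wedge q (transp x c)
        (fun S => a c * wedgeList q (transp x) l F S)) = 0 := by
      intro c hc
      have := wedgeList_append q (transp x) P [c] (fun S => a c * wedgeList q (transp x) l F S)
      refine this.symm.trans (wedgeList_eq_zero hq hx.transp ?_ _)
      have := hP c hc
      simp [List.nodup_append, this]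
    have hs : wedgeList q (transp x) P (wedge q (transp x j)
        (fun S => D * wedgeList q (transp x) l F S)) =
        wedgeList q (transp x) (P ++ [j]) (fun S => D * wedgeList q (transp x) l F S) := by
      rw [wedgeList_append, wedgeList_cons, wedgeList_nil]
    rw [wedgeList_cons, mul_wedge q ha]
    change wedgeListHom q (transp x) P _ = _
    rw [map_add, map_smul, map_sum, Finset.sum_eq_zero hz, add_zero]
    change t • wedgeList q (transp x) P _ = _
    rw [hs, ih h (fun c hc => List.mem_append_left _ (hP c hc)), smul_smul, List.append_assoc,
      List.singleton_append, List.length_cons, pow_succ']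

theorem wedgeList_mul_right (q : K) (x : ℕ → ℕ → A) (l : List ℕ) (F : Finset ℕ → A) (D : A) :
    wedgeList q x l (fun S => F S * D) = fun S => wedgeList q x l F S * D := by
  induction l with
  | nil => rfl
  | cons i l ih =>
    rw [wedgeList_cons, ih]
    funext S
    simp only [wedgeList_cons, wedge, Finset.sum_mul, smul_mul_assoc, mul_assoc]

theorem minor_mul_minor {q : K} (hq : q ≠ 0) {x : ℕ → ℕ → A} (hx : Manin q x)
    {R I : Finset ℕ} (hRI : R.card = I.card) (hR : ∀ i ∉ R, ∀ j, x i j = 0)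
    {J J₁ J₂ : Finset ℕ} (hdisj : Disjoint J₁ J₂) (hpart : J₁ ∪ J₂ = J \ I)
    (h1 : ∀ a ∈ J₁, ∀ b ∈ I \ J, a < b) (h2 : ∀ a ∈ I \ J, ∀ b ∈ J₂, a < b) (S : Finset ℕ) :
    minor q x R I * minor q x S J =
      q ^ ((J₂.card : ℤ) - (J₁.card : ℤ)) • (minor q x S J * minor q x R I) := by
  have hJ : ∀ j, j ∈ J ∧ j ∉ I ↔ j ∈ J₁ ∨ j ∈ J₂ := fun j => by
    rw [← Finset.mem_union, hpart, Finset.mem_sdiff]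
  simp only [Finset.mem_sdiff] at h1 h2
  set D := minor q x R I
  have k0 : ∀ j ∈ (I ∩ J).sort, CommutesModulo x D (1 : K) ∅ j := fun j hj =>
    commutesModulo_of_mem hq hx hRI hR _ (Finset.mem_inter.1 ((Finset.mem_sort _).1 hj)).1
  have k1 : ∀ j ∈ J₁.sort, CommutesModulo x D q⁻¹ (I ∩ J) j := fun j hj =>
    have hj := (Finset.mem_sort _).1 hj
    commutesModulo_of_lt hq hx hRI hR ((hJ j).2 (.inl hj)).2 fun c hc hcC =>
      h1 j hj c ⟨hc, fun h => hcC (Finset.mem_inter.2 ⟨hc, h⟩)⟩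
  have k2 : ∀ j ∈ J₂.sort, CommutesModulo x D q (I ∩ J) j := fun j hj =>
    have hj := (Finset.mem_sort _).1 hj
    commutesModulo_of_gt hq hx hRI hR ((hJ j).2 (.inr hj)).2 fun c hc hcC =>
      h2 c ⟨hc, fun h => hcC (Finset.mem_inter.2 ⟨hc, h⟩)⟩ j hj
  have key : (fun S => D * wedgeList q (transp x)
      ((I ∩ J).sort ++ (J₁.sort ++ J₂.sort)) (vac A) S) =
      q ^ ((J₂.card : ℤ) - (J₁.card : ℤ)) • fun S => wedgeList q (transp x)
      ((I ∩ J).sort ++ (J₁.sort ++ J₂.sort)) (vac A) S * D := by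
    have e0 := wedgeList_mul_wedgeList hq hx k0 (P := []) (by simp)
      (wedgeList q (transp x) (J₁.sort ++ J₂.sort) (vac A))
    have e1 := wedgeList_mul_wedgeList hq hx k1 (P := (I ∩ J).sort) (by simp)
      (wedgeList q (transp x) J₂.sort (vac A))
    have e2 := wedgeList_mul_wedgeList hq hx k2 (P := (I ∩ J).sort ++ J₁.sort)
      (by simp +contextual) (vac A)
    have hv : (fun S => D * vac A S) = fun S => vac A S * D := by
      funext S
      simp [vac]
    rw [← wedgeList_append] at e0 e1
    rw [wedgeList_nil, List.nil_append, one_pow, one_smul] at e0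
    rw [e0, e1, e2, hv, wedgeList_mul_right, smul_smul, List.append_assoc, Finset.length_sort,
      Finset.length_sort, zpow_sub₀ hq, zpow_natCast, zpow_natCast, inv_pow, mul_comm,
      div_eq_mul_inv]
  obtain ⟨s, hs⟩ := wedgeList_perm hq hx.transp
    (l := J.sort) (l' := (I ∩ J).sort ++ (J₁.sort ++ J₂.sort)) (by
      rw [List.perm_ext_iff_of_nodup (Finset.sort_nodup _ _)]
      · intro j
        have := hJ j
        simp only [Finset.mem_sort, List.mem_append, Finset.mem_inter]
        tauto
      · refine (Finset.sort_nodup _ _).append ((Finset.sort_nodup _ _).append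
          (Finset.sort_nodup _ _) ?_) ?_
        · intro j hj hj'
          rw [Finset.mem_sort] at hj hj'
          exact Finset.disjoint_left.1 hdisj hj hj'
        · intro j hj hj'
          have := hJ j
          simp only [Finset.mem_sort, List.mem_append, Finset.mem_inter] at hj hj'
          tauto)
  have key' := congrFun key S
  simp only [Pi.smul_apply] at key'
  rw [minor_transp hx S J, minor, hs, Pi.smul_apply, mul_smul_comm, key', smul_mul_assoc,
    smul_comm]

/-- The permutation of `Fin (k + 1)` sending `0` to `p` and acting on the remaining elements
like `σ`. -/
def consPerm {k : ℕ} (p : Fin (k + 1)) (σ : Equiv.Perm (Fin k)) : Equiv.Perm (Fin (k + 1)) :=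
  (finSuccEquiv' 0).trans ((Equiv.optionCongr σ).trans (finSuccEquiv' p).symm)

@[simp] theorem consPerm_zero {k : ℕ} (p : Fin (k + 1)) (σ : Equiv.Perm (Fin k)) :
    consPerm p σ 0 = p := by
  simp [consPerm]

@[simp] theorem consPerm_succ {k : ℕ} (p : Fin (k + 1)) (σ : Equiv.Perm (Fin k)) (i : Fin k) :
    consPerm p σ i.succ = p.succAbove (σ i) := by
  rw [consPerm, Equiv.trans_apply, ← Fin.succAbove_zero, finSuccEquiv'_succAbove]
  simp

theorem consPerm_bijective (k : ℕ) : Function.Bijective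
    fun z : Fin (k + 1) × Equiv.Perm (Fin k) => consPerm z.1 z.2 := by
  rw [Fintype.bijective_iff_injective_and_card]
  constructor
  · rintro ⟨p, σ⟩ ⟨p', σ'⟩ h
    simp only at h
    have h0 : p = p' := by simpa using congrArg (fun τ : Equiv.Perm (Fin (k + 1)) => τ 0) h
    subst h0
    congr 1
    ext i
    have hi := congrArg (fun τ : Equiv.Perm (Fin (k + 1)) => τ i.succ) h
    simp only [consPerm_succ, Fin.succAbove_right_inj] at hi
    rw [hi]
  · simp [Fintype.card_perm, Nat.factorial_succ]

theorem sum_succAbove_lt {k : ℕ} (p : Fin (k + 1)) :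
    ∑ b : Fin k, (if p.succAbove b < p then 1 else 0) = (p : ℕ) := by
  have h := Fin.sum_univ_succAbove (fun b : Fin (k + 1) => if b < p then 1 else 0) p
  rw [if_neg (lt_irrefl p), zero_add] at h
  rw [← h, ← Finset.card_filter, ← Fin.card_Iio]
  congr 1
  ext b
  simp

theorem permInversions_consPerm {k : ℕ} (p : Fin (k + 1)) (σ : Equiv.Perm (Fin k)) :
    permInversions (consPerm p σ) = p + permInversions σ := by
  simp only [permInversions, Finset.card_filter, Fintype.sum_prod_type, Fin.sum_univ_succ,
    consPerm_zero, consPerm_succ]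
  simp only [lt_irrefl, Fin.succ_pos, Fin.not_lt_zero, false_and, true_and, if_false, zero_add,
    Fin.succ_lt_succ_iff, Fin.succAbove_lt_succAbove_iff]
  rw [← sum_succAbove_lt p, Equiv.sum_comp σ (fun b => if p.succAbove b < p then 1 else 0)]

theorem below_orderEmbOfFin {k : ℕ} {J : Finset ℕ} (h : J.card = k) (p : Fin k) :
    below J (J.orderEmbOfFin h p) = p := by
  have hJ : J.filter (· < J.orderEmbOfFin h p) =
      (Finset.Iio p).map (J.orderEmbOfFin h).toEmbedding := by
    refine Eq.trans (congrArg (Finset.filter _) (Finset.map_orderEmbOfFin_univ J h).symm) ?_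
    rw [Finset.filter_map]
    congr 1
    ext b
    simp
  rw [below, hJ, Finset.card_map, Fin.card_Iio]

theorem orderEmbOfFin_erase {k : ℕ} {J : Finset ℕ} (h : J.card = k + 1) (p : Fin (k + 1))
    (h' : (J.erase (J.orderEmbOfFin h p)).card = k) (b : Fin k) :
    J.orderEmbOfFin h (p.succAbove b) = (J.erase (J.orderEmbOfFin h p)).orderEmbOfFin h' b := by
  refine congrFun (Finset.orderEmbOfFin_unique h'
    (f := fun b => J.orderEmbOfFin h (p.succAbove b)) (fun b => ?_) ?_) b
  · rw [Finset.mem_erase]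
    exact ⟨fun hb => Fin.succAbove_ne p b ((J.orderEmbOfFin h).injective hb),
      Finset.orderEmbOfFin_mem _ _ _⟩
  · exact (J.orderEmbOfFin h).strictMono.comp p.strictMono_succAbove

theorem sum_perm_eq_wedgeList (q : K) (x : ℕ → ℕ → A) {k : ℕ} (r : Fin k → ℕ) (J : Finset ℕ)
    (h : J.card = k) :
    ∑ σ : Equiv.Perm (Fin k), (-q) ^ permInversions σ •
      (List.ofFn (fun d => x (r d) (J.orderEmbOfFin h (σ d)))).prod =
    wedgeList q x (List.ofFn r) (vac A) J := by
  induction k generalizing J with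
  | zero =>
    rw [Finset.card_eq_zero] at h
    subst h
    simp [permInversions, vac]
  | succ k ih =>
    rw [← (consPerm_bijective k).sum_comp, Fintype.sum_prod_type, List.ofFn_succ, wedgeList_cons,
      wedge]
    conv_rhs => rw [← Finset.map_orderEmbOfFin_univ J h, Finset.sum_map]
    refine Finset.sum_congr rfl fun p _ => ?_
    have h' : (J.erase (J.orderEmbOfFin h p)).card = k := by
      rw [Finset.card_erase_of_mem (Finset.orderEmbOfFin_mem _ _ _), h, Nat.add_sub_cancel]
    rw [Finset.map_orderEmbOfFin_univ]
    change _ = (-q) ^ below J (J.orderEmbOfFin h p) • (x (r 0) (J.orderEmbOfFin h p) *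
      wedgeList q x (List.ofFn fun i => r i.succ) (vac A) (J.erase (J.orderEmbOfFin h p)))
    rw [← ih _ _ h', below_orderEmbOfFin, Finset.mul_sum, Finset.smul_sum]
    refine Finset.sum_congr rfl fun σ _ => ?_
    simp only [permInversions_consPerm, List.ofFn_succ, List.prod_cons, consPerm_zero,
      consPerm_succ, orderEmbOfFin_erase h p h', mul_smul_comm, smul_smul, pow_add]

theorem qMinor_eq_minor (q : K) (x : ℕ → ℕ → A) {R J : Finset ℕ} (h : R.card = J.card) :
    qMinor q x R J = minor q x R J := by
  rw [qMinor, dif_pos h, sum_perm_eq_wedgeList q x (R.orderEmbOfFin rfl) J h.symm, minor,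
    List.ofFn_eq_map, Finset.listMap_orderEmbOfFin_finRange]

theorem qMinor_congr (q : K) {x y : ℕ → ℕ → A} {R J : Finset ℕ}
    (h : ∀ i ∈ R, ∀ j ∈ J, x i j = y i j) : qMinor q x R J = qMinor q y R J := by
  unfold qMinor
  split_ifs with hc
  · refine Finset.sum_congr rfl fun σ _ => ?_
    congr 3
    funext d
    exact h _ (Finset.orderEmbOfFin_mem _ _ _) _ (Finset.orderEmbOfFin_mem _ _ _)
  · rfl

/-- The matrix `x` with the entries outside rows `1, …, d` and columns `1, …, n` set to zero. -/
def truncate (d n : ℕ) (x : ℕ → ℕ → A) (i j : ℕ) : A :=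
  if (1 ≤ i ∧ i ≤ d) ∧ 1 ≤ j ∧ j ≤ n then x i j else 0

theorem manin_truncate {q : K} {x : ℕ → ℕ → A} {m n d : ℕ} (hx : IsQMatrix q m n x)
    (hd : d ≤ m) : Manin q (truncate d n x) := by
  obtain ⟨h1, h2, h3, h4⟩ := hx
  constructor
  · intro i j k hjk
    by_cases h : (1 ≤ i ∧ i ≤ d) ∧ 1 ≤ j ∧ k ≤ n
    · have e1 : (1 ≤ i ∧ i ≤ d) ∧ 1 ≤ j ∧ j ≤ n := by omega
      have e2 : (1 ≤ i ∧ i ≤ d) ∧ 1 ≤ k ∧ k ≤ n := by omega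
      simp only [truncate, if_pos e1, if_pos e2]
      exact h1 i j k (by omega) (by omega) (by omega) hjk (by omega)
    · simp only [truncate]
      split_ifs <;> first | omega | simp
  · intro i l j hil
    by_cases h : (1 ≤ i ∧ l ≤ d) ∧ 1 ≤ j ∧ j ≤ n
    · have e1 : (1 ≤ i ∧ i ≤ d) ∧ 1 ≤ j ∧ j ≤ n := by omega
      have e2 : (1 ≤ l ∧ l ≤ d) ∧ 1 ≤ j ∧ j ≤ n := by omega
      simp only [truncate, if_pos e1, if_pos e2]
      exact h2 i l j (by omega) (by omega) (by omega) (by omega) (by omega)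
    · simp only [truncate]
      split_ifs <;> first | omega | simp
  · intro i l j k hil hjk
    by_cases h : (1 ≤ i ∧ l ≤ d) ∧ 1 ≤ j ∧ k ≤ n
    · have e1 : (1 ≤ i ∧ i ≤ d) ∧ 1 ≤ k ∧ k ≤ n := by omega
      have e2 : (1 ≤ l ∧ l ≤ d) ∧ 1 ≤ j ∧ j ≤ n := by omega
      simp only [truncate, if_pos e1, if_pos e2]
      exact h3 i l j k (by omega) hil (by omega) (by omega) hjk (by omega)
    · simp only [truncate]
      split_ifs <;> first | omega | simp
  · intro i l j k hil hjk
    by_cases h : (1 ≤ i ∧ l ≤ d) ∧ 1 ≤ j ∧ k ≤ n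
    · have e1 : (1 ≤ i ∧ i ≤ d) ∧ 1 ≤ k ∧ k ≤ n := by omega
      have e2 : (1 ≤ l ∧ l ≤ d) ∧ 1 ≤ j ∧ j ≤ n := by omega
      have e3 : (1 ≤ i ∧ i ≤ d) ∧ 1 ≤ j ∧ j ≤ n := by omega
      have e4 : (1 ≤ l ∧ l ≤ d) ∧ 1 ≤ k ∧ k ≤ n := by omega
      simp only [truncate, if_pos e1, if_pos e2, if_pos e3, if_pos e4]
      exact h4 i l j k (by omega) hil (by omega) (by omega) hjk (by omega)
    · simp only [truncate]
      split_ifs <;> first | omega | simp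

theorem flagMinor_eq_minor_truncate (q : K) (x : ℕ → ℕ → A) {d n : ℕ} {J : Finset ℕ}
    (hJ : J ⊆ Finset.Icc 1 n) (hd : J.card ≤ d) :
    flagMinor q x J = minor q (truncate d n x) (Finset.Icc 1 J.card) J := by
  rw [← qMinor_eq_minor q _ (by simp)]
  refine qMinor_congr q fun i hi j hj => ?_
  have hi := Finset.mem_Icc.1 hi
  exact (if_pos ⟨⟨hi.1, hi.2.trans hd⟩, Finset.mem_Icc.1 (hJ hj)⟩).symm

end QuantumMinor

/-- Leclerc–Zelevinsky quasicommutation ("if" direction): weakly separated flag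
quantum minors quasicommute, with explicit exponent `|J₂| - |J₁|`. -/
theorem flagMinor_quasicommute
    {K A : Type} [Field K] [Ring A] [Algebra K A] {m n : ℕ}
    (q : K) (hq : q ≠ 0) (x : ℕ → ℕ → A) (hx : IsQMatrix q m n x)
    (I J : Finset ℕ) (hIn : I ⊆ Finset.Icc 1 n) (hJn : J ⊆ Finset.Icc 1 n)
    (hJI : J.card ≤ I.card) (hIm : I.card ≤ m)
    (J₁ J₂ : Finset ℕ) (hdisj : Disjoint J₁ J₂) (hpart : J₁ ∪ J₂ = J \ I)
    (h1 : finsetLT J₁ (I \ J)) (h2 : finsetLT (I \ J) J₂) :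
    flagMinor q x I * flagMinor q x J =
      (q ^ ((J₂.card : ℤ) - (J₁.card : ℤ))) • (flagMinor q x J * flagMinor q x I) := by
  rw [QuantumMinor.flagMinor_eq_minor_truncate q x hIn le_rfl,
    QuantumMinor.flagMinor_eq_minor_truncate q x hJn hJI]
  refine QuantumMinor.minor_mul_minor hq (QuantumMinor.manin_truncate hx hIm) (by simp)
    (fun i hi j => if_neg fun h => hi (Finset.mem_Icc.2 h.1)) hdisj hpart h1 h2 _
end
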